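/- Fix positive integers k and d. For a prime power q, let Z_q denote the (random) number of points x ∈ F_q^k at which all of k independently chosen uniformly random polynomials from F_q[X_1,…,X_k]_{≤d} vanish simultaneously. Then: (a) for every ε > 0 there exists Q such that for all prime powers q ≥ Q, the probability that Z_q = d^k is at least (1 − ε)/(d^k)!; and (b) there exists a constant C > 0 such that for all prime powers q, the probability that Z_q > d^k is at most C·q^{−d}. -/

import Mathlib

namespace S5
open MvPolynomial

noncomputable def cc (m N : ℕ) : ℕ := Nat.card {e : Fin m → ℕ // ∑ i, e i ≤ N}

lemma finite_cc (m N : ℕ) : Finite {e : Fin m → ℕ // ∑ i, e i ≤ N} := by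
  apply Finite.of_injective (β := Fin m → Fin (N+1))
    (fun e i => ⟨e.1 i, Nat.lt_succ_of_le ((Finset.single_le_sum (f := e.1) (fun _ _ => Nat.zero_le _) (Finset.mem_univ i)).trans e.2)⟩)
  intro e e' h
  ext i
  have := congrFun h i
  simpa using this

lemma cc_le (m N : ℕ) : cc m N ≤ (N+1)^m := by
  have : Nat.card (Fin m → Fin (N+1)) = (N+1)^m := by simp
  rw [← this]
  apply Nat.card_le_card_of_injective
    (fun (e : {e : Fin m → ℕ // ∑ i, e i ≤ N}) (i : Fin m) => (⟨e.1 i, Nat.lt_succ_of_le ((Finset.single_le_sum (f := e.1) (fun _ _ => Nat.zero_le _) (Finset.mem_univ i)).trans e.2)⟩ : Fin (N+1)))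
  intro e e' h
  ext i
  have := congrFun h i
  simpa using this

lemma cc_pos (m N : ℕ) : 0 < cc m N := by
  have := finite_cc m N
  have : Nonempty {e : Fin m → ℕ // ∑ i, e i ≤ N} := ⟨⟨0, by simp⟩⟩
  exact Nat.card_pos

lemma cc_scale (m d N : ℕ) (hd : 0 < d) : cc m (d * N + d ^ m) ≤ d ^ m * cc m (N + d ^ m) := by
  have h1 : Nat.card ((Fin m → Fin d) × {e : Fin m → ℕ // ∑ i, e i ≤ N + d^m}) = d ^ m * cc m (N + d ^ m) := by
    simp [cc]
  rw [← h1]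
  have := finite_cc m (N + d^m)
  apply Nat.card_le_card_of_injective
    (fun (e : {e : Fin m → ℕ // ∑ i, e i ≤ d * N + d ^ m}) =>
      ((fun i => (⟨e.1 i % d, Nat.mod_lt _ hd⟩ : Fin d),
      ⟨fun i => e.1 i / d, by
        have h2 : d * ∑ i, e.1 i / d ≤ d * (N + d ^ m) := by
          rw [Finset.mul_sum]
          calc ∑ i, d * (e.1 i / d) ≤ ∑ i, e.1 i := Finset.sum_le_sum (fun i _ => Nat.mul_div_le _ _)
            _ ≤ d * N + d ^ m := e.2
            _ ≤ d * (N + d^m) := by nlinarith [Nat.zero_le (d^m)]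
        exact Nat.le_of_mul_le_mul_left h2 hd⟩) : (Fin m → Fin d) × {e : Fin m → ℕ // ∑ i, e i ≤ N + d^m}))
  intro e e' h
  ext i
  have ha := congrFun (congrArg Prod.fst h) i
  have hb := congrFun (congrArg Subtype.val (congrArg Prod.snd h)) i
  simp at ha hb
  rw [← Nat.div_add_mod (e.1 i) d, ← Nat.div_add_mod (e'.1 i) d, ha, hb]

lemma cc_growth (m D : ℕ) (hD : 0 < D) : ∃ N, D * cc m (N + D) < (D + 1) * cc m N := by
  by_contra! hcon
  have h : ∀ j, (D+1)^j ≤ D^j * cc m (j * D) := by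
    intro j
    induction j with
    | zero => have := cc_pos m 0; simp; omega
    | succ j ih =>
      calc (D+1)^(j+1) = (D+1) * (D+1)^j := by ring
        _ ≤ (D+1) * (D^j * cc m (j*D)) := Nat.mul_le_mul_left _ ih
        _ = D^j * ((D+1) * cc m (j*D)) := by ring
        _ ≤ D^j * (D * cc m (j*D + D)) := Nat.mul_le_mul_left _ (hcon _)
        _ = D^(j+1) * cc m ((j+1)*D) := by ring_nf
  have h2 : ∀ j : ℕ, (1 + 1/(D:ℝ))^j ≤ ((j:ℝ) * D + 1)^m := by
    intro j
    have h3 : ((D+1)^j : ℝ) ≤ D^j * ((j:ℝ) * D + 1)^m := by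
      have := (h j).trans (Nat.mul_le_mul_left _ (cc_le m (j*D)))
      exact_mod_cast this
    have hD' : (0:ℝ) < D := by exact_mod_cast hD
    have : (1 + 1/(D:ℝ)) = (D+1)/D := by field_simp
    rw [this, div_pow, div_le_iff₀ (by positivity)]
    linarith
  have hr : (1:ℝ) < 1 + 1/(D:ℝ) := by
    have : (0:ℝ) < 1/D := by positivity
    linarith
  have ht := tendsto_pow_const_div_const_pow_of_one_lt m hr
  have hev := ht.eventually (gt_mem_nhds (show (0:ℝ) < 1/((D+1:ℝ)^m) by positivity))
  obtain ⟨j, hj, hj1⟩ := (hev.and (Filter.eventually_ge_atTop 1)).exists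
  have h4 := h2 j
  have hj1' : (1:ℝ) ≤ j := by exact_mod_cast hj1
  have h5 : ((j:ℝ) * D + 1)^m ≤ (j:ℝ)^m * (D+1)^m := by
    rw [← mul_pow]
    apply pow_le_pow_left₀ (by positivity)
    nlinarith
  have hp : (0:ℝ) < (1 + 1/(D:ℝ))^j := by positivity
  rw [div_lt_div_iff₀ hp (by positivity)] at hj
  linarith

lemma finrank_rtd (L : Type*) [Field L] (m N : ℕ) :
    Module.finrank L (restrictTotalDegree (Fin m) L N) = cc m N := by
  unfold restrictTotalDegree
  rw [Module.finrank_eq_nat_card_basis (basisRestrictSupport L _)]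
  unfold cc
  refine Nat.card_congr ⟨fun e => ⟨fun i => e.1 i, ?_⟩, fun e => ⟨Finsupp.equivFunOnFinite.symm e.1, ?_⟩, ?_, ?_⟩
  · have := e.2
    simp [Finsupp.sum_fintype] at this
    exact this
  · have := e.2
    simpa [Finsupp.sum_fintype] using this
  · intro e; ext i; simp
  · intro e; ext i; simp

lemma totalDegree_aeval_le {L : Type*} [Field L] {σ τ : Type*} (g : σ → MvPolynomial τ L) (d : ℕ)
    (hg : ∀ i, (g i).totalDegree ≤ d) (p : MvPolynomial σ L) :
    (aeval g p).totalDegree ≤ d * p.totalDegree := by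
  rw [aeval_def, eval₂_eq]
  refine totalDegree_finsetSum_le fun e he => ?_
  refine (totalDegree_mul _ _).trans ?_
  rw [algebraMap_eq, totalDegree_C, zero_add]
  refine (totalDegree_finsetProd _ _).trans ?_
  calc ∑ i ∈ e.support, (g i ^ e i).totalDegree ≤ ∑ i ∈ e.support, d * e i := by
        refine Finset.sum_le_sum fun i _ => (totalDegree_pow _ _).trans ?_
        rw [mul_comm]; exact Nat.mul_le_mul_right _ (hg i)
    _ = d * e.sum (fun _ n => n) := by rw [← Finset.mul_sum]; rfl
    _ ≤ _ := Nat.mul_le_mul_left _ (le_totalDegree he)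

lemma perron {L : Type*} [Field L] (m d : ℕ) (hd : 0 < d) (f : Fin m → MvPolynomial (Fin m) L)
    (hf : ∀ i, (f i).totalDegree ≤ d) (θ : MvPolynomial (Fin m) L) (hθ : θ.totalDegree ≤ 1) :
    ∃ P : Polynomial (MvPolynomial (Fin m) L), P ≠ 0 ∧ P.natDegree ≤ d ^ m ∧
      Polynomial.eval₂ (aeval f : MvPolynomial (Fin m) L →ₐ[L] MvPolynomial (Fin m) L).toRingHom θ P = 0 := by
  obtain ⟨N, hN⟩ := cc_growth m (d^m) (by positivity)
  let V := restrictTotalDegree (Fin m) L N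
  let W := restrictTotalDegree (Fin m) L (d * N + d ^ m)
  let φ : (Fin (d^m+1) → V) →ₗ[L] W :=
    LinearMap.codRestrict W
     (∑ i : Fin (d^m+1), (LinearMap.mulRight L (θ ^ (i:ℕ))) ∘ₗ (aeval f).toLinearMap ∘ₗ V.subtype ∘ₗ LinearMap.proj i) (by
      intro c
      rw [LinearMap.sum_apply]
      refine Submodule.sum_mem _ fun i _ => ?_
      rw [mem_restrictTotalDegree]
      simp only [LinearMap.comp_apply, LinearMap.mulRight_apply]
      refine (totalDegree_mul _ _).trans (add_le_add ?_ ?_)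
      · refine (totalDegree_aeval_le f d hf _).trans (Nat.mul_le_mul_left _ ?_)
        exact (mem_restrictTotalDegree _ _ _).1 (c i).2
      · refine (totalDegree_pow _ _).trans ?_
        have := i.2
        calc (i:ℕ) * θ.totalDegree ≤ (i:ℕ) * 1 := Nat.mul_le_mul_left _ hθ
          _ ≤ d^m := by omega)
  have hker : LinearMap.ker φ ≠ ⊥ := by
    apply LinearMap.ker_ne_bot_of_finrank_lt
    rw [Module.finrank_pi_fintype]
    simp only [V, W, finrank_rtd, Finset.sum_const, Finset.card_univ, Fintype.card_fin, smul_eq_mul]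
    exact (cc_scale m d N hd).trans_lt hN
  obtain ⟨c, hc, hc0⟩ := (Submodule.ne_bot_iff _).1 hker
  refine ⟨∑ i : Fin (d^m+1), Polynomial.monomial (i:ℕ) (c i).1, ?_, ?_, ?_⟩
  · intro h0
    apply hc0
    funext i
    have := congrArg (fun P => Polynomial.coeff P (i:ℕ)) h0
    simp only [Polynomial.finsetSum_coeff, Polynomial.coeff_monomial, Polynomial.coeff_zero] at this
    rw [Finset.sum_eq_single i] at this
    · simpa using this
    · intro b _ hb
      rw [if_neg]
      exact fun h => hb (Fin.ext h)
    · simp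
  · refine Polynomial.natDegree_sum_le_of_forall_le _ _ fun i _ => ?_
    exact (Polynomial.natDegree_monomial_le _).trans (by have := i.2; omega)
  · have := congrArg Subtype.val (LinearMap.mem_ker.1 hc)
    simp only [φ, LinearMap.codRestrict_apply, LinearMap.sum_apply] at this
    rw [Polynomial.eval₂_finsetSum]
    simpa [Polynomial.eval₂_monomial] using this
end S5

namespace S5
open MvPolynomial

lemma exists_separating {K : Type*} [Field K] (m : ℕ) (V : Finset (Fin m → K)) (S : Finset K)
    (hS : V.card * V.card * m < S.card) :
    ∃ l : Fin m → K, ∀ x ∈ V, ∀ y ∈ V, ∑ i, l i * x i = ∑ i, l i * y i → x = y := by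
  classical
  by_contra! hcon
  let pp : (Fin m → K) × (Fin m → K) → Polynomial K :=
    fun xy => ∑ i : Fin m, Polynomial.monomial (i:ℕ) (xy.1 i - xy.2 i)
  have hsub : S ⊆ ((V ×ˢ V).filter (fun xy => xy.1 ≠ xy.2)).biUnion (fun xy => (pp xy).roots.toFinset) := by
    intro c hc
    obtain ⟨x, hx, y, hy, hxy, hne⟩ := hcon (fun i => c ^ (i:ℕ))
    rw [Finset.mem_biUnion]
    refine ⟨(x, y), by simp [hx, hy, hne], ?_⟩
    rw [Multiset.mem_toFinset, Polynomial.mem_roots']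
    constructor
    · intro h0
      apply hne
      funext i
      have := congrArg (fun P => Polynomial.coeff P (i:ℕ)) h0
      simp only [pp, Polynomial.finsetSum_coeff, Polynomial.coeff_monomial, Polynomial.coeff_zero] at this
      rw [Finset.sum_eq_single i] at this
      · simpa [sub_eq_zero] using this
      · intro b _ hb
        rw [if_neg]
        exact fun h => hb (Fin.ext h)
      · simp
    · simp only [pp, Polynomial.IsRoot, Polynomial.eval_finsetSum, Polynomial.eval_monomial]
      rw [← sub_eq_zero, ← Finset.sum_sub_distrib] at hxy
      rw [← hxy]
      exact Finset.sum_congr rfl fun i _ => by ring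
  have h1 := Finset.card_le_card hsub
  have h2 := h1.trans Finset.card_biUnion_le
  have h3 : ∀ xy ∈ ((V ×ˢ V).filter (fun xy => xy.1 ≠ xy.2)), (pp xy).roots.toFinset.card ≤ m := by
    intro xy _
    refine (Multiset.toFinset_card_le _).trans ((Polynomial.card_roots' _).trans ?_)
    refine Polynomial.natDegree_sum_le_of_forall_le _ _ fun i _ => ?_
    exact (Polynomial.natDegree_monomial_le _).trans i.2.le
  have h4 := h2.trans (Finset.sum_le_card_nsmul _ _ _ h3)
  have h5 : ((V ×ˢ V).filter (fun xy => xy.1 ≠ xy.2)).card ≤ V.card * V.card := by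
    rw [← Finset.card_product]; exact Finset.card_filter_le _ _
  rw [smul_eq_mul] at h4
  have := Nat.mul_le_mul_right m h5
  omega

lemma height_poly_ker {A L : Type*} [CommRing A] [IsNoetherianRing A] [Field L] (ev : Polynomial A →+* L)
    (h : Function.Surjective ev) :
    (RingHom.ker ev).height = (RingHom.ker (ev.comp Polynomial.C)).height + 1 := by
  have : (RingHom.ker ev).IsMaximal := RingHom.ker_isMaximal_of_surjective _ h
  have : (RingHom.ker ev).LiesOver (RingHom.ker (ev.comp Polynomial.C)) := by
    constructor
    ext a
    simp [Ideal.under, RingHom.mem_ker]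
  exact Polynomial.height_eq_height_add_one _ _

lemma height_point {L : Type*} [Field L] (m : ℕ) (z : Fin m → L) :
    (m : ℕ∞) ≤ (RingHom.ker (eval z)).height := by
  induction m with
  | zero => simp
  | succ m ih =>
    let e := (finSuccEquiv L m).toRingEquiv
    let ev : Polynomial (MvPolynomial (Fin m) L) →+* L := (eval z).comp (e.symm : _ →+* _)
    have hevC : ev.comp Polynomial.C = eval (fun i => z i.succ) := by
      apply MvPolynomial.ringHom_ext
      · intro a
        have : e.symm (Polynomial.C (C a)) = C a := by
          rw [RingEquiv.symm_apply_eq]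
          exact ((finSuccEquiv L m).commutes a).symm
        simp only [ev, RingHom.comp_apply, RingHom.coe_coe, this, eval_C]
      · intro i
        have : e.symm (Polynomial.C (X i)) = X i.succ := by
          rw [RingEquiv.symm_apply_eq]
          exact finSuccEquiv_X_succ.symm
        simp only [ev, RingHom.comp_apply, RingHom.coe_coe, this, eval_X]
    have hs : Function.Surjective (ev.comp Polynomial.C) := by
      rw [hevC]; intro a; exact ⟨C a, by simp⟩
    have hh := height_poly_ker ev (fun a => by obtain ⟨b, hb⟩ := hs a; exact ⟨_, hb⟩)
    have hk : RingHom.ker ev = (RingHom.ker (eval z)).comap (e.symm : _ ≃+* _) := by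
      ext p; rw [Ideal.mem_comap, RingHom.mem_ker, RingHom.mem_ker]; rfl
    rw [hk, RingEquiv.height_comap, hevC] at hh
    rw [hh]
    push_cast
    gcongr
    exact ih _

lemma factor_X {L : Type*} [Field L] (P : Polynomial (Polynomial L)) (hP : P ≠ 0) :
    ∃ (e : ℕ) (P' : Polynomial (Polynomial L)), P = Polynomial.C (Polynomial.X ^ e) * P' ∧
      P'.map (Polynomial.evalRingHom 0) ≠ 0 := by
  obtain ⟨e, P', h1, h2⟩ := WfDvdMonoid.max_power_factor hP
    (Polynomial.prime_C_iff.2 (Polynomial.prime_X (R := L))).irreducible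
  refine ⟨e, P', by rw [h2, map_pow], fun h0 => h1 ?_⟩
  rw [Polynomial.C_dvd_iff_dvd_coeff]
  intro i
  rw [Polynomial.X_dvd_iff, Polynomial.coeff_zero_eq_eval_zero]
  simpa using congrArg (fun p => Polynomial.coeff p i) h0

lemma bezout {L : Type*} [Field L] [IsAlgClosed L] (m d : ℕ) (hd : 0 < d)
    (f : Fin m → MvPolynomial (Fin m) L) (hf : ∀ i, (f i).totalDegree ≤ d)
    (hV : {z : Fin m → L | ∀ i, eval z (f i) = 0}.Finite) :
    {z : Fin m → L | ∀ i, eval z (f i) = 0}.ncard ≤ d ^ m := by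
  classical
  set V := hV.toFinset with hVdef
  have hmemV : ∀ z, z ∈ V ↔ ∀ i, eval z (f i) = 0 := fun z => by simp [hVdef]
  obtain ⟨S, -, hS⟩ := Set.Infinite.exists_subset_card_eq (Set.infinite_univ (α := L)) (V.card * V.card * m + 1)
  obtain ⟨l, hl⟩ := exists_separating m V S (by omega)
  let θ : MvPolynomial (Fin m) L := ∑ i, C (l i) * X i
  have hθd : θ.totalDegree ≤ 1 := by
    refine totalDegree_finsetSum_le fun i _ => ?_
    refine (totalDegree_mul _ _).trans ?_
    simp
  have hθe : ∀ z, eval z θ = ∑ i, l i * z i := fun z => by simp [θ]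
  obtain ⟨P, hP0, hPd, hPe⟩ := perron m d hd f hf θ hθd
  obtain ⟨i0, hi0⟩ : ∃ i, P.coeff i ≠ 0 := by
    by_contra! h; exact hP0 (Polynomial.ext (by simpa using h))
  obtain ⟨c, hc⟩ : ∃ c : Fin m → L, eval c (P.coeff i0) ≠ 0 := by
    by_contra! h; exact hi0 (MvPolynomial.funext (by simpa using h))
  let φ : MvPolynomial (Fin m) L →+* Polynomial L :=
    (aeval (fun i => Polynomial.X * Polynomial.C (c i)) : MvPolynomial (Fin m) L →ₐ[L] Polynomial L).toRingHom
  have hφ1 : (Polynomial.evalRingHom 1).comp φ = eval c := by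
    apply MvPolynomial.ringHom_ext
    · intro a; simp [φ]
    · intro i; simp [φ]
  have hPt : P.map φ ≠ 0 := by
    intro h
    have := congrArg (fun p => (Polynomial.coeff p i0).eval 1) h
    simp only [Polynomial.coeff_map, Polynomial.coeff_zero, Polynomial.eval_zero] at this
    apply hc
    rw [← hφ1]; exact this
  obtain ⟨e, P', hPP, hP'⟩ := factor_X _ hPt
  have hroot : ∀ z ∈ V, eval z θ ∈ (P'.map (Polynomial.evalRingHom 0)).roots.toFinset := by
    intro z hz
    rw [Multiset.mem_toFinset, Polynomial.mem_roots hP']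
    let ev : Polynomial (MvPolynomial (Fin m) L) →+* L := Polynomial.eval₂RingHom (eval z) 0
    have hevC : ev.comp Polynomial.C = eval z := by
      apply MvPolynomial.ringHom_ext <;> intro a <;> simp [ev]
    have hsC : Function.Surjective (ev.comp Polynomial.C) := by
      rw [hevC]; intro a; exact ⟨C a, by simp⟩
    have hs : Function.Surjective ev := fun a => by obtain ⟨b, hb⟩ := hsC a; exact ⟨_, hb⟩
    have hmax : (RingHom.ker ev).IsMaximal := RingHom.ker_isMaximal_of_surjective _ hs
    have hht := height_poly_ker ev hs
    rw [hevC] at hht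
    have hht2 : ((m + 1 : ℕ) : ℕ∞) ≤ (RingHom.ker ev).height := by
      rw [hht]; push_cast; gcongr; exact height_point m z
    let gen : Fin m → Polynomial (MvPolynomial (Fin m) L) := fun i => Polynomial.C (f i) - Polynomial.X * Polynomial.C (C (c i))
    let gs : Finset (Polynomial (MvPolynomial (Fin m) L)) := Finset.univ.image gen
    have hle : Ideal.span (gs : Set (Polynomial (MvPolynomial (Fin m) L))) ≤ RingHom.ker ev := by
      rw [Ideal.span_le]
      intro x hx
      simp only [gs, Finset.coe_image, Set.mem_image, Finset.coe_univ, Set.mem_univ, true_and] at hx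
      obtain ⟨i, rfl⟩ := hx
      have := (hmemV z).1 hz i
      simp [gen, ev, RingHom.mem_ker, this]
    obtain ⟨Q, hQmin, hQle⟩ := Ideal.exists_minimalPrimes_le hle
    have hQp : Q.IsPrime := hQmin.1.1
    have hgen : ∀ i, gen i ∈ Q := fun i => hQmin.1.2 (Ideal.subset_span (by simp [gs]))
    have hQh : Q.height ≤ m := by
      have := Ideal.height_le_card_of_mem_minimalPrimes_span_finset hQmin
      refine this.trans ?_
      have h2 : gs.card ≤ m := Finset.card_image_le.trans (by simp)
      exact_mod_cast h2
    have hsQ : (Polynomial.X : Polynomial (MvPolynomial (Fin m) L)) ∉ Q := by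
      intro hX
      have hfQ : ∀ i, Polynomial.C (f i) ∈ Q := fun i => by
        have := Q.add_mem (hgen i) (Q.mul_mem_right (Polynomial.C (C (c i))) hX)
        simpa [gen] using this
      let Qc := Q.comap (Polynomial.C : MvPolynomial (Fin m) L →+* Polynomial (MvPolynomial (Fin m) L))
      have hQc : Qc.IsPrime := Ideal.comap_isPrime _ _
      have hnull := MvPolynomial.IsPrime.vanishingIdeal_zeroLocus (K := L) Qc
      have hXj : ∀ j, (X j - C (z j) : MvPolynomial (Fin m) L) ∈ Qc := by
        intro j
        have hzl : ∀ x ∈ zeroLocus L Qc, x ∈ V := by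
          intro x hx
          rw [hmemV]
          intro i
          have := hx (f i) (hfQ i)
          simpa using this
        have hprod : (∏ x ∈ V, (X j - C (x j) : MvPolynomial (Fin m) L)) ∈ Qc := by
          rw [← hnull, mem_vanishingIdeal_iff]
          intro x hx
          rw [map_prod]
          exact Finset.prod_eq_zero (hzl x hx) (by simp)
        rw [hQc.prod_mem_iff] at hprod
        obtain ⟨x, hxV, hx⟩ := hprod
        have h1 : ev (Polynomial.C (X j - C (x j))) = 0 := hQle hx
        have h2 : z j = x j := by
          have h3 : eval z (X j - C (x j)) = 0 := by rw [← hevC]; exact h1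
          simpa [sub_eq_zero] using h3
        rw [h2]; exact hx
      have : RingHom.ker ev ≤ Q := by
        have heq : Ideal.Quotient.mk Q = ((Ideal.Quotient.mk Q).comp ((Polynomial.C).comp (C : L →+* MvPolynomial (Fin m) L))).comp ev := by
          apply Polynomial.ringHom_ext'
          · apply MvPolynomial.ringHom_ext
            · intro a; simp [ev]
            · intro j
              have : Ideal.Quotient.mk Q (Polynomial.C (X j - C (z j))) = 0 :=
                Ideal.Quotient.eq_zero_iff_mem.2 (hXj j)
              rw [map_sub, map_sub, sub_eq_zero] at this
              simp [ev, this]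
          · simpa [ev] using Ideal.Quotient.eq_zero_iff_mem.2 hX
        intro p hp
        rw [← Ideal.Quotient.eq_zero_iff_mem, heq, RingHom.comp_apply, (RingHom.mem_ker).1 hp, map_zero]
      have h3 := (hht2.trans (Ideal.height_mono this)).trans hQh
      have h4 : m + 1 ≤ m := by exact_mod_cast h3
      omega
    let base : Polynomial L →+* Polynomial (MvPolynomial (Fin m) L) :=
      Polynomial.eval₂RingHom ((Polynomial.C).comp (C : L →+* MvPolynomial (Fin m) L)) Polynomial.X
    let Ψ : Polynomial (Polynomial L) →+* Polynomial (MvPolynomial (Fin m) L) := Polynomial.eval₂RingHom base (Polynomial.C θ)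
    have hcompat : (Ideal.Quotient.mk Q).comp (base.comp φ) =
        ((Ideal.Quotient.mk Q).comp (Polynomial.C)).comp (aeval f : MvPolynomial (Fin m) L →ₐ[L] _).toRingHom := by
      apply MvPolynomial.ringHom_ext
      · intro a; simp [φ, base]
      · intro i
        have := Ideal.Quotient.eq_zero_iff_mem.2 (hgen i)
        simp only [gen] at this
        rw [map_sub, sub_eq_zero] at this
        simp [φ, base, this]
    have h0 : Ideal.Quotient.mk Q (Ψ (P.map φ)) = 0 := by
      have h1 : Ideal.Quotient.mk Q (Ψ (P.map φ)) = Polynomial.eval₂ ((Ideal.Quotient.mk Q).comp (base.comp φ))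
          (Ideal.Quotient.mk Q (Polynomial.C θ)) P := by
        simp only [Ψ, Polynomial.coe_eval₂RingHom, Polynomial.eval₂_map, Polynomial.hom_eval₂]
      rw [h1, hcompat]
      have h2 := congrArg ((Ideal.Quotient.mk Q).comp (Polynomial.C)) hPe
      rw [Polynomial.hom_eval₂, map_zero] at h2
      exact h2
    rw [Ideal.Quotient.eq_zero_iff_mem, hPP, map_mul] at h0
    have h1 : Ψ (Polynomial.C (Polynomial.X ^ e)) = Polynomial.X ^ e := by
      rw [map_pow Polynomial.C, map_pow Ψ]; simp [Ψ, base]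
    rw [h1] at h0
    have h2 : Ψ P' ∈ Q := (hQp.mem_or_mem h0).resolve_left fun h => hsQ (hQp.mem_of_pow_mem _ h)
    have h3 : ev (Ψ P') = 0 := hQle h2
    have h4 : ev.comp base = Polynomial.evalRingHom 0 := by
      apply Polynomial.ringHom_ext <;> simp [ev, base]
    have h5 : ev (Polynomial.C θ) = eval z θ := by rw [← hevC]; rfl
    simp only [Ψ, Polynomial.coe_eval₂RingHom] at h3
    rw [Polynomial.hom_eval₂, h4, h5] at h3
    rw [Polynomial.IsRoot, Polynomial.eval_map]
    exact h3
  have hinj : Set.InjOn (fun z => eval z θ) (V : Set (Fin m → L)) := by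
    intro x hx y hy hxy
    exact hl x hx y hy (by simpa only [hθe] using hxy)
  rw [Set.ncard_eq_toFinset_card _ hV]
  calc V.card = (V.image (fun z => eval z θ)).card := (Finset.card_image_of_injOn hinj).symm
    _ ≤ (P'.map (Polynomial.evalRingHom 0)).roots.toFinset.card := Finset.card_le_card (by
        intro y hy
        obtain ⟨z, hz, rfl⟩ := Finset.mem_image.1 hy
        exact hroot z hz)
    _ ≤ (P'.map (Polynomial.evalRingHom 0)).natDegree :=
        (Multiset.toFinset_card_le _).trans (Polynomial.card_roots' _)
    _ ≤ P'.natDegree := Polynomial.natDegree_map_le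
    _ = (P.map φ).natDegree := by
        rw [hPP, Polynomial.natDegree_C_mul]
        exact pow_ne_zero _ Polynomial.X_ne_zero
    _ ≤ P.natDegree := Polynomial.natDegree_map_le
    _ ≤ d ^ m := hPd

end S5

namespace S5
open MvPolynomial

lemma totalDegree_algHom_le {F L : Type*} [Field F] [Field L] [Algebra F L] {σ τ : Type*}
    (ψ : MvPolynomial σ F →ₐ[F] MvPolynomial τ L)
    (hg : ∀ i, (ψ (X i)).totalDegree ≤ 1) (p : MvPolynomial σ F) :
    (ψ p).totalDegree ≤ p.totalDegree := by
  conv_lhs => rw [aeval_unique ψ, aeval_def, eval₂_eq]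
  refine totalDegree_finsetSum_le fun e he => ?_
  refine (totalDegree_mul _ _).trans ?_
  rw [show algebraMap F (MvPolynomial τ L) (coeff e p) = C (algebraMap F L (coeff e p)) from rfl,
    totalDegree_C, zero_add]
  refine (totalDegree_finsetProd _ _).trans ?_
  refine le_trans (Finset.sum_le_sum (g := fun i => e i) fun i _ => ?_) (le_totalDegree he)
  refine (totalDegree_pow _ _).trans ?_
  have := hg i
  simp only [Function.comp]
  nlinarith

instance finite_rtd (k d : ℕ) (F : Type*) [Field F] [Finite F] : Finite (restrictTotalDegree (Fin k) F d) :=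
  Module.finite_of_finite F

lemma card_kill {F L : Type*} [Field F] [Fintype F] [Field L] [Algebra F L] (k d : ℕ)
    (lam : MvPolynomial (Fin k) F →ₐ[F] L) (i : Fin k) (hi : Transcendental F (lam (X i))) :
    Nat.card {f : restrictTotalDegree (Fin k) F d // lam f.1 = 0} * Fintype.card F ^ (d+1) ≤
      Nat.card (restrictTotalDegree (Fin k) F d) := by
  have hmem : ∀ c : Fin (d+1) → F, (∑ j : Fin (d+1), C (c j) * X i ^ (j:ℕ)) ∈ restrictTotalDegree (Fin k) F d := by
    intro c
    rw [mem_restrictTotalDegree]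
    refine totalDegree_finsetSum_le fun j _ => ?_
    refine (totalDegree_mul _ _).trans ?_
    rw [totalDegree_C, zero_add]
    refine (totalDegree_pow _ _).trans ?_
    rw [totalDegree_X, mul_one]; omega
  let G : {f : restrictTotalDegree (Fin k) F d // lam f.1 = 0} × (Fin (d+1) → F) → restrictTotalDegree (Fin k) F d :=
    fun p => p.1.1 + ⟨_, hmem p.2⟩
  have hG : Function.Injective G := by
    rintro ⟨⟨f, hf⟩, c⟩ ⟨⟨f', hf'⟩, c'⟩ h
    have h1 := congrArg (fun f => lam f.1) h
    simp only [G, Submodule.coe_add, map_add, hf, hf', zero_add, map_sum, map_mul, map_pow] at h1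
    have hcc : c = c' := by
      have hp : (∑ j : Fin (d+1), Polynomial.monomial (j:ℕ) (c j - c' j)) = 0 := by
        by_contra hne
        apply hi
        refine ⟨_, hne, ?_⟩
        rw [← sub_eq_zero, ← Finset.sum_sub_distrib] at h1
        rw [map_sum, ← h1]
        refine Finset.sum_congr rfl fun j _ => ?_
        rw [Polynomial.aeval_monomial, map_sub, ← algebraMap_eq, AlgHom.commutes, AlgHom.commutes]
        ring
      funext j
      have := congrArg (fun P => Polynomial.coeff P (j:ℕ)) hp
      simp only [Polynomial.finsetSum_coeff, Polynomial.coeff_monomial, Polynomial.coeff_zero] at this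
      rw [Finset.sum_eq_single j] at this
      · simpa [sub_eq_zero] using this
      · intro b _ hb
        rw [if_neg]
        exact fun h => hb (Fin.ext h)
      · simp
    subst hcc
    simp only [G, add_left_inj] at h
    subst h; rfl
  have := Nat.card_le_card_of_injective G hG
  rw [Nat.card_prod] at this
  simpa using this

abbrev RF (L : Type) [Field L] : Type := FractionRing (Polynomial L)
abbrev RFc (L : Type) [Field L] : Type := AlgebraicClosure (RF L)

attribute [local instance] MvPolynomial.algebraMvPolynomial in
lemma ff_zero {L : Type} [Field L] (m : ℕ) (j : Fin (m+1)) (G : Set (MvPolynomial (Fin (m+1)) L))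
    (hinf : ((fun z : Fin (m+1) → L => z j) '' {z | ∀ g ∈ G, eval z g = 0}).Infinite) :
    ∃ z : Fin m → RFc L, ∀ g ∈ G,
      aeval (j.insertNth (algebraMap (Polynomial L) _ Polynomial.X) z :
        Fin (m+1) → RFc L) g = 0 := by
  classical
  let σ : MvPolynomial (Fin (m+1)) L →ₐ[L] MvPolynomial (Fin m) (Polynomial L) :=
    aeval (j.insertNth (C Polynomial.X) X : Fin (m+1) → MvPolynomial (Fin m) (Polynomial L))
  let I : Ideal (MvPolynomial (Fin m) (Polynomial L)) := Ideal.span (σ '' G)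
  have hI : I.map (algebraMap _ (MvPolynomial (Fin m) (RF L))) ≠ ⊤ := by
    rw [IsLocalization.map_algebraMap_ne_top_iff_disjoint ((nonZeroDivisors (Polynomial L)).map (C (σ := Fin m)))]
    rw [Set.disjoint_left]
    rintro _ ⟨b, hb, rfl⟩ hbI
    apply hinf
    have hb0 : b ≠ 0 := nonZeroDivisors.ne_zero hb
    refine Set.Finite.subset (b.roots.toFinset.finite_toSet) ?_
    rintro _ ⟨z, hz, rfl⟩
    simp only [Finset.mem_coe, Multiset.mem_toFinset]
    rw [Polynomial.mem_roots hb0]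
    let ev : MvPolynomial (Fin m) (Polynomial L) →ₐ[L] L :=
      { eval₂Hom (Polynomial.evalRingHom (z j)) (fun i => z (j.succAbove i)) with
        commutes' := fun a => by
          simp [IsScalarTower.algebraMap_apply L (Polynomial L) (MvPolynomial (Fin m) (Polynomial L)), algebraMap_eq] }
    have hevX : ∀ i, ev (X i) = z (j.succAbove i) := fun i => by simp [ev]
    have hevC : ∀ p, ev (C p) = p.eval (z j) := fun i => by simp [ev]
    have hcomp : ev.comp σ = aeval z := by
      apply MvPolynomial.algHom_ext
      intro i
      rw [AlgHom.comp_apply, aeval_X, aeval_X]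
      refine Fin.succAboveCases j ?_ (fun i => ?_) i
      · simp [hevC]
      · simp [hevX]
    have : I ≤ RingHom.ker ev := by
      rw [Ideal.span_le]
      rintro _ ⟨g, hg, rfl⟩
      have := hz g hg
      rw [SetLike.mem_coe, RingHom.mem_ker, ← AlgHom.comp_apply, hcomp]
      simpa [aeval_eq_eval] using this
    have h2 := this hbI
    rwa [RingHom.mem_ker, hevC] at h2
  obtain ⟨z, hz⟩ : (zeroLocus (RFc L) (I.map (algebraMap _ (MvPolynomial (Fin m) (RF L))))).Nonempty := by
    by_contra hne
    rw [Set.not_nonempty_iff_eq_empty] at hne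
    have := vanishingIdeal_zeroLocus_eq_radical (K := (RFc L)) (I.map (algebraMap _ (MvPolynomial (Fin m) (RF L))))
    rw [hne, vanishingIdeal_empty, eq_comm, Ideal.radical_eq_top] at this
    exact hI this
  refine ⟨z, fun g hg => ?_⟩
  have h1 := hz _ (Ideal.mem_map_of_mem _ (Ideal.subset_span ⟨g, hg, rfl⟩ : σ g ∈ I))
  rw [← h1]
  let big : MvPolynomial (Fin (m+1)) L →ₐ[L] (RFc L) :=
    ((aeval z : MvPolynomial (Fin m) (RF L) →ₐ[(RF L)] (RFc L)).restrictScalars L).comp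
     ((MvPolynomial.mapAlgHom (Algebra.ofId (Polynomial L) (RF L) |>.restrictScalars L)).comp σ)
  have hbig : big = aeval (j.insertNth (algebraMap (Polynomial L) _ Polynomial.X) z : Fin (m+1) → (RFc L)) := by
    apply MvPolynomial.algHom_ext
    intro i
    simp only [big, AlgHom.comp_apply, σ, aeval_X]
    refine Fin.succAboveCases j ?_ (fun i => ?_) i
    · simp [IsScalarTower.algebraMap_apply (Polynomial L) (RF L) (RFc L)]
    · simp
  rw [← hbig]
  rfl

lemma card_pairs {A B : Type*} [Fintype A] [Finite B] (R : A → B → Prop) :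
    Nat.card {p : A × B // R p.1 p.2} = ∑ a, Nat.card {b // R a b} := by
  rw [← Nat.card_sigma]
  refine Nat.card_congr ⟨fun p => ⟨p.1.1, p.1.2, p.2⟩, fun p => ⟨(p.1, p.2.1), p.2.2⟩, fun p => rfl, fun p => rfl⟩

lemma card_union_le {A ι : Type*} [Finite A] [Fintype ι] (P : A → Prop) (R : ι → A → Prop)
    (h : ∀ a, P a → ∃ i, R i a) : Nat.card {a // P a} ≤ ∑ i, Nat.card {a // R i a} := by
  classical
  rw [← Nat.card_sigma]
  choose f hf using h
  refine Nat.card_le_card_of_injective (fun a : {a // P a} => (⟨f a.1 a.2, a.1, hf _ _⟩ : Σ i, {a // R i a})) ?_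
  intro a b hab
  simp only [Sigma.mk.injEq] at hab
  obtain ⟨h1, h2⟩ := hab
  apply Subtype.ext
  have : ∀ (i j : ι) (x : {a // R i a}) (y : {a // R j a}), i = j → x ≍ y → x.1 = y.1 := by
    rintro i j x y rfl h; rw [eq_of_heq h]
  exact this _ _ _ _ h1 h2

/-- The substitution used in the inductive step. -/
noncomputable def sub1 {L : Type} [Field L] (m : ℕ) (j : Fin (m+1)) :
    MvPolynomial (Fin (m+1)) L →ₐ[L] MvPolynomial (Fin m) (RFc L) :=
  aeval (j.insertNth (C (algebraMap (Polynomial L) _ Polynomial.X)) X : Fin (m+1) → MvPolynomial (Fin m) (RFc L))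

lemma eval_sub1 {L : Type} [Field L] (m : ℕ) (j : Fin (m+1)) (z : Fin m → RFc L) (g) :
    eval z (sub1 m j g) = aeval (j.insertNth (algebraMap (Polynomial L) _ Polynomial.X) z :
        Fin (m+1) → RFc L) g := by
  have : ((aeval z : MvPolynomial (Fin m) (RFc L) →ₐ[RFc L] RFc L).restrictScalars L).comp (sub1 m j) =
    aeval (j.insertNth (algebraMap (Polynomial L) _ Polynomial.X) z : Fin (m+1) → RFc L) := by
    apply MvPolynomial.algHom_ext
    intro i
    simp only [AlgHom.comp_apply, sub1, aeval_X]
    refine Fin.succAboveCases j ?_ (fun i => ?_) i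
    · simp
    · simp
  rw [← this]
  simp [aeval_eq_eval]

lemma trans_X (F L : Type) [Field F] [Field L] [Algebra F L] :
    Transcendental F (algebraMap (Polynomial L) (RFc L) Polynomial.X) := by
  have h1 : Transcendental L (algebraMap (Polynomial L) (RFc L) Polynomial.X) := by
    rw [transcendental_algebraMap_iff]
    · exact Polynomial.transcendental_X L
    · rw [IsScalarTower.algebraMap_eq (Polynomial L) (RF L) (RFc L)]
      exact (algebraMap (RF L) (RFc L)).injective.comp (IsFractionRing.injective _ _)
  intro h
  exact h1 (h.extendScalars (algebraMap F L).injective)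

lemma infinite_prob (k d : ℕ) (hd : 0 < d) (m : ℕ) : ∃ Cm : ℕ, ∀ (F : Type) [Field F] [Fintype F]
    (L : Type) [Field L] [IsAlgClosed L] [Algebra F L]
    (ψ : MvPolynomial (Fin k) F →ₐ[F] MvPolynomial (Fin m) L) (_ : ∀ i, (ψ (X i)).totalDegree ≤ 1)
    (_ : ∀ j, ∃ i, ψ (X i) = X j),
    Nat.card {f : Fin m → restrictTotalDegree (Fin k) F d //
      {z : Fin m → L | ∀ i, eval z (ψ (f i).1) = 0}.Infinite} * Fintype.card F ^ (d+1) ≤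
    Cm * Nat.card (restrictTotalDegree (Fin k) F d) ^ m := by
  induction m with
  | zero =>
    refine ⟨0, fun F _ _ L _ _ _ ψ _ _ => ?_⟩
    have : IsEmpty {f : Fin 0 → restrictTotalDegree (Fin k) F d //
      {z : Fin 0 → L | ∀ i, eval z (ψ (f i).1) = 0}.Infinite} :=
      ⟨fun f => f.2 (Set.toFinite _)⟩
    simp
  | succ m ih =>
    obtain ⟨Cm, hCm⟩ := ih
    refine ⟨(m+1) * (Cm + d ^ m), fun F _ _ L _ _ _ ψ hdeg hsurj => ?_⟩
    classical
    set W := restrictTotalDegree (Fin k) F d with hW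
    have : Fintype (Fin m → W) := Fintype.ofFinite _
    let ψ' : Fin (m+1) → (MvPolynomial (Fin k) F →ₐ[F] MvPolynomial (Fin m) (RFc L)) := fun j =>
      ((sub1 m j).restrictScalars F).comp ψ
    have hψ'X : ∀ j i, ψ' j (X i) = sub1 m j (ψ (X i)) := fun j i => rfl
    have hdeg' : ∀ j i, (ψ' j (X i)).totalDegree ≤ 1 := by
      intro j i
      rw [hψ'X]
      refine (totalDegree_algHom_le (sub1 m j) ?_ _).trans (hdeg i)
      intro l
      simp only [sub1, aeval_X]
      refine Fin.succAboveCases j ?_ (fun l => ?_) l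
      · simp
      · simp
    have hsurj' : ∀ j l, ∃ i, ψ' j (X i) = X l := by
      intro j l
      obtain ⟨i, hi⟩ := hsurj (j.succAbove l)
      exact ⟨i, by rw [hψ'X, hi]; simp [sub1]⟩
    let Bad : Fin (m+1) → (Fin m → W) → Prop := fun j g =>
      {z : Fin m → RFc L | ∀ i, eval z (ψ' j (g i).1) = 0}.Infinite
    let R : Fin (m+1) → (Fin m → W) → W → Prop := fun j g f => Bad j g ∨
      (¬ Bad j g ∧ ∃ z : Fin m → RFc L, (∀ i, eval z (ψ' j (g i).1) = 0) ∧ eval z (ψ' j f.1) = 0)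
    have hcover : ∀ f : Fin (m+1) → W, {z : Fin (m+1) → L | ∀ i, eval z (ψ (f i).1) = 0}.Infinite →
        ∃ j, R j (Fin.init f) (f (Fin.last m)) := by
      intro f hf
      obtain ⟨j, hj⟩ : ∃ j, ((fun z : Fin (m+1) → L => z j) '' {z | ∀ i, eval z (ψ (f i).1) = 0}).Infinite := by
        by_contra! h
        refine hf ((Set.Finite.pi' h).subset ?_)
        intro z hz j
        exact ⟨z, hz, rfl⟩
      refine ⟨j, ?_⟩
      by_cases hb : Bad j (Fin.init f)
      · exact Or.inl hb
      right
      refine ⟨hb, ?_⟩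
      obtain ⟨z, hz⟩ := ff_zero m j (Set.range fun i => ψ (f i).1) (by simpa using hj)
      have hz' : ∀ i, eval z (ψ' j (f i).1) = 0 := fun i => by
        have := hz _ ⟨i, rfl⟩
        rw [← eval_sub1] at this
        exact this
      exact ⟨z, fun i => hz' _, hz' _⟩
    have hR : ∀ j g, Nat.card {f // R j g f} * Fintype.card F ^ (d+1) ≤
        (if Bad j g then 1 else 0) * (Nat.card W * Fintype.card F ^ (d+1)) + d ^ m * Nat.card W := by
      intro j g
      by_cases hb : Bad j g
      · rw [if_pos hb]
        have := Finite.card_subtype_le (R j g)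
        have := Nat.mul_le_mul_right (Fintype.card F ^ (d+1)) this
        omega
      · rw [if_neg hb, zero_mul, zero_add]
        have hfin : {z : Fin m → RFc L | ∀ i, eval z (ψ' j (g i).1) = 0}.Finite := by
          simpa [Bad] using hb
        have hbez := bezout m d hd (fun i => ψ' j (g i).1) (fun i =>
          (totalDegree_algHom_le (ψ' j) (hdeg' j) _).trans ((mem_restrictTotalDegree _ _ _).1 (g i).2)) hfin
        have : Fintype {z : Fin m → RFc L | ∀ i, eval z (ψ' j (g i).1) = 0} := hfin.fintype
        have hu := card_union_le (ι := {z : Fin m → RFc L | ∀ i, eval z (ψ' j (g i).1) = 0})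
          (R j g) (fun z f => eval z.1 (ψ' j f.1) = 0) (by
            rintro f (h | ⟨-, z, hz, hz'⟩)
            · exact absurd h hb
            · exact ⟨⟨z, hz⟩, hz'⟩)
        refine (Nat.mul_le_mul_right _ hu).trans ?_
        rw [Finset.sum_mul]
        refine (Finset.sum_le_card_nsmul _ _ (Nat.card W) ?_).trans ?_
        · rintro ⟨z, hz⟩ -
          obtain ⟨i, hi⟩ := hsurj j
          let lam : MvPolynomial (Fin k) F →ₐ[F] RFc L :=
            ((aeval z : MvPolynomial (Fin m) (RFc L) →ₐ[RFc L] RFc L).restrictScalars F).comp (ψ' j)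
          have hlam : ∀ f, lam f = eval z (ψ' j f) := fun f => by simp [lam, aeval_eq_eval]
          have := card_kill k d lam i (by
            rw [hlam, hψ'X, hi, eval_sub1]
            simpa using trans_X F L)
          simpa only [hlam] using this
        · rw [smul_eq_mul]
          refine Nat.mul_le_mul_right _ ?_
          rw [Finset.card_univ, ← Nat.card_eq_fintype_card]
          exact hbez
    have hsum : ∀ j, Nat.card {p : (Fin m → W) × W // R j p.1 p.2} * Fintype.card F ^ (d+1) ≤
        (Cm + d ^ m) * Nat.card W ^ (m+1) := by
      intro j
      rw [card_pairs (R j), Finset.sum_mul]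
      refine (Finset.sum_le_sum fun g _ => hR j g).trans ?_
      rw [Finset.sum_add_distrib, ← Finset.sum_mul, Finset.sum_boole, Finset.sum_const, smul_eq_mul, Finset.card_univ]
      have h1 := hCm F (RFc L) (ψ' j) (hdeg' j) (hsurj' j)
      have h2 : Nat.card {g : Fin m → W // Bad j g} = (Finset.univ.filter fun g => Bad j g).card := by
        rw [Nat.card_eq_fintype_card, Fintype.card_subtype]
      have h3 : Fintype.card (Fin m → W) = Nat.card W ^ m := by
        rw [← Nat.card_eq_fintype_card, Nat.card_fun, Nat.card_eq_fintype_card (α := Fin m), Fintype.card_fin]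
      rw [h3]
      change Nat.card {g : Fin m → W // Bad j g} * _ ≤ _ at h1
      rw [h2] at h1
      have h4 := Nat.mul_le_mul_right (Nat.card W) h1
      rw [pow_succ (Nat.card W) m]
      simp only [Nat.cast_id]
      nlinarith [h4]
    let E : (Fin (m+1) → W) ≃ (Fin m → W) × W := ⟨fun f => (Fin.init f, f (Fin.last m)), fun p => Fin.snoc (α := fun _ => W) p.1 p.2,
      fun f => by simp, fun p => by simp⟩
    have hu := card_union_le (fun p : (Fin m → W) × W =>
        {z : Fin (m+1) → L | ∀ i, eval z (ψ (E.symm p i).1) = 0}.Infinite) (fun j p => R j p.1 p.2) (by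
        intro p hp
        obtain ⟨j, hj⟩ := hcover _ hp
        refine ⟨j, ?_⟩
        have h1 := E.apply_symm_apply p
        have h2 : Fin.init (E.symm p) = p.1 := congrArg Prod.fst h1
        have h3 : E.symm p (Fin.last m) = p.2 := congrArg Prod.snd h1
        rwa [h2, h3] at hj)
    have hcongr : Nat.card {f : Fin (m+1) → W // {z : Fin (m+1) → L | ∀ i, eval z (ψ (f i).1) = 0}.Infinite} =
        Nat.card {p : (Fin m → W) × W // {z : Fin (m+1) → L | ∀ i, eval z (ψ (E.symm p i).1) = 0}.Infinite} :=
      Nat.card_congr (E.subtypeEquiv fun f => by simp only [Equiv.symm_apply_apply])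
    rw [hcongr]
    refine (Nat.mul_le_mul_right _ hu).trans ?_
    rw [Finset.sum_mul]
    refine (Finset.sum_le_card_nsmul _ _ _ fun j _ => hsum j).trans ?_
    simp [mul_assoc]

lemma partb (k d : ℕ) (hd : 0 < d) : ∃ Cm : ℕ, ∀ (F : Type) [Field F] [Fintype F],
    Nat.card {f : Fin k → restrictTotalDegree (Fin k) F d //
      d ^ k < Nat.card {x : Fin k → F // ∀ i, eval x (f i).1 = 0}} * Fintype.card F ^ (d+1) ≤
    Cm * Nat.card (restrictTotalDegree (Fin k) F d) ^ k := by
  obtain ⟨Cm, h⟩ := infinite_prob k d hd k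
  refine ⟨Cm, fun F _ _ => ?_⟩
  let L := AlgebraicClosure F
  let ψ : MvPolynomial (Fin k) F →ₐ[F] MvPolynomial (Fin k) L := mapAlgHom (Algebra.ofId F L)
  have hX : ∀ i, ψ (X i) = X i := fun i => by simp [ψ]
  have h0 := h F L ψ (fun i => by rw [hX]; simp) (fun j => ⟨j, hX j⟩)
  refine le_trans (Nat.mul_le_mul_right _ ?_) h0
  refine Nat.card_le_card_of_injective (fun f => ⟨f.1, ?_⟩) ?_
  · intro hfin
    have hb := bezout k d hd (fun i => ψ (f.1 i).1) (fun i =>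
      (totalDegree_algHom_le ψ (fun i => by rw [hX]; simp) _).trans
        ((mem_restrictTotalDegree _ _ _).1 (f.1 i).2)) hfin
    have h2 := f.2
    have : Finite {z : Fin k → L | ∀ i, eval z (ψ (f.1 i).1) = 0} := hfin
    have h3 : Nat.card {x : Fin k → F // ∀ i, eval x (f.1 i).1 = 0} ≤
        Nat.card {z : Fin k → L | ∀ i, eval z (ψ (f.1 i).1) = 0} := by
      refine Nat.card_le_card_of_injective (fun x => ⟨fun i => algebraMap F L (x.1 i), fun i => ?_⟩) ?_
      · have : eval (fun i => algebraMap F L (x.1 i)) (ψ (f.1 i).1) = algebraMap F L (eval x.1 (f.1 i).1) := by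
          have hc : (eval (fun i => algebraMap F L (x.1 i))).comp (ψ : MvPolynomial (Fin k) F →+* MvPolynomial (Fin k) L) =
              (algebraMap F L).comp (eval x.1) := by
            apply MvPolynomial.ringHom_ext
            · intro a; simp [ψ, Algebra.ofId_apply]
            · intro a; simp [ψ]
          exact congrArg (fun φ => φ (f.1 i).1) hc
        rw [this, x.2 i, map_zero]
      · intro x y hxy
        apply Subtype.ext
        funext i
        have := congrArg (fun z => z.1 i) hxy
        exact (algebraMap F L).injective this
    have h4 := h3.trans hb
    omega
  · intro f g hfg
    exact Subtype.ext (congrArg (fun z => z.1) hfg)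

end S5

namespace S5
open PowerSeries

/-- Contraction principle for tuples of power series, with coefficient constraints. -/
lemma contr {R : Type*} [CommRing R] {ι : Type*} (Φ : (ι → R⟦X⟧) → (ι → R⟦X⟧))
    (S : ι → ℕ → Set R) (hS0 : ∀ i m, (0:R) ∈ S i m)
    (hS : ∀ w : ι → R⟦X⟧, (∀ i m, coeff m (w i) ∈ S i m) → ∀ i m, coeff m (Φ w i) ∈ S i m)
    (hΦ : ∀ (x y : ι → R⟦X⟧) (N : ℕ), (∀ i, X ^ N ∣ x i - y i) → ∀ i, X ^ (N+1) ∣ Φ x i - Φ y i) :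
    ∃ x : ι → R⟦X⟧, Φ x = x ∧ ∀ i m, coeff m (x i) ∈ S i m := by
  let s : ℕ → (ι → R⟦X⟧) := fun N => Φ^[N] 0
  have hs : ∀ N, s (N+1) = Φ (s N) := fun N => Function.iterate_succ_apply' _ _ _
  have h1 : ∀ N i, X ^ N ∣ s (N+1) i - s N i := by
    intro N
    induction N with
    | zero => simp
    | succ N ih => intro i; rw [hs (N+1), hs N]; exact hΦ _ _ _ (by rw [← hs N]; exact ih) i
  have h2 : ∀ N P i, X ^ N ∣ s (N+P) i - s N i := by
    intro N P i
    induction P with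
    | zero => simp
    | succ P ih =>
      have := dvd_add ((pow_dvd_pow X (Nat.le_add_right N P)).trans (h1 (N+P) i)) ih
      simpa [add_assoc] using this
  have hin : ∀ N i m, coeff m (s N i) ∈ S i m := by
    intro N
    induction N with
    | zero => intro i m; simpa [s] using hS0 i m
    | succ N ih => rw [hs]; exact hS _ ih
  let x : ι → R⟦X⟧ := fun i => PowerSeries.mk fun m => coeff m (s (m+1) i)
  have h3 : ∀ N i, X ^ N ∣ x i - s N i := by
    intro N i
    rw [X_pow_dvd_iff]
    intro m hm
    obtain ⟨P, rfl⟩ := Nat.exists_eq_add_of_le (show m + 1 ≤ N from hm)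
    have := (X_pow_dvd_iff.1 (h2 (m+1) P i)) m (Nat.lt_succ_self m)
    rw [map_sub, sub_eq_zero] at this ⊢
    simp only [x, coeff_mk]
    exact this.symm
  refine ⟨x, ?_, fun i m => by simpa [x] using hin (m+1) i m⟩
  funext i
  ext m
  have h4 := hΦ _ _ _ (h3 m) i
  rw [← hs] at h4
  have h5 := dvd_sub h4 (h3 (m+1) i)
  have h6 := X_pow_dvd_iff.1 h5 m (Nat.lt_succ_self m)
  simp only [map_sub] at h6
  linear_combination h6

/-- `(t+a)^i = t^i + a * tA t a i`. -/
def tA {R : Type*} [CommRing R] (t a : R) : ℕ → R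
  | 0 => 0
  | i+1 => (t + a) * tA t a i + t ^ i

/-- `(y+b)^j = y^j + j y^(j-1) b + b^2 * tB y b j`. -/
def tB {R : Type*} [CommRing R] (y b : R) : ℕ → R
  | 0 => 0
  | j+1 => (y + b) * tB y b j + j * y ^ (j-1)

lemma tA_spec {R : Type*} [CommRing R] (t a : R) (i : ℕ) : (t + a) ^ i = t ^ i + a * tA t a i := by
  induction i with
  | zero => simp [tA]
  | succ i ih => rw [pow_succ, ih, tA, pow_succ]; ring

lemma tB_spec {R : Type*} [CommRing R] (y b : R) (j : ℕ) :
    (y + b) ^ j = y ^ j + j * y ^ (j-1) * b + b ^ 2 * tB y b j := by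
  induction j with
  | zero => simp [tB]
  | succ j ih =>
    rw [pow_succ, ih, tB]
    cases j with
    | zero => simp; ring
    | succ j => simp; ring

lemma map_tA {R S : Type*} [CommRing R] [CommRing S] (φ : R →+* S) (t a : R) (i : ℕ) :
    φ (tA t a i) = tA (φ t) (φ a) i := by
  induction i with
  | zero => simp [tA]
  | succ i ih => simp [tA, ih]

lemma map_tB {R S : Type*} [CommRing R] [CommRing S] (φ : R →+* S) (y b : R) (i : ℕ) :
    φ (tB y b i) = tB (φ y) (φ b) i := by
  induction i with
  | zero => simp [tB]
  | succ i ih => simp [tB, ih]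

/-- Power series with coefficient `m` in `Fil (2 c m + r)`. -/
def GG {K S : Type*} [Field K] [CommRing S] [Algebra K S] (Fil : ℕ → Submodule K S) (c r : ℕ) : Set (S⟦X⟧) :=
  {φ | ∀ m, coeff m φ ∈ Fil (2 * c * m + r)}

section
variable {K S : Type*} [Field K] [CommRing S] [Algebra K S] {Fil : ℕ → Submodule K S}
  (hmono : Monotone Fil) (hone : (1:S) ∈ Fil 0) (hmul : ∀ v w a b, a ∈ Fil v → b ∈ Fil w → a * b ∈ Fil (v + w))
  (c : ℕ)

include hmono in
lemma GG_mono {r r' : ℕ} (h : r ≤ r') {φ : S⟦X⟧} (hφ : φ ∈ GG Fil c r) : φ ∈ GG Fil c r' :=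
  fun m => hmono (by omega) (hφ m)

lemma GG_add {r : ℕ} {φ ψ : S⟦X⟧} (hφ : φ ∈ GG Fil c r) (hψ : ψ ∈ GG Fil c r) : φ + ψ ∈ GG Fil c r :=
  fun m => by rw [map_add]; exact Submodule.add_mem _ (hφ m) (hψ m)

lemma GG_neg {r : ℕ} {φ : S⟦X⟧} (hφ : φ ∈ GG Fil c r) : -φ ∈ GG Fil c r :=
  fun m => by rw [map_neg]; exact Submodule.neg_mem _ (hφ m)

lemma GG_sum {ι : Type*} (P : Finset ι) {r : ℕ} {φ : ι → S⟦X⟧} (hφ : ∀ i ∈ P, φ i ∈ GG Fil c r) :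
    ∑ i ∈ P, φ i ∈ GG Fil c r :=
  fun m => by rw [map_sum]; exact Submodule.sum_mem _ fun i hi => hφ i hi m

include hmul in
lemma GG_mul {r r' : ℕ} {φ ψ : S⟦X⟧} (hφ : φ ∈ GG Fil c r) (hψ : ψ ∈ GG Fil c r') :
    φ * ψ ∈ GG Fil c (r + r') := by
  intro m
  rw [coeff_mul]
  refine Submodule.sum_mem _ fun p hp => ?_
  have := hmul _ _ _ _ (hφ p.1) (hψ p.2)
  rw [Finset.HasAntidiagonal.mem_antidiagonal] at hp
  have h2 : 2 * c * p.1 + r + (2 * c * p.2 + r') = 2 * c * m + (r + r') := by rw [← hp]; ring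
  rwa [h2] at this

include hmono in
lemma GG_C {r : ℕ} {a : S} (ha : a ∈ Fil r) : (PowerSeries.C a : S⟦X⟧) ∈ GG Fil c r := by
  intro m
  rw [coeff_C]
  split_ifs
  · exact hmono (by omega) ha
  · exact Submodule.zero_mem _

include hmono hone in
lemma GG_one : (1 : S⟦X⟧) ∈ GG Fil c 0 := by
  rw [← map_one PowerSeries.C]; exact GG_C hmono c hone

include hmono hone hmul in
lemma GG_pow {r : ℕ} {φ : S⟦X⟧} (hφ : φ ∈ GG Fil c r) (j : ℕ) : φ ^ j ∈ GG Fil c (r * j) := by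
  induction j with
  | zero => simpa using GG_one hmono hone c
  | succ j ih => rw [pow_succ, mul_add, mul_one]; exact GG_mul hmul c ih hφ

include hmono in
lemma GG_X {r r' : ℕ} {φ : S⟦X⟧} (h : r ≤ 2 * c + r') (hφ : φ ∈ GG Fil c r) :
    X * φ ∈ GG Fil c r' := by
  intro m
  cases m with
  | zero => rw [coeff_zero_X_mul]; exact Submodule.zero_mem _
  | succ m => rw [coeff_succ_X_mul]; exact hmono (by rw [mul_add]; omega) (hφ m)

include hmono hone hmul in
lemma GG_tA {v : ℕ} {t a : S⟦X⟧} (ht : t ∈ GG Fil c v) (ha : a ∈ GG Fil c v) (i : ℕ) :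
    tA t a i ∈ GG Fil c (v * i) := by
  induction i with
  | zero => intro m; simp [tA]
  | succ i ih =>
    rw [tA]
    refine GG_add c ?_ (GG_mono hmono c (by nlinarith) (GG_pow hmono hone hmul c ht i))
    rw [mul_add, mul_one, add_comm]
    exact GG_mul hmul c (GG_add c ht ha) ih

include hmono hone hmul in
lemma GG_tB {v : ℕ} {t a : S⟦X⟧} (ht : t ∈ GG Fil c v) (ha : a ∈ GG Fil c v) (i : ℕ) :
    tB t a i ∈ GG Fil c (v * i) := by
  induction i with
  | zero => intro m; simp [tB]
  | succ i ih =>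
    rw [tB]
    refine GG_add c ?_ ?_
    · rw [mul_add, mul_one, add_comm]
      exact GG_mul hmul c (GG_add c ht ha) ih
    · have h1 := GG_pow hmono hone hmul c ht (i-1)
      have h2 : v * (i-1) ≤ v * (i+1) := Nat.mul_le_mul_left _ (by omega)
      intro m
      have := (GG_mono hmono c h2 h1) m
      rw [← nsmul_eq_mul, map_nsmul]
      exact Submodule.smul_of_tower_mem _ _ this

include hmono hone hmul in
/-- Scaled Hensel lemma with control of the coefficients. -/
lemma hens2 (P : Finset (ℕ × ℕ)) (co : ℕ × ℕ → K) (e : ℕ) (hP : ∀ p ∈ P, p.1 + e * p.2 ≤ c)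
    (t y h : S) (ht : t ∈ Fil 1) (hy : y ∈ Fil e) (hh : h ∈ Fil c)
    (h0 : ∑ p ∈ P, algebraMap K S (co p) * (t ^ p.1 * y ^ p.2) = 0)
    (h1 : ∑ p ∈ P, algebraMap K S (co p) * (t ^ p.1 * (p.2 * y ^ (p.2 - 1))) = h) :
    ∃ W : S⟦X⟧, W ∈ GG Fil c c ∧
      ∑ p ∈ P, PowerSeries.C (algebraMap K S (co p)) * ((PowerSeries.C t + PowerSeries.C (h ^ 2) * X) ^ p.1 *
        (PowerSeries.C y + PowerSeries.C h * (X * W)) ^ p.2) = 0 := by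
  let T : S⟦X⟧ := PowerSeries.C t
  let Y : S⟦X⟧ := PowerSeries.C y
  let a : S⟦X⟧ := PowerSeries.C (h ^ 2) * X
  let b : S⟦X⟧ → S⟦X⟧ := fun W => PowerSeries.C h * (X * W)
  let Φ : S⟦X⟧ → S⟦X⟧ := fun W => -((∑ p ∈ P, PowerSeries.C (algebraMap K S (co p)) * (tA T a p.1 * (Y + b W) ^ p.2)) +
    X * (W ^ 2 * ∑ p ∈ P, PowerSeries.C (algebraMap K S (co p)) * (T ^ p.1 * tB Y (b W) p.2)))
  have hTg : T ∈ GG Fil c 1 := GG_C hmono c ht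
  have hYg : Y ∈ GG Fil c e := GG_C hmono c hy
  have hag : a ∈ GG Fil c 1 := by
    simp only [a]; rw [mul_comm]
    refine GG_X hmono c (r := c + c) (by omega) (GG_C hmono c ?_)
    rw [pow_two]; exact hmul _ _ _ _ hh hh
  have hbg : ∀ W ∈ GG Fil c c, b W ∈ GG Fil c e := by
    intro W hW
    simp only [b]; rw [mul_left_comm]
    exact GG_X hmono c (r := c + c) (by omega) (GG_mul hmul c (GG_C hmono c hh) hW)
  have hcg : ∀ p ∈ P, ∀ φ ∈ GG Fil c (1 * p.1 + e * p.2), PowerSeries.C (algebraMap K S (co p)) * φ ∈ GG Fil c c := by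
    intro p hp φ hφ m
    rw [coeff_C_mul, ← Algebra.smul_def]
    exact Submodule.smul_mem _ _ (GG_mono hmono c (by have := hP p hp; omega) hφ m)
  obtain ⟨x, hx, hxS⟩ := contr (ι := Unit) (fun w _ => Φ (w ())) (fun _ m => (Fil (2 * c * m + c) : Set S))
    (fun _ _ => Submodule.zero_mem _)
    (by
      intro w hw _
      have hw' : w () ∈ GG Fil c c := hw ()
      change Φ (w ()) ∈ GG Fil c c
      refine GG_neg c (GG_add c (GG_sum c _ fun p hp => hcg p hp _ ?_) ?_)
      · exact GG_mul hmul c (GG_tA hmono hone hmul c hTg hag _)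
          (GG_pow hmono hone hmul c (GG_add c hYg (hbg _ hw')) _)
      · refine GG_X hmono c (r := c * 2 + c) (by omega) (GG_mul hmul c (GG_pow hmono hone hmul c hw' 2)
          (GG_sum c _ fun p hp => hcg p hp _ ?_))
        exact GG_mul hmul c (GG_pow hmono hone hmul c hTg _) (GG_tB hmono hone hmul c hYg (hbg _ hw') _))
    (by
      intro x y N hxy _
      have hd := hxy ()
      let I : Ideal S⟦X⟧ := Ideal.span {X ^ (N+1)}
      have key : ∀ u v : S⟦X⟧, X ^ (N+1) ∣ u - v ↔ Ideal.Quotient.mk I u = Ideal.Quotient.mk I v := fun u v => by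
        rw [Ideal.Quotient.eq, Ideal.mem_span_singleton]
      have e1 : Ideal.Quotient.mk I (b (x ())) = Ideal.Quotient.mk I (b (y ())) := by
        rw [← key]
        obtain ⟨z, hz⟩ := hd
        exact ⟨PowerSeries.C h * z, by simp only [b]; linear_combination (PowerSeries.C h * X) * hz⟩
      have e2 : Ideal.Quotient.mk I (X * x () ^ 2) = Ideal.Quotient.mk I (X * y () ^ 2) := by
        rw [← key]
        obtain ⟨z, hz⟩ := hd
        exact ⟨z * (x () + y ()), by linear_combination (X * (x () + y ())) * hz⟩
      rw [key]
      rw [map_mul, map_mul, map_pow, map_pow] at e2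
      simp only [Φ, ← mul_assoc X]
      simp only [map_neg, map_add, map_sum, map_mul (Ideal.Quotient.mk I), map_pow, map_tB, e1, e2])
  refine ⟨x (), hxS (), ?_⟩
  have hfix : Φ (x ()) = x () := congrFun hx ()
  have h0' : ∑ p ∈ P, PowerSeries.C (algebraMap K S (co p)) * (T ^ p.1 * Y ^ p.2) = 0 := by
    have := congrArg (PowerSeries.C (R := S)) h0
    simp only [map_sum, map_mul, map_pow, map_zero] at this
    exact this
  have h1' : ∑ p ∈ P, PowerSeries.C (algebraMap K S (co p)) * (T ^ p.1 * (p.2 * Y ^ (p.2-1))) = PowerSeries.C h := by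
    have := congrArg (PowerSeries.C (R := S)) h1
    simp only [map_sum, map_mul, map_pow, map_natCast] at this
    exact this
  have hexp : ∀ p ∈ P, PowerSeries.C (algebraMap K S (co p)) * ((T + a) ^ p.1 * (Y + b (x ())) ^ p.2) =
      PowerSeries.C (algebraMap K S (co p)) * (T ^ p.1 * Y ^ p.2) +
      b (x ()) * (PowerSeries.C (algebraMap K S (co p)) * (T ^ p.1 * (p.2 * Y ^ (p.2-1)))) +
      b (x ()) ^ 2 * (PowerSeries.C (algebraMap K S (co p)) * (T ^ p.1 * tB Y (b (x ())) p.2)) +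
      a * (PowerSeries.C (algebraMap K S (co p)) * (tA T a p.1 * (Y + b (x ())) ^ p.2)) := by
    intro p _
    rw [tA_spec, add_mul, mul_add]
    congr 1
    · rw [tB_spec]; ring
    · ring
  change ∑ p ∈ P, PowerSeries.C (algebraMap K S (co p)) * ((T + a) ^ p.1 * (Y + b (x ())) ^ p.2) = 0
  rw [Finset.sum_congr rfl hexp]
  simp only [Finset.sum_add_distrib, ← Finset.mul_sum]
  rw [h0', h1']
  have hfix' := hfix
  simp only [Φ] at hfix'
  simp only [a, map_pow] at hfix' ⊢
  generalize (∑ p ∈ P, PowerSeries.C (algebraMap K S (co p)) * (tA T (PowerSeries.C h ^ 2 * X) p.1 * (Y + b (x ())) ^ p.2)) = s1 at *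
  generalize (∑ p ∈ P, PowerSeries.C (algebraMap K S (co p)) * (T ^ p.1 * tB Y (b (x ())) p.2)) = s2 at *
  simp only [b]
  linear_combination (-PowerSeries.C h ^ 2 * X) * hfix'

end

end S5

namespace S5
open Polynomial

/-- Evaluation of a bivariate polynomial. -/
noncomputable def ev2 {K B : Type*} [Field K] [CommRing B] [Algebra K B] (x y : B) : K[X][X] →+* B :=
  Polynomial.eval₂RingHom ((Polynomial.aeval x : K[X] →ₐ[K] B) : K[X] →+* B) y

section
variable {K B B' : Type*} [Field K] [CommRing B] [Algebra K B] [CommRing B'] [Algebra K B']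

@[simp] lemma ev2_X (x y : B) : ev2 (K := K) x y X = y := by simp [ev2]
@[simp] lemma ev2_CX (x y : B) : ev2 (K := K) x y (C X) = x := by simp [ev2]
@[simp] lemma ev2_CC (x y : B) (c : K) : ev2 (K := K) x y (C (C c)) = algebraMap K B c := by simp [ev2]
lemma ev2_C (x y : B) (p : K[X]) : ev2 (K := K) x y (C p) = aeval x p := by simp [ev2]

lemma ev2_sum (x y : B) (H : K[X][X]) (n e : ℕ) (hn : H.natDegree ≤ n) (he : ∀ j, (H.coeff j).natDegree ≤ e) :
    ev2 x y H = ∑ p ∈ Finset.range (e+1) ×ˢ Finset.range (n+1),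
      algebraMap K B ((H.coeff p.2).coeff p.1) * (x ^ p.1 * y ^ p.2) := by
  rw [Finset.sum_product_right]
  have : ev2 x y H = H.sum fun j c => aeval x c * y ^ j := by
    rw [ev2, coe_eval₂RingHom, eval₂_eq_sum]; rfl
  rw [this, Polynomial.sum_over_range' _ _ (n+1) (by omega)]
  · refine Finset.sum_congr rfl fun j _ => ?_
    rw [aeval_eq_sum_range' (n := e+1) (by have := he j; omega), Finset.sum_mul]
    refine Finset.sum_congr rfl fun i _ => ?_
    rw [Algebra.smul_def]; ring
  · simp

lemma ev2_map (φ : B →ₐ[K] B') (x y : B) (H : K[X][X]) : φ (ev2 x y H) = ev2 (φ x) (φ y) H := by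
  have : ((φ : B →+* B').comp (ev2 x y) : K[X][X] →+* B') = ev2 (φ x) (φ y) := by
    apply Polynomial.ringHom_ext
    · intro p
      simp [ev2_C]
      rw [aeval_algHom_apply]
    · simp
  exact congrArg (fun f => f H) this

lemma ev2_map' (φ : B →+* B') (hφ : ∀ c, φ (algebraMap K B c) = algebraMap K B' c) (x y : B) (H : K[X][X]) :
    φ (ev2 x y H) = ev2 (φ x) (φ y) H :=
  ev2_map (⟨φ, hφ⟩ : B →ₐ[K] B') x y H

/-- derivative in the main variable -/
lemma ev2_deriv (x y : B) (H : K[X][X]) (n e : ℕ) (hn : H.natDegree ≤ n) (he : ∀ j, (H.coeff j).natDegree ≤ e) :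
    ev2 x y (derivative H) = ∑ p ∈ Finset.range (e+1) ×ˢ Finset.range (n+1),
      algebraMap K B ((H.coeff p.2).coeff p.1) * (x ^ p.1 * (p.2 * y ^ (p.2-1))) := by
  rw [Finset.sum_product_right]
  have h1 : derivative H = ∑ j ∈ Finset.range (n+1), C (H.coeff j) * (C (j:K[X]) * X ^ (j-1)) := by
    conv_lhs => rw [H.as_sum_range_C_mul_X_pow' (n := n+1) (by omega)]
    rw [derivative_sum]
    refine Finset.sum_congr rfl fun j _ => ?_
    rw [derivative_C_mul_X_pow]; simp; ring
  rw [h1, map_sum]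
  refine Finset.sum_congr rfl fun j _ => ?_
  rw [map_mul, map_mul, ev2_C, map_pow, ev2_X, aeval_eq_sum_range' (n := e+1) (by have := he j; omega), Finset.sum_mul]
  refine Finset.sum_congr rfl fun i _ => ?_
  rw [Algebra.smul_def]; simp; ring
end

section
variable {K S : Type*} [Field K] [CommRing S] [Algebra K S]

/-- The weight filtration. -/
def Fl (K : Type*) {S : Type*} [Field K] [CommRing S] [Algebra K S] (t y z : S) (e w : ℕ) : Submodule K S :=
  Submodule.span K {s | ∃ a b c, a + e * (b + c) ≤ w ∧ s = t ^ a * y ^ b * z ^ c}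

lemma Fl_mono (t y z : S) (e : ℕ) : Monotone (Fl K t y z e) := by
  intro v w h
  apply Submodule.span_mono
  rintro s ⟨a, b, c, h1, h2⟩
  exact ⟨a, b, c, h1.trans h, h2⟩

lemma Fl_mem (t y z : S) (e : ℕ) {w : ℕ} (a b c : ℕ) (h : a + e * (b + c) ≤ w) : t ^ a * y ^ b * z ^ c ∈ Fl K t y z e w :=
  Submodule.subset_span ⟨a, b, c, h, rfl⟩

lemma Fl_one (t y z : S) (e : ℕ) : (1:S) ∈ Fl K t y z e 0 := by
  simpa using Fl_mem (K := K) t y z e 0 0 0 (by simp)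

lemma Fl_mul (t y z : S) (e : ℕ) (v w : ℕ) (a b : S) (ha : a ∈ Fl K t y z e v) (hb : b ∈ Fl K t y z e w) :
    a * b ∈ Fl K t y z e (v + w) := by
  have : Fl K t y z e v * Fl K t y z e w ≤ Fl K t y z e (v+w) := by
    rw [Fl, Fl, Submodule.span_mul_span, Submodule.span_le]
    rintro _ ⟨_, ⟨a, b, c, h1, rfl⟩, _, ⟨a', b', c', h1', rfl⟩, rfl⟩
    have := Fl_mem (K := K) t y z e (w := v + w) (a+a') (b+b') (c+c') (by nlinarith)
    have e1 : t ^ a * y ^ b * z ^ c * (t ^ a' * y ^ b' * z ^ c') = t ^ (a+a') * y ^ (b+b') * z ^ (c+c') := by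
      simp only [pow_add]; ring
    simp only [e1]; exact this
  exact this (Submodule.mul_mem_mul ha hb)

/-- reduced generators -/
def Fl' (K : Type*) {S : Type*} [Field K] [CommRing S] [Algebra K S] (t y z : S) (n e w : ℕ) : Submodule K S :=
  Submodule.span K {s | ∃ a b c, a + e * (b + c) ≤ w ∧ b < n ∧ c < n - 1 ∧ s = t ^ a * y ^ b * z ^ c}

lemma red_y (t y : S) (H : K[X][X]) (n e : ℕ) (hn : H.natDegree = n) (hm : H.Monic)
    (he : ∀ j, (H.coeff j).natDegree ≤ e) (h0 : ev2 t y H = 0) :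
    y ^ n = - ∑ p ∈ Finset.range (e+1) ×ˢ Finset.range n,
      algebraMap K S ((H.coeff p.2).coeff p.1) * (t ^ p.1 * y ^ p.2) := by
  rw [ev2_sum t y H n e hn.le he, Finset.sum_product_right, Finset.sum_range_succ] at h0
  have h1 : H.coeff n = 1 := by rw [← hn]; exact hm
  rw [Finset.sum_product_right]
  have h2 : ∑ i ∈ Finset.range (e+1), algebraMap K S ((H.coeff n).coeff i) * (t ^ i * y ^ n) = y ^ n := by
    rw [h1, Finset.sum_eq_single 0]
    · simp
    · intro b _ hb; simp [coeff_one, hb]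
    · simp
  rw [h2] at h0
  linear_combination h0

lemma red_z (t y z : S) (H : K[X][X]) (n e : ℕ) (hn : H.natDegree = n) (hm : H.Monic)
    (he : ∀ j, (H.coeff j).natDegree ≤ e) (h0 : ev2 t y H = 0) (h0' : ev2 t z H = 0)
    (hu : IsUnit (z - y)) :
    ∑ l ∈ Finset.range n, z ^ l * y ^ (n-1-l) = - ∑ p ∈ Finset.range (e+1) ×ˢ Finset.range n,
      algebraMap K S ((H.coeff p.2).coeff p.1) * (t ^ p.1 * ∑ l ∈ Finset.range p.2, z ^ l * y ^ (p.2-1-l)) := by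
  apply hu.mul_right_cancel
  have h1 := red_y t y H n e hn hm he h0
  have h2 := red_y t z H n e hn hm he h0'
  rw [(Commute.all z y).geom_sum₂_mul, neg_mul, Finset.sum_mul, h1, h2, neg_sub_neg]
  rw [← Finset.sum_sub_distrib, ← Finset.sum_neg_distrib]
  refine Finset.sum_congr rfl fun p _ => ?_
  rw [mul_assoc, mul_assoc, (Commute.all z y).geom_sum₂_mul]
  ring

lemma Fl_le (t y z : S) (H : K[X][X]) (n e : ℕ) (hn : H.natDegree = n) (hn0 : 0 < n) (hm : H.Monic)
    (he : ∀ j, (H.coeff j).natDegree ≤ e) (h0 : ev2 t y H = 0) (h0' : ev2 t z H = 0)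
    (hu : IsUnit (z - y)) (w : ℕ) : Fl K t y z e w ≤ Fl' K t y z n e w := by
  have main : ∀ c b a : ℕ, a + e * (b + c) ≤ w → t ^ a * y ^ b * z ^ c ∈ Fl' K t y z n e w := by
    intro c
    induction c using Nat.strong_induction_on with
    | _ c ihc =>
    by_cases hc : c < n - 1
    · intro b
      induction b using Nat.strong_induction_on with
      | _ b ihb =>
      intro a hw
      by_cases hb : b < n
      · exact Submodule.subset_span ⟨a, b, c, hw, hb, hc, rfl⟩
      · obtain ⟨b', rfl⟩ := Nat.exists_eq_add_of_le (not_lt.1 hb)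
        rw [pow_add, red_y t y H n e hn hm he h0]
        have : t ^ a * (-(∑ p ∈ Finset.range (e+1) ×ˢ Finset.range n,
            algebraMap K S ((H.coeff p.2).coeff p.1) * (t ^ p.1 * y ^ p.2)) * y ^ b') * z ^ c =
            -(∑ p ∈ Finset.range (e+1) ×ˢ Finset.range n, (H.coeff p.2).coeff p.1 • (t ^ (a + p.1) * y ^ (b' + p.2) * z ^ c)) := by
          simp only [Algebra.smul_def, Finset.sum_mul, Finset.mul_sum, neg_mul, mul_neg, pow_add]
          congr 1
          refine Finset.sum_congr rfl fun p _ => by ring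
        rw [this]
        refine Submodule.neg_mem _ (Submodule.sum_mem _ fun p hp => Submodule.smul_mem _ _ ?_)
        simp only [Finset.mem_product, Finset.mem_range] at hp
        refine ihb _ (by omega) _ ?_
        have : e * (p.2 + 1) ≤ e * n := Nat.mul_le_mul_left _ (by omega)
        nlinarith
    · intro b a hw
      obtain ⟨c', rfl⟩ := Nat.exists_eq_add_of_le (not_lt.1 hc)
      have h1 := red_z t y z H n e hn hm he h0 h0' hu
      obtain ⟨n', rfl⟩ : ∃ n', n = n' + 1 := ⟨n - 1, by omega⟩
      rw [Finset.sum_range_succ] at h1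
      simp only [Nat.add_sub_cancel, Nat.sub_self, pow_zero, mul_one] at h1 hw ihc ⊢
      have h2 : t ^ a * y ^ b * z ^ (n' + c') = t ^ a * y ^ b * z ^ c' *
        (∑ l ∈ Finset.range n', z ^ l * y ^ (n' - l) + z ^ n') - ∑ l ∈ Finset.range n', t ^ a * y ^ (b + (n' - l)) * z ^ (c' + l) := by
        simp only [mul_add, Finset.mul_sum, pow_add]
        rw [add_sub_right_comm, ← Finset.sum_sub_distrib, Finset.sum_eq_zero]
        · ring
        · intro l _; ring
      have h3 : t ^ a * y ^ b * z ^ c' * (∑ l ∈ Finset.range n', z ^ l * y ^ (n' - l) + z ^ n') =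
         -(∑ p ∈ Finset.range (e+1) ×ˢ Finset.range (n'+1), (H.coeff p.2).coeff p.1 •
            ∑ l ∈ Finset.range p.2, (t ^ (a + p.1) * y ^ (b + (p.2-1-l)) * z ^ (c' + l))) := by
        rw [h1]
        simp only [Algebra.smul_def, Finset.mul_sum, mul_neg, pow_add]
        congr 1
        refine Finset.sum_congr rfl fun p _ => Finset.sum_congr rfl fun l _ => by ring
      rw [h2, h3]
      refine Submodule.sub_mem _ (Submodule.neg_mem _ (Submodule.sum_mem _ fun p hp => Submodule.smul_mem _ _
        (Submodule.sum_mem _ fun l hl => ?_))) (Submodule.sum_mem _ fun l hl => ?_)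
      · simp only [Finset.mem_product, Finset.mem_range] at hp hl
        refine ihc _ (by omega) _ _ ?_
        have e1 : e * (b + (p.2 - 1 - l) + (c' + l) + 1) ≤ e * (b + (n' + c')) := Nat.mul_le_mul_left _ (by omega)
        rw [Nat.mul_add _ _ 1] at e1
        omega
      · simp only [Finset.mem_range] at hl
        refine ihc _ (by omega) _ _ ?_
        have e1 : e * (b + (n' - l) + (c' + l)) ≤ e * (b + (n' + c')) := Nat.mul_le_mul_left _ (by omega)
        omega
  rw [Fl, Submodule.span_le]
  rintro _ ⟨a, b, c, h, rfl⟩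
  exact main c b a h

lemma Fl'_fin (t y z : S) (n e w : ℕ) : Module.Finite K (Fl' K t y z n e w) ∧
    Module.finrank K (Fl' K t y z n e w) ≤ (w+1) * (n * (n-1)) := by
  classical
  let s : Finset S := (Finset.range (w+1) ×ˢ (Finset.range n ×ˢ Finset.range (n-1))).image
    fun p => t ^ p.1 * y ^ p.2.1 * z ^ p.2.2
  have hle : Fl' K t y z n e w ≤ Submodule.span K (s : Set S) := by
    apply Submodule.span_mono
    rintro _ ⟨a, b, c, h, h1, h2, rfl⟩
    simp only [s, Finset.coe_image, Set.mem_image]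
    exact ⟨(a, b, c), by simp; omega, rfl⟩
  haveI : Module.Finite K (Submodule.span K (s : Set S)) := FiniteDimensional.span_finset K s
  refine ⟨Submodule.finiteDimensional_of_le hle, (Submodule.finrank_mono hle).trans ?_⟩
  refine (finrank_span_finset_le_card s).trans (Finset.card_image_le.trans ?_)
  simp
end
end S5

namespace S5
open Polynomial

/-- index type for the auxiliary polynomial -/
abbrev Idx (A n J : ℕ) := Fin A × Fin n × Fin J × Fin n

/-- auxiliary polynomial -/
noncomputable def gpoly {K : Type*} [Field K] {A n J : ℕ} (q : ℕ) (α : Idx A n J → K) : K[X][X] :=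
  ∑ x : Idx A n J, C (C (α x)) * ((C X) ^ x.1.1 * X ^ x.2.1.1 * ((C X) ^ x.2.2.1.1 * X ^ x.2.2.2.1) ^ q)

lemma ev2_gpoly {K B : Type*} [Field K] [CommRing B] [Algebra K B] {A n J : ℕ} (q : ℕ) (α : Idx A n J → K) (t y : B) :
    ev2 t y (gpoly q α) = ∑ x : Idx A n J, algebraMap K B (α x) *
      (t ^ x.1.1 * y ^ x.2.1.1 * (t ^ x.2.2.1.1 * y ^ x.2.2.2.1) ^ q) := by
  simp [gpoly, map_sum]

lemma frob_ps (K : Type*) {S : Type*} [Field K] [Fintype K] [CommRing S] [Algebra K S] (φ : PowerSeries S) :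
    ∃ ψ, φ ^ Fintype.card K = PowerSeries.C ((PowerSeries.constantCoeff φ) ^ Fintype.card K) +
      PowerSeries.X ^ Fintype.card K * ψ := by
  have h := PowerSeries.eq_X_mul_shift_add_const φ
  have h2 := congrArg (FiniteField.frobeniusAlgHom K (PowerSeries S)) h
  rw [map_add, map_mul] at h2
  simp only [FiniteField.coe_frobeniusAlgHom] at h2
  exact ⟨_, by rw [h2, map_pow, add_comm]⟩

lemma stepA {K S : Type*} [Field K] [Fintype K] [CommRing S] [Algebra K S] (q : ℕ) (hq : Fintype.card K = q)
    (H : K[X][X]) (n e : ℕ) (hn : H.natDegree = n) (hn0 : 0 < n) (hm : H.Monic)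
    (he : ∀ j, (H.coeff j).natDegree ≤ e) (t y : S) (ht : t ^ q = t) (hu : IsUnit (y ^ q - y))
    (h0 : ev2 t y H = 0) (h : S) (hh : ev2 t y (derivative H) = h) (M A J : ℕ) (hM : M ≤ q)
    (hcount : M * ((2 * (e + e * n) * M + (A + J + 2 * e * n) + 1) * (n * (n-1))) < A * (n * (J * n))) :
    ∃ α : Idx A n J → K, α ≠ 0 ∧ ∃ W : PowerSeries S,
      ev2 (PowerSeries.C t + PowerSeries.C (h^2) * PowerSeries.X)
        (PowerSeries.C y + PowerSeries.C h * (PowerSeries.X * W)) H = 0 ∧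
      PowerSeries.X ^ M ∣ ev2 (PowerSeries.C t + PowerSeries.C (h^2) * PowerSeries.X)
        (PowerSeries.C y + PowerSeries.C h * (PowerSeries.X * W)) (gpoly q α) := by
  have h0' : ev2 t (y ^ q) H = 0 := by
    have := congrArg (FiniteField.frobeniusAlgHom K S) h0
    rw [ev2_map, map_zero] at this
    simpa only [FiniteField.coe_frobeniusAlgHom, hq, ht] using this
  set z := y ^ q with hz
  set c := e + e * n with hc
  let F := Fl K t y z e
  have hmono := Fl_mono (K := K) t y z e
  have hone := Fl_one (K := K) t y z e
  have hmul := Fl_mul (K := K) t y z e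
  have htF : t ∈ F 1 := by simpa using Fl_mem (K := K) t y z e (w := 1) 1 0 0 (by omega)
  have hyF : y ∈ F e := by simpa using Fl_mem (K := K) t y z e (w := e) 0 1 0 (by omega)
  have hhF : h ∈ F c := by
    rw [← hh, ev2_deriv t y H n e hn.le he]
    refine Submodule.sum_mem _ fun p hp => ?_
    simp only [Finset.mem_product, Finset.mem_range] at hp
    have h1 : p.1 + e * (p.2 - 1 + 0) ≤ c := by
      have : e * (p.2 - 1 + 0) ≤ e * n := Nat.mul_le_mul_left _ (by omega)
      omega
    have h2 := Fl_mem (K := K) t y z e _ _ _ h1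
    rw [pow_zero, mul_one] at h2
    have h3 : algebraMap K S ((H.coeff p.2).coeff p.1) * (t ^ p.1 * (p.2 * y ^ (p.2 - 1))) =
      ((H.coeff p.2).coeff p.1) • (p.2 • (t ^ p.1 * y ^ (p.2 - 1))) := by
      rw [Algebra.smul_def, nsmul_eq_mul]; ring
    rw [h3]
    exact Submodule.smul_mem _ _ (Submodule.smul_of_tower_mem _ _ h2)
  obtain ⟨W, hW, hW0⟩ := hens2 hmono hone hmul c (Finset.range (e+1) ×ˢ Finset.range (n+1))
    (fun p => (H.coeff p.2).coeff p.1) e (by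
      intro p hp
      simp only [Finset.mem_product, Finset.mem_range] at hp
      have : e * p.2 ≤ e * n := Nat.mul_le_mul_left _ (by omega)
      omega) t y h htF hyF hhF (by rw [← ev2_sum t y H n e hn.le he]; exact h0)
      (by rw [← ev2_deriv t y H n e hn.le he]; exact hh)
  set τ := PowerSeries.C t + PowerSeries.C (h^2) * PowerSeries.X with hτ
  set η := PowerSeries.C y + PowerSeries.C h * (PowerSeries.X * W) with hη
  have hτG : τ ∈ GG F c 1 := by
    refine GG_add c (GG_C hmono c htF) ?_
    rw [mul_comm]
    refine GG_X hmono c (r := c + c) (by omega) (GG_C hmono c ?_)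
    rw [pow_two]; exact hmul _ _ _ _ hhF hhF
  have hηG : η ∈ GG F c e := by
    refine GG_add c (GG_C hmono c hyF) ?_
    rw [mul_left_comm]
    exact GG_X hmono c (r := c + c) (by omega) (GG_mul hmul c (GG_C hmono c hhF) hW)
  have hτ0 : PowerSeries.constantCoeff τ = t := by simp [hτ]
  have hη0 : PowerSeries.constantCoeff η = y := by simp [hη]
  set w := 2 * c * M + (A + J + 2 * e * n) with hw
  have hmem : ∀ (x : Idx A n J) (m : Fin M), PowerSeries.coeff m.1 (τ ^ x.1.1 * η ^ x.2.1.1) *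
      (t ^ x.2.2.1.1 * z ^ x.2.2.2.1) ∈ F w := by
    intro x m
    have h1 := GG_mul hmul c (GG_pow hmono hone hmul c hτG x.1.1) (GG_pow hmono hone hmul c hηG x.2.1.1) m.1
    have h2 := Fl_mem (K := K) t y z e x.2.2.1.1 0 x.2.2.2.1 le_rfl
    rw [pow_zero, mul_one] at h2
    refine hmono ?_ (hmul _ _ _ _ h1 h2)
    have a1 := x.1.2; have a2 := x.2.1.2; have a3 := x.2.2.1.2; have a4 := x.2.2.2.2
    have b1 : 2 * c * m.1 ≤ 2 * c * M := Nat.mul_le_mul_left _ m.2.le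
    have b2 : e * x.2.1.1 ≤ e * n := Nat.mul_le_mul_left _ a2.le
    have b3 : e * (0 + x.2.2.2.1) ≤ e * n := Nat.mul_le_mul_left _ (by omega)
    have b4 : 2 * e * n = e * n + e * n := by ring
    omega
  let Fw : Submodule K S := F w
  obtain ⟨hf1, hf2⟩ := Fl'_fin (K := K) t y z n e w
  have hle : Fw ≤ Fl' K t y z n e w := Fl_le t y z H n e hn hn0 hm he h0 h0' hu w
  have : Module.Finite K Fw := Submodule.finiteDimensional_of_le hle
  have hfr : Module.finrank K Fw ≤ (w+1) * (n * (n-1)) := (Submodule.finrank_mono hle).trans hf2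
  let v : Idx A n J → (Fin M → Fw) := fun x m => ⟨_, hmem x m⟩
  have hker : LinearMap.ker (Fintype.linearCombination K v) ≠ ⊥ := by
    apply LinearMap.ker_ne_bot_of_finrank_lt
    rw [Module.finrank_pi_fintype, Module.finrank_pi]
    simp only [Finset.sum_const, Finset.card_univ, Fintype.card_fin, smul_eq_mul, Fintype.card_prod]
    exact lt_of_le_of_lt (Nat.mul_le_mul_left _ hfr) hcount
  obtain ⟨α, hα, hα0⟩ := (Submodule.ne_bot_iff _).1 hker
  refine ⟨α, hα0, W, ?_, ?_⟩
  · rw [ev2_sum _ _ H n e hn.le he]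
    simp only [PowerSeries.algebraMap_apply]
    exact hW0
  · have hrel : ∀ m : Fin M, ∑ x, α x • (PowerSeries.coeff m.1 (τ ^ x.1.1 * η ^ x.2.1.1) *
      (t ^ x.2.2.1.1 * z ^ x.2.2.2.1)) = 0 := by
      intro m
      have h1 := congrFun (LinearMap.mem_ker.1 hα) m
      have h2 := congrArg (Subtype.val) h1
      simpa [Fintype.linearCombination_apply, v] using h2
    have hsplit : ∀ x : Idx A n J, ∃ ψ, (τ ^ x.2.2.1.1 * η ^ x.2.2.2.1) ^ q =
        PowerSeries.C (t ^ x.2.2.1.1 * z ^ x.2.2.2.1) + PowerSeries.X ^ q * ψ := by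
      intro x
      obtain ⟨ψ, hψ⟩ := frob_ps K (τ ^ x.2.2.1.1 * η ^ x.2.2.2.1)
      refine ⟨ψ, ?_⟩
      rw [hq] at hψ
      have e0 : PowerSeries.constantCoeff (τ ^ x.2.2.1.1 * η ^ x.2.2.2.1) = t ^ x.2.2.1.1 * y ^ x.2.2.2.1 := by
        rw [map_mul, map_pow, map_pow, hτ0, hη0]
      rw [hψ, e0, mul_pow, ← pow_mul, ← pow_mul, mul_comm _ q, mul_comm _ q,
        pow_mul, pow_mul, ht]
    choose ψ hψ using hsplit
    rw [ev2_gpoly]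
    have e1 : ∑ x : Idx A n J, algebraMap K (PowerSeries S) (α x) *
      (τ ^ x.1.1 * η ^ x.2.1.1 * (τ ^ x.2.2.1.1 * η ^ x.2.2.2.1) ^ q) =
      (∑ x : Idx A n J, PowerSeries.C (algebraMap K S (α x)) *
      (τ ^ x.1.1 * η ^ x.2.1.1 * PowerSeries.C (t ^ x.2.2.1.1 * z ^ x.2.2.2.1))) +
      PowerSeries.X ^ q * ∑ x : Idx A n J, PowerSeries.C (algebraMap K S (α x)) *
      (τ ^ x.1.1 * η ^ x.2.1.1 * ψ x) := by
      rw [Finset.mul_sum, ← Finset.sum_add_distrib]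
      refine Finset.sum_congr rfl fun x _ => ?_
      rw [hψ, PowerSeries.algebraMap_apply]
      ring
    rw [e1]
    refine dvd_add ?_ ((pow_dvd_pow _ hM).mul_right _)
    rw [PowerSeries.X_pow_dvd_iff]
    intro m hm
    rw [map_sum, ← hrel ⟨m, hm⟩]
    refine Finset.sum_congr rfl fun x _ => ?_
    rw [PowerSeries.coeff_C_mul, PowerSeries.coeff_mul_C, Algebra.smul_def]

end S5

namespace S5
open Polynomial

lemma det_natDegree_le' {K ι : Type*} [Field K] [Fintype ι] [DecidableEq ι] (Mx : Matrix ι ι K[X]) (b : ι → ℕ)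
    (h : ∀ i j, (Mx i j).natDegree ≤ b j) : Mx.det.natDegree ≤ ∑ j, b j := by
  rw [Matrix.det_apply]
  refine natDegree_sum_le_of_forall_le _ _ fun σ _ => ?_
  refine (natDegree_smul_le _ _).trans ((natDegree_prod_le _ _).trans (Finset.sum_le_sum fun i _ => h _ _))

lemma res_natDegree_le {K : Type*} [Field K] (H g : K[X][X]) (m N e E : ℕ)
    (he : ∀ j, (H.coeff j).natDegree ≤ e) (hE : ∀ j, (g.coeff j).natDegree ≤ E) :
    (resultant H g m N).natDegree ≤ m * E + N * e := by
  rw [resultant]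
  refine (det_natDegree_le' _ (fun j => j.addCases (fun _ => E) (fun _ => e)) ?_).trans ?_
  · intro i j
    induction j using Fin.addCases with
    | left j => simp [sylvester]; split_ifs <;> simp [hE]
    | right j => simp [sylvester]; split_ifs <;> simp [he]
  · rw [Fin.sum_univ_add]; simp

lemma res_ne_zero {K : Type*} [Field K] {B : Type*} [CommRing B] [IsDomain B] [Algebra K B] (x u : B)
    (H g : K[X][X]) (n N : ℕ) (hm : H.Monic) (hn : H.natDegree = n)
    (hu : ev2 x u H = 0) (hmin : ∀ P : K[X][X], P ≠ 0 → P.natDegree < n → ev2 x u P ≠ 0)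
    (hg : g.natDegree ≤ N) (hgu : ev2 x u g ≠ 0) : resultant H g n N ≠ 0 := by
  intro h0
  rw [resultant, ← Matrix.exists_mulVec_eq_zero_iff] at h0
  obtain ⟨v, hv, hv0⟩ := h0
  let b₁ := ((degreeLT.basis K[X] n).prod (degreeLT.basis K[X] N)).reindex finSumFinEquiv
  let b₂ := degreeLT.basis K[X] (n + N)
  let f := sylvesterMap H g hn.le hg
  have hT : f.toMatrix b₁ b₂ = sylvester H g n N := toMatrix_sylvesterMap' H g hn.le hg
  let z := b₁.equivFun.symm v
  have hz : z ≠ 0 := fun h => hv (by simpa only [z, LinearEquiv.map_eq_zero_iff] using h)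
  have h1 := LinearMap.toMatrix_mulVec_repr b₁ b₂ f z
  have h2 : (b₁.repr z : Fin (n+N) → K[X]) = v := by
    rw [← Module.Basis.equivFun_apply]; exact b₁.equivFun.apply_symm_apply v
  rw [h2, hT, hv0] at h1
  have h3 : f z = 0 := by
    apply b₂.repr.injective
    ext1 i
    rw [map_zero]
    exact (congrFun h1 i).symm
  have h4 : H * z.2.1 + g * z.1.1 = 0 := congrArg Subtype.val h3
  have h5 : ev2 x u z.1.1 = 0 := by
    have := congrArg (ev2 x u) h4
    rw [map_add, map_mul, map_mul, hu, zero_mul, zero_add, map_zero] at this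
    exact (mul_eq_zero.1 this).resolve_left hgu
  have h6 : z.1.1 = 0 := by
    by_contra hne
    refine hmin _ hne ?_ h5
    have := z.1.2
    rw [Polynomial.mem_degreeLT] at this
    exact (natDegree_lt_iff_degree_lt hne).2 this
  rw [h6, mul_zero, add_zero] at h4
  have h7 : z.2.1 = 0 := (mul_eq_zero.1 h4).resolve_left hm.ne_zero
  exact hz (Prod.ext (Subtype.ext h6) (Subtype.ext h7))

lemma aeval_ps_X {K : Type*} [Field K] (p : K[X]) : aeval (PowerSeries.X : PowerSeries K) p = (p : PowerSeries K) := by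
  have : (aeval (PowerSeries.X : PowerSeries K) : K[X] →ₐ[K] PowerSeries K) = Polynomial.coeToPowerSeries.algHom K := by
    apply Polynomial.algHom_ext
    simp
  rw [this]; simp

lemma order_bound {K : Type*} [Field K] (u : PowerSeries K) (H g : K[X][X]) (n N e E : ℕ) (hm : H.Monic) (hn : H.natDegree = n)
    (hn0 : 0 < n)
    (he : ∀ j, (H.coeff j).natDegree ≤ e) (hE : ∀ j, (g.coeff j).natDegree ≤ E)
    (hu : ev2 PowerSeries.X u H = 0) (hmin : ∀ P : K[X][X], P ≠ 0 → P.natDegree < n → ev2 PowerSeries.X u P ≠ 0)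
    (hg : g.natDegree ≤ N) (r : ℕ) (hr : n * E + N * e < r) (hd : PowerSeries.X ^ r ∣ ev2 PowerSeries.X u g) :
    ev2 PowerSeries.X u g = 0 := by
  by_contra hne
  have h1 := res_ne_zero _ u H g n N hm hn hu hmin hg hne
  obtain ⟨p, s, -, -, hps⟩ := exists_mul_add_mul_eq_C_resultant H g hn.le hg (Or.inl hn0.ne')
  have h2 := congrArg (ev2 PowerSeries.X u) hps
  rw [map_add, map_mul, map_mul, hu, zero_mul, zero_add, ev2_C, aeval_ps_X] at h2
  have h3 : PowerSeries.X ^ r ∣ ((resultant H g n N : K[X]) : PowerSeries K) := h2 ▸ hd.mul_right _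
  apply h1
  ext i
  rw [coeff_zero]
  by_cases hi : i < r
  · have := PowerSeries.X_pow_dvd_iff.1 h3 i hi
    rwa [Polynomial.coeff_coe] at this
  · apply coeff_eq_zero_of_natDegree_lt
    have := res_natDegree_le H g n N e E he hE
    omega

/-- small polynomials -/
noncomputable def spoly {K : Type*} [Field K] {A n : ℕ} (α : Fin A × Fin n → K) : K[X][X] :=
  ∑ x, C (C (α x)) * ((C X) ^ x.1.1 * X ^ x.2.1)

lemma spoly_coeff {K : Type*} [Field K] {A n : ℕ} (α : Fin A × Fin n → K) (a : Fin A) (b : Fin n) :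
    ((spoly α).coeff b.1).coeff a.1 = α (a, b) := by
  simp only [spoly, finsetSum_coeff, coeff_C_mul]
  rw [Finset.sum_eq_single (a, b)]
  · simp only [← C_pow, coeff_C_mul, coeff_X_pow]; simp
  · rintro ⟨a', b'⟩ _ hne
    simp only [← C_pow, coeff_C_mul, coeff_X_pow]
    by_cases hb : b.1 = b'.1
    · have ha : a.1 ≠ a'.1 := fun h => hne (by rw [Fin.ext h, Fin.ext hb])
      simp [hb, ha, coeff_X_pow]
    · simp [hb]
  · simp

lemma spoly_ne {K : Type*} [Field K] {A n : ℕ} (α : Fin A × Fin n → K) (h : spoly α = 0) : α = 0 := by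
  funext ⟨a, b⟩
  rw [← spoly_coeff α, h]; simp

lemma spoly_natDegree {K : Type*} [Field K] {A n : ℕ} (α : Fin A × Fin n → K) : (spoly α).natDegree ≤ n - 1 := by
  refine natDegree_sum_le_of_forall_le _ _ fun x _ => ?_
  rw [← C_pow, ← mul_assoc, ← C_mul]
  refine (natDegree_C_mul_X_pow_le _ _).trans (by omega)

lemma spoly_coeff_natDegree {K : Type*} [Field K] {A n : ℕ} (α : Fin A × Fin n → K) (j : ℕ) :
    ((spoly α).coeff j).natDegree ≤ A := by
  rw [spoly, finsetSum_coeff]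
  refine natDegree_sum_le_of_forall_le _ _ fun x _ => ?_
  rw [← C_pow, ← mul_assoc, ← C_mul, coeff_C_mul, coeff_X_pow]
  split_ifs
  · rw [mul_one]; exact (natDegree_C_mul_X_pow_le _ _).trans (by omega)
  · simp

lemma ev2_spoly {K B : Type*} [Field K] [CommRing B] [Algebra K B] {A n : ℕ} (α : Fin A × Fin n → K) (t y : B) :
    ev2 t y (spoly α) = ∑ x, algebraMap K B (α x) * (t ^ x.1.1 * y ^ x.2.1) := by
  simp [spoly, map_sum]

/-- step (6) -/
lemma gpoly_ne {K : Type*} [Field K] [Fintype K] (u : PowerSeries K) (H : K[X][X]) (n e A J : ℕ) (hm : H.Monic) (hn : H.natDegree = n)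
    (hn0 : 0 < n) (he : ∀ j, (H.coeff j).natDegree ≤ e)
    (hu : ev2 PowerSeries.X u H = 0) (hmin : ∀ P : K[X][X], P ≠ 0 → P.natDegree < n → ev2 PowerSeries.X u P ≠ 0)
    (α : Idx A n J → K) (hα : α ≠ 0) (hq : n * A + (n-1) * e < Fintype.card K) :
    ev2 PowerSeries.X u (gpoly (Fintype.card K) α) ≠ 0 := by
  set q := Fintype.card K with hqd
  intro h0
  have hfin : ∀ {A n' : ℕ} (β : Fin A × Fin n' → K), n' ≤ n → ev2 PowerSeries.X u (spoly β) = 0 → β = 0 := by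
    intro A n' β hn' hβ
    by_contra hne
    by_cases h1 : n' = 0
    · subst h1; exact hne (by funext x; exact x.2.elim0)
    refine hmin (spoly β) (fun h => hne (spoly_ne β h)) ?_ hβ
    have := spoly_natDegree β
    omega
  -- the inner series
  let V : Fin A × Fin n → PowerSeries K := fun x => ev2 PowerSeries.X u (spoly fun y : Fin J × Fin n => α (x.1, x.2, y.1, y.2))
  have hVq : ∀ x, V x ^ q = ∑ y : Fin J × Fin n, algebraMap K (PowerSeries K) (α (x.1, x.2, y.1, y.2)) *
      (PowerSeries.X ^ y.1.1 * u ^ y.2.1) ^ q := by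
    intro x
    simp only [V]
    rw [ev2_spoly]
    have := map_sum (FiniteField.frobeniusAlgHom K (PowerSeries K)) (fun y : Fin J × Fin n => algebraMap K (PowerSeries K) (α (x.1, x.2, y.1, y.2)) *
      (PowerSeries.X ^ y.1.1 * u ^ y.2.1)) Finset.univ
    simp only [FiniteField.coe_frobeniusAlgHom, mul_pow, ← map_pow, FiniteField.pow_card] at this
    rw [this]
    simp only [mul_pow]
    rfl
  have hsum : ∑ x : Fin A × Fin n, (PowerSeries.X ^ x.1.1 * u ^ x.2.1) * V x ^ q = 0 := by
    rw [ev2_gpoly] at h0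
    rw [← h0]
    simp only [hVq, Finset.mul_sum]
    simp only [Fintype.sum_prod_type]
    refine Finset.sum_congr rfl fun a _ => Finset.sum_congr rfl fun b _ => Finset.sum_congr rfl fun c _ =>
      Finset.sum_congr rfl fun d _ => by ring
  -- all powers of X divide all V
  have hdiv : ∀ m x, PowerSeries.X ^ m ∣ V x := by
    intro m
    induction m with
    | zero => simp
    | succ m ih =>
      choose V' hV' using ih
      have h1 : ∑ x : Fin A × Fin n, (PowerSeries.X ^ x.1.1 * u ^ x.2.1) * V' x ^ q = 0 := by
        have h2 : (PowerSeries.X ^ m) ^ q * ∑ x : Fin A × Fin n, (PowerSeries.X ^ x.1.1 * u ^ x.2.1) * V' x ^ q = 0 := by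
          rw [← hsum, Finset.mul_sum]
          refine Finset.sum_congr rfl fun x _ => ?_
          rw [hV', mul_pow]; ring
        refine (mul_eq_zero.1 h2).resolve_left ?_
        exact pow_ne_zero _ (pow_ne_zero _ PowerSeries.X_ne_zero)
      have h3 : ∀ x, ∃ ψ, V' x ^ q = PowerSeries.C (PowerSeries.constantCoeff (V' x)) + PowerSeries.X ^ q * ψ := by
        intro x
        obtain ⟨ψ, hψ⟩ := frob_ps K (V' x)
        rw [FiniteField.pow_card] at hψ
        exact ⟨ψ, hψ⟩
      choose ψ hψ using h3
      let β : Fin A × Fin n → K := fun x => PowerSeries.constantCoeff (V' x)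
      have h4 : PowerSeries.X ^ q ∣ ev2 PowerSeries.X u (spoly β) := by
        refine ⟨-∑ x : Fin A × Fin n, (PowerSeries.X ^ x.1.1 * u ^ x.2.1) * ψ x, ?_⟩
        rw [ev2_spoly]
        have h5 := h1
        simp only [hψ, mul_add, Finset.sum_add_distrib] at h5
        rw [mul_neg, Finset.mul_sum, ← add_eq_zero_iff_eq_neg, ← h5]
        congr 1
        · refine Finset.sum_congr rfl fun x _ => ?_
          rw [PowerSeries.algebraMap_apply]; simp [β]; ring
        · refine Finset.sum_congr rfl fun x _ => by ring
      have h6 := order_bound u H (spoly β) n (n-1) e A hm hn hn0 he (spoly_coeff_natDegree β) hu hmin (spoly_natDegree β) q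
        hq h4
      have h7 := hfin β le_rfl h6
      intro x
      rw [hV', pow_succ]
      refine mul_dvd_mul_left _ (PowerSeries.X_dvd_iff.2 (congrFun h7 x))
  have hV0 : ∀ x, V x = 0 := by
    intro x
    ext m
    rw [map_zero]
    exact PowerSeries.X_pow_dvd_iff.1 (hdiv (m+1) x) m (Nat.lt_succ_self m)
  apply hα
  funext ⟨a, b, c, d⟩
  exact congrFun (hfin _ le_rfl (hV0 (a, b))) (c, d)

end S5

namespace S5
open Polynomial

lemma coeff_aeval_X {K L : Type*} [Field K] [Field L] [Algebra K L] (r : K[X]) (m : ℕ) :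
    PowerSeries.coeff m (aeval (PowerSeries.X : PowerSeries L) r) = algebraMap K L (r.coeff m) := by
  induction r using Polynomial.induction_on' with
  | add p q hp hq => simp [hp, hq]
  | monomial k a =>
    rw [aeval_monomial, PowerSeries.algebraMap_apply, PowerSeries.coeff_C_mul, PowerSeries.coeff_X_pow, coeff_monomial]
    by_cases h : m = k
    · simp [h]
    · simp [h, Ne.symm h]

lemma local_dvd {K L : Type*} [Field K] [Field L] [Algebra K L] (τ : K) (p : K[X]) (m : ℕ)
    (h : PowerSeries.X ^ m ∣ aeval (PowerSeries.C (algebraMap K L τ) + PowerSeries.X : PowerSeries L) p) :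
    (X - C τ) ^ m ∣ p := by
  have h1 : aeval (PowerSeries.C (algebraMap K L τ) + PowerSeries.X : PowerSeries L) p =
      aeval (PowerSeries.X : PowerSeries L) (p.comp (X + C τ)) := by
    rw [aeval_comp]
    congr 1
    simp [PowerSeries.algebraMap_apply, add_comm]
  rw [h1] at h
  rw [X_sub_C_pow_dvd_iff, X_pow_dvd_iff]
  intro d hd
  have := PowerSeries.X_pow_dvd_iff.1 h d hd
  rw [coeff_aeval_X] at this
  exact (map_eq_zero _).1 this

lemma gpoly_natDegree {K : Type*} [Field K] {A n J : ℕ} (q : ℕ) (α : Idx A n J → K) :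
    (gpoly q α).natDegree ≤ (n-1) * (q+1) := by
  refine natDegree_sum_le_of_forall_le _ _ fun x _ => ?_
  have h1 : C (C (α x)) * ((C X) ^ x.1.1 * X ^ x.2.1.1 * ((C X) ^ x.2.2.1.1 * X ^ x.2.2.2.1) ^ q) =
    C (C (α x) * X ^ (x.1.1 + x.2.2.1.1 * q)) * X ^ (x.2.1.1 + x.2.2.2.1 * q) := by
    simp only [C_mul, C_pow]; ring
  rw [h1]
  refine (natDegree_C_mul_X_pow_le _ _).trans ?_
  have h2 : x.2.2.2.1 * q ≤ (n-1) * q := Nat.mul_le_mul_right _ (by omega)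
  have h3 : x.2.1.1 ≤ n - 1 := by omega
  nlinarith

lemma gpoly_coeff {K : Type*} [Field K] {A n J : ℕ} (q : ℕ) (α : Idx A n J → K) (j : ℕ) :
    ((gpoly q α).coeff j).natDegree ≤ A + J * q := by
  rw [gpoly, finsetSum_coeff]
  refine natDegree_sum_le_of_forall_le _ _ fun x _ => ?_
  have h1 : C (C (α x)) * ((C X) ^ x.1.1 * X ^ x.2.1.1 * ((C X) ^ x.2.2.1.1 * X ^ x.2.2.2.1) ^ q) =
    C (C (α x) * X ^ (x.1.1 + x.2.2.1.1 * q)) * X ^ (x.2.1.1 + x.2.2.2.1 * q) := by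
    simp only [C_mul, C_pow]; ring
  rw [h1, coeff_C_mul, coeff_X_pow]
  split_ifs
  · rw [mul_one]
    refine (natDegree_C_mul_X_pow_le _ _).trans ?_
    have h2 : x.2.2.1.1 * q ≤ J * q := Nat.mul_le_mul_right _ (by omega)
    omega
  · simp

lemma ev2_eq_eval {K B : Type*} [Field K] [CommRing B] [Algebra K B] (x y : B) (P : K[X][X]) :
    ev2 x y P = eval y (P.map ((aeval x : K[X] →ₐ[K] B) : K[X] →+* B)) := by
  rw [ev2, coe_eval₂RingHom, eval_map]

lemma resc_C {L : Type*} [Field L] (a b : L) : PowerSeries.rescale a (PowerSeries.C b) = PowerSeries.C b := by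
  ext m
  rw [PowerSeries.coeff_rescale, PowerSeries.coeff_C]
  split_ifs with h <;> simp [h]

/-- The Stepanov counting inequality -/
lemma stepB {K L : Type*} [Field K] [Fintype K] [Field L] [Algebra K L] (q : ℕ) (hq : Fintype.card K = q)
    (u : PowerSeries K) (H : K[X][X]) (n e : ℕ) (hm : H.Monic) (hn : H.natDegree = n)
    (hn0 : 0 < n) (he : ∀ j, (H.coeff j).natDegree ≤ e)
    (hu : ev2 PowerSeries.X u H = 0) (hmin : ∀ P : K[X][X], P ≠ 0 → P.natDegree < n → ev2 PowerSeries.X u P ≠ 0)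
    (Ω : Finset (K × L)) (hΩ0 : ∀ p ∈ Ω, ev2 (algebraMap K L p.1) p.2 H = 0)
    (hΩ1 : ∀ p ∈ Ω, ev2 (algebraMap K L p.1) p.2 (derivative H) ≠ 0)
    (hΩ2 : ∀ p ∈ Ω, p.2 ^ q - p.2 ≠ 0)
    (M A J : ℕ) (hM : M ≤ q)
    (hcount : M * ((2 * (e + e * n) * M + (A + J + 2 * e * n) + 1) * (n * (n-1))) < A * (n * (J * n)))
    (hqA : n * A + (n-1) * e < q) :
    M * Ω.card ≤ n * (A + J * q) + (n-1) * (q+1) * e := by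
  classical
  let t : Ω → L := fun p => algebraMap K L p.1.1
  let y : Ω → L := fun p => p.1.2
  have hev : ∀ (P : K[X][X]) (p : Ω), ev2 t y P p = ev2 (algebraMap K L p.1.1) p.1.2 P :=
    fun P p => ev2_map (Pi.evalAlgHom K (fun _ : Ω => L) p) t y P
  let h : Ω → L := ev2 t y (derivative H)
  obtain ⟨α, hα, W, hW1, hW2⟩ := stepA (S := Ω → L) q hq H n e hn hn0 hm he t y
    (by funext p; change (algebraMap K L p.1.1) ^ q = _; rw [← map_pow, ← hq, FiniteField.pow_card])
    (by rw [Pi.isUnit_iff]; exact fun p => (hΩ2 p.1 p.2).isUnit)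
    (by funext p; rw [hev]; exact hΩ0 p.1 p.2) h rfl M A J hM hcount
  have hh : ∀ p : Ω, h p ≠ 0 := fun p => by simp only [h]; rw [hev]; exact hΩ1 p.1 p.2
  set g := gpoly q α with hg
  have hgne : ev2 PowerSeries.X u g ≠ 0 := by
    have := gpoly_ne u H n e A J hm hn hn0 he hu hmin α hα (by rw [hq]; exact hqA)
    rwa [hq] at this
  set N := (n-1) * (q+1) with hN
  have hres := res_ne_zero _ u H g n N hm hn hu hmin (gpoly_natDegree q α) hgne
  have hdeg := res_natDegree_le H g n N e (A + J * q) he (gpoly_coeff q α)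
  set R := resultant H g n N with hR
  -- local roots
  have hY : ∀ p : Ω, ∃ Y : PowerSeries L, PowerSeries.constantCoeff Y = p.1.2 ∧
      ev2 (PowerSeries.C (algebraMap K L p.1.1) + PowerSeries.X) Y H = 0 ∧
      PowerSeries.X ^ M ∣ ev2 (PowerSeries.C (algebraMap K L p.1.1) + PowerSeries.X) Y g := by
    intro p
    let φ : PowerSeries (Ω → L) →+* PowerSeries L := (PowerSeries.rescale ((h p ^ 2)⁻¹)).comp
      (PowerSeries.map (Pi.evalRingHom (fun _ : Ω => L) p))
    have hφ : ∀ c : K, φ (algebraMap K (PowerSeries (Ω → L)) c) = algebraMap K (PowerSeries L) c := by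
      intro c
      simp [φ, PowerSeries.algebraMap_apply, resc_C]
    have hφX : φ PowerSeries.X = PowerSeries.C ((h p ^ 2)⁻¹) * PowerSeries.X := by
      simp [φ, PowerSeries.rescale_X]
    have hφC : ∀ s : Ω → L, φ (PowerSeries.C s) = PowerSeries.C (s p) := by
      intro s; simp [φ, resc_C]
    have e1 : φ (PowerSeries.C t + PowerSeries.C (h^2) * PowerSeries.X) = PowerSeries.C (algebraMap K L p.1.1) + PowerSeries.X := by
      rw [map_add, map_mul, hφC, hφC, hφX, ← mul_assoc, ← map_mul]
      rw [Pi.pow_apply, mul_inv_cancel₀ (pow_ne_zero _ (hh p))]; simp [t]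
    refine ⟨φ (PowerSeries.C y + PowerSeries.C h * (PowerSeries.X * W)), ?_, ?_, ?_⟩
    · rw [map_add, map_mul, map_mul, hφC, hφC, hφX]; simp [y]
    · rw [← e1, ← ev2_map' φ hφ, hW1, map_zero]
    · rw [← e1, ← ev2_map' φ hφ]
      have h1 := map_dvd φ hW2
      rw [map_pow, hφX, mul_pow] at h1
      exact dvd_of_mul_left_dvd h1
  choose Y hY0 hY1 hY2 using hY
  let Ωτ : K → Finset Ω := fun τ => Finset.univ.filter fun p => p.1.1 = τ
  have hloc : ∀ τ : K, (X - C τ) ^ (M * (Ωτ τ).card) ∣ R := by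
    intro τ
    apply local_dvd (L := L)
    let ρ : K[X] →+* PowerSeries L := ((aeval (PowerSeries.C (algebraMap K L τ) + PowerSeries.X) : K[X] →ₐ[K] PowerSeries L) : K[X] →+* PowerSeries L)
    have h1 : ρ R = resultant (H.map ρ) (g.map ρ) n N := by rw [resultant_map_map]
    change _ ∣ ρ R
    rw [h1]
    have h2 : (∏ p ∈ Ωτ τ, (X - C (Y p))) ∣ H.map ρ := by
      apply Finset.prod_dvd_of_coprime
      · intro a ha b hb hab
        apply isCoprime_X_sub_C_of_isUnit_sub
        rw [PowerSeries.isUnit_iff_constantCoeff, map_sub, hY0, hY0, isUnit_iff_ne_zero, sub_ne_zero]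
        intro hab2
        apply hab
        simp only [Ωτ, Finset.coe_filter, Finset.mem_univ, true_and, Set.mem_ofPred_eq] at ha hb
        exact Subtype.ext (Prod.ext (ha.trans hb.symm) hab2)
      · intro a ha
        simp only [Ωτ, Finset.mem_filter, Finset.mem_univ, true_and] at ha
        rw [dvd_iff_isRoot, IsRoot]
        have := hY1 a
        rw [ha, ev2_eq_eval] at this
        exact this
    obtain ⟨H', hH'⟩ := h2
    have hmon : (∏ p ∈ Ωτ τ, (X - C (Y p))).Monic := monic_prod_of_monic _ _ fun p _ => monic_X_sub_C _
    have hH'0 : H' ≠ 0 := by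
      rintro rfl
      rw [mul_zero] at hH'
      exact (hm.map ρ).ne_zero hH'
    have h3 : (∏ p ∈ Ωτ τ, (X - C (Y p))).natDegree + H'.natDegree = n := by
      rw [← natDegree_mul hmon.ne_zero hH'0, ← hH', hm.natDegree_map, hn]
    have h4 : (g.map ρ).natDegree ≤ N := natDegree_map_le.trans (gpoly_natDegree q α)
    rw [hH', ← h3, resultant_mul_left _ _ _ _ h4, resultant_prod_left _ _ _ _ (by simp) h4]
    apply Dvd.dvd.mul_right
    rw [pow_mul, ← Finset.prod_const]
    refine Finset.prod_dvd_prod_of_dvd _ _ fun p hp => ?_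
    simp only [Ωτ, Finset.mem_filter, Finset.mem_univ, true_and] at hp
    rw [natDegree_X_sub_C, resultant_X_sub_C_left _ _ _ h4]
    have := hY2 p
    rw [hp, ev2_eq_eval] at this
    exact this
  have hall : (∏ τ : K, (X - C τ) ^ (M * (Ωτ τ).card)) ∣ R := by
    apply Finset.prod_dvd_of_coprime
    · intro a _ b _ hab
      exact (isCoprime_X_sub_C_of_isUnit_sub (sub_ne_zero.2 hab).isUnit).pow
    · intro a _; exact hloc a
  have hfin := natDegree_le_of_dvd hall hres
  rw [natDegree_prod_of_monic _ _ fun τ _ => (monic_X_sub_C τ).pow _] at hfin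
  simp only [natDegree_pow, natDegree_X_sub_C, mul_one] at hfin
  rw [← Finset.mul_sum] at hfin
  have hcard : ∑ τ, (Ωτ τ).card = Ω.card := by
    rw [← Finset.card_eq_sum_card_fiberwise (f := fun p : Ω => p.1.1) (s := Finset.univ) (t := Finset.univ) (by simp)]
    simp
  rw [hcard] at hfin
  omega

end S5

namespace S5
open Polynomial

lemma mem_range_of_pow {K L : Type*} [Field K] [Fintype K] [Field L] [Algebra K L] (y : L)
    (hy : y ^ Fintype.card K = y) : ∃ a : K, algebraMap K L a = y := by
  classical
  by_contra hne
  push Not at hne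
  let s : Finset L := insert y (Finset.univ.image (algebraMap K L))
  have hs : s.card = Fintype.card K + 1 := by
    rw [Finset.card_insert_of_notMem (by simpa using hne), Finset.card_image_of_injective _ (algebraMap K L).injective, Finset.card_univ]
  have h0 := FiniteField.X_pow_card_sub_X_ne_zero L (Fintype.one_lt_card (α := K))
  have h1 : s ⊆ (X ^ Fintype.card K - X : L[X]).roots.toFinset := by
    intro z hz
    rw [Multiset.mem_toFinset, mem_roots h0]
    simp only [s, Finset.mem_insert, Finset.mem_image, Finset.mem_univ, true_and] at hz
    rcases hz with rfl | ⟨a, rfl⟩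
    · simp [hy]
    · simp [← map_pow, FiniteField.pow_card]
  have h2 := (Finset.card_le_card h1).trans ((Multiset.toFinset_card_le _).trans (card_roots' _))
  rw [FiniteField.X_pow_card_sub_X_natDegree_eq L (Fintype.one_lt_card (α := K))] at h2
  omega

lemma ev2_alg {K L : Type*} [Field K] [Field L] [Algebra K L] (τ : K) (y : L) (P : K[X][X]) :
    ev2 (algebraMap K L τ) y P = eval y ((P.map (evalRingHom τ)).map (algebraMap K L)) := by
  rw [ev2_eq_eval, map_map]
  congr 2
  apply Polynomial.ringHom_ext
  · intro a; simp
  · simp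

/-- counting step -/
lemma stepC {K : Type} [Field K] [Fintype K] [DecidableEq K] (q : ℕ) (hq : Fintype.card K = q)
    (u : PowerSeries K) (H : K[X][X]) (n e : ℕ) (hm : H.Monic) (hn : H.natDegree = n)
    (hn0 : 0 < n) (he : ∀ j, (H.coeff j).natDegree ≤ e)
    (hu : ev2 PowerSeries.X u H = 0) (hmin : ∀ P : K[X][X], P ≠ 0 → P.natDegree < n → ev2 PowerSeries.X u P ≠ 0)
    (Bd : Finset K) (hB : ∀ τ ∉ Bd, (H.map (evalRingHom τ)).Separable)
    (M A J : ℕ) (hM : M ≤ q)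
    (hcount : M * ((2 * (e + e * n) * M + (A + J + 2 * e * n) + 1) * (n * (n-1))) < A * (n * (J * n)))
    (hqA : n * A + (n-1) * e < q) :
    M * (n * q) ≤ n * (A + J * q) + (n-1) * (q+1) * e + M * (n * Bd.card) +
      M * ∑ τ ∈ Finset.univ \ Bd, (H.map (evalRingHom τ)).roots.toFinset.card := by
  classical
  let L := AlgebraicClosure K
  let R : K → Finset L := fun τ => ((H.map (evalRingHom τ)).map (algebraMap K L)).roots.toFinset
  have hmon : ∀ τ, ((H.map (evalRingHom τ)).map (algebraMap K L)).Monic := fun τ => (hm.map _).map _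
  have hR : ∀ τ y, y ∈ R τ ↔ ev2 (algebraMap K L τ) y H = 0 := by
    intro τ y
    rw [Multiset.mem_toFinset, mem_roots (hmon τ).ne_zero, IsRoot, ev2_alg]
  have hRc : ∀ τ ∉ Bd, (R τ).card = n := by
    intro τ hτ
    rw [Multiset.toFinset_card_of_nodup (nodup_roots (hB τ hτ).map), IsAlgClosed.card_roots_eq_natDegree,
      (hm.map _).natDegree_map, hm.natDegree_map, hn]
  let R' : K → Finset L := fun τ => (R τ).filter fun y => y ^ q - y ≠ 0
  let Ω : Finset (K × L) := ((Finset.univ \ Bd).sigma R').map (Equiv.sigmaEquivProd K L).toEmbedding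
  have hΩ : ∀ p ∈ Ω, p.1 ∉ Bd ∧ p.2 ∈ R' p.1 := by
    intro p hp
    simp only [Ω, Finset.mem_map, Finset.mem_sigma, Finset.mem_sdiff, Finset.mem_univ, true_and] at hp
    obtain ⟨⟨a, b⟩, h, rfl⟩ := hp
    exact h
  have hΩc : Ω.card = ∑ τ ∈ Finset.univ \ Bd, (R' τ).card := by
    rw [Finset.card_map, Finset.card_sigma]
  have hmain := stepB (L := L) q hq u H n e hm hn hn0 he hu hmin Ω
    (fun p hp => (hR _ _).1 (Finset.mem_filter.1 (hΩ p hp).2).1)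
    (by
      intro p hp h0
      have h1 := (hR _ _).1 (Finset.mem_filter.1 (hΩ p hp).2).1
      have h2 := (hB p.1 (hΩ p hp).1).map (f := algebraMap K L)
      rw [ev2_alg] at h0 h1
      rw [← derivative_map, ← derivative_map] at h0
      obtain ⟨a, b, hab⟩ := h2
      have := congrArg (eval p.2) hab
      rw [eval_add, eval_mul, eval_mul, h0, h1] at this
      simp at this)
    (fun p hp => (Finset.mem_filter.1 (hΩ p hp).2).2) M A J hM hcount hqA
  have hsplit : ∀ τ ∈ Finset.univ \ Bd, n = (R' τ).card + (H.map (evalRingHom τ)).roots.toFinset.card := by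
    intro τ hτ
    rw [← hRc τ (by simpa using hτ), ← Finset.card_filter_add_card_filter_not (s := R τ) (fun y => y ^ q - y ≠ 0)]
    congr 1
    rw [← Finset.card_map ⟨algebraMap K L, (algebraMap K L).injective⟩]
    congr 1
    ext y
    simp only [Finset.mem_filter, not_not, Finset.mem_map, Function.Embedding.coeFn_mk, Multiset.mem_toFinset,
      mem_roots (hm.map (evalRingHom τ)).ne_zero, hR, ev2_alg, IsRoot]
    constructor
    · rintro ⟨h1, h2⟩
      obtain ⟨a, rfl⟩ := mem_range_of_pow (K := K) y (by rw [hq]; exact sub_eq_zero.1 h2)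
      refine ⟨a, ?_, rfl⟩
      rw [eval_map_algebraMap, aeval_algebraMap_apply] at h1
      have := (map_eq_zero _).1 h1
      simpa using this
    · rintro ⟨a, h1, rfl⟩
      refine ⟨?_, ?_⟩
      · rw [eval_map_algebraMap, aeval_algebraMap_apply]
        simp [h1]
      · rw [← map_pow, ← hq, FiniteField.pow_card, sub_self]
  have htot : ∑ τ ∈ Finset.univ \ Bd, n = Ω.card + ∑ τ ∈ Finset.univ \ Bd, (H.map (evalRingHom τ)).roots.toFinset.card := by
    rw [hΩc, ← Finset.sum_add_distrib]
    exact Finset.sum_congr rfl hsplit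
  rw [Finset.sum_const, smul_eq_mul] at htot
  have hc : q ≤ (Finset.univ \ Bd).card + Bd.card := by
    rw [← hq, ← Finset.card_univ]; exact Finset.card_le_card_sdiff_add_card
  have h1 : M * (n * q) ≤ M * (n * ((Finset.univ \ Bd).card + Bd.card)) :=
    Nat.mul_le_mul_left _ (Nat.mul_le_mul_left _ hc)
  have h2 : M * (n * ((Finset.univ \ Bd).card + Bd.card)) = M * ((Finset.univ \ Bd).card * n) + M * (n * Bd.card) := by ring
  have h2' : M * ((Finset.univ \ Bd).card * n) = M * Ω.card + M * ∑ τ ∈ Finset.univ \ Bd, (H.map (evalRingHom τ)).roots.toFinset.card := by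
    rw [htot, mul_add]
  omega

theorem stepanov (n e : ℕ) (hn0 : 0 < n) (ε : ℝ) (hε : 0 < ε) : ∃ Q : ℕ, ∀ (K : Type) [Field K] [Fintype K] [DecidableEq K],
    Q ≤ Fintype.card K → ∀ (u : PowerSeries K) (H : K[X][X]), H.Monic → H.natDegree = n →
    (∀ j, (H.coeff j).natDegree ≤ e) → ev2 PowerSeries.X u H = 0 →
    (∀ P : K[X][X], P ≠ 0 → P.natDegree < n → ev2 PowerSeries.X u P ≠ 0) →
    ∀ (Bd : Finset K), (∀ τ ∉ Bd, (H.map (evalRingHom τ)).Separable) →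
    (1 - ε) * (Fintype.card K : ℝ) - n * (Bd.card : ℝ) ≤
      ((∑ τ ∈ Finset.univ \ Bd, (H.map (evalRingHom τ)).roots.toFinset.card : ℕ) : ℝ) := by
  obtain ⟨M, hM⟩ := exists_nat_ge (max 1 ((n + n * e) * 2 / ε : ℝ))
  have hM1 : 1 ≤ M := by exact_mod_cast (le_max_left _ _).trans hM
  have hM2 := (le_max_right _ _).trans hM
  let J := M * (n-1) / n + 1
  have hJ1 : M * (n-1) + 1 ≤ n * J := by
    have := Nat.lt_mul_div_succ (M * (n-1)) hn0
    exact this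
  have hJ2 : n * J ≤ M * (n-1) + n := by
    have := Nat.mul_div_le (M * (n-1)) n
    simp only [J]; rw [mul_add]; omega
  let B := 2 * (e + e * n) * M + J + 2 * e * n + 1
  let A := M * (n - 1) * B + 1
  have hcount : M * ((2 * (e + e * n) * M + (A + J + 2 * e * n) + 1) * (n * (n-1))) < A * (n * (J * n)) := by
    have e1 : 2 * (e + e * n) * M + (A + J + 2 * e * n) + 1 = A + B := by simp only [B]; omega
    rw [e1]
    have e2 : M * ((A + B) * (n * (n-1))) = n * (A * (M * (n-1)) + M * (n-1) * B) := by ring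
    have e3 : A * (n * (J * n)) = n * (A * (n * J)) := by ring
    rw [e2, e3]
    apply Nat.mul_lt_mul_of_pos_left _ hn0
    calc A * (M * (n-1)) + M * (n-1) * B < A * (M * (n-1)) + A := by simp only [A]; omega
      _ = A * (M * (n-1) + 1) := by ring
      _ ≤ A * (n * J) := Nat.mul_le_mul_left _ hJ1
  obtain ⟨Q0, hQ0⟩ := exists_nat_ge ((n * A + n * e) * 2 / ε : ℝ)
  refine ⟨max Q0 (max M (n * A + (n-1) * e + 1)), ?_⟩
  intro K _ _ _ hQ u H hm hn he hu hmin Bd hB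
  set q := Fintype.card K with hq
  have q1 : Q0 ≤ q := (le_max_left _ _).trans hQ
  have q2 : M ≤ q := ((le_max_left _ _).trans (le_max_right _ _)).trans hQ
  have q3 : n * A + (n-1) * e + 1 ≤ q := ((le_max_right _ _).trans (le_max_right _ _)).trans hQ
  have hmain := stepC q rfl u H n e hm hn hn0 he hu hmin Bd hB M A J q2 hcount (by omega)
  set T := ∑ τ ∈ Finset.univ \ Bd, (H.map (evalRingHom τ)).roots.toFinset.card with hT
  have hJ3 : n * J + M ≤ M * n + n := by
    have : M * (n - 1) + M = M * n := by
      obtain ⟨n', rfl⟩ : ∃ n', n = n' + 1 := ⟨n - 1, by omega⟩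
      simp; ring
    omega
  have h1 : M * (n * q) + M * q ≤ n * A + (M * n + n) * q + n * (q+1) * e + M * (n * Bd.card) + M * T := by
    have a1 : (n-1) * (q+1) * e ≤ n * (q+1) * e := Nat.mul_le_mul_right _ (Nat.mul_le_mul_right _ (by omega))
    have a2 := Nat.mul_le_mul_right q hJ3
    have a3 : n * (A + J * q) + M * q = n * A + (n * J + M) * q := by ring
    omega
  have h2 : ((M * (n * q) + M * q : ℕ) : ℝ) ≤ ((n * A + (M * n + n) * q + n * (q+1) * e + M * (n * Bd.card) + M * T : ℕ) : ℝ) := by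
    exact_mod_cast h1
  push_cast at h2
  have hMr : (1:ℝ) ≤ M := by exact_mod_cast hM1
  have hqr : (Q0:ℝ) ≤ q := by exact_mod_cast q1
  have h3 : (n * A + n * e : ℝ) * 2 ≤ ε * q := by
    have := hQ0.trans hqr
    rw [div_le_iff₀ hε] at this
    linarith
  have h4 : (n + n * e : ℝ) * 2 ≤ ε * M := by
    rw [div_le_iff₀ hε] at hM2
    linarith
  have hq0 : (0:ℝ) ≤ q := by positivity
  have h5 : (n + n * e : ℝ) * 2 * q ≤ ε * M * q := mul_le_mul_of_nonneg_right h4 hq0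
  have h6 : ε * q ≤ ε * q * M := le_mul_of_one_le_right (by positivity) hMr
  have h7 : (M:ℝ) * ((1 - ε) * q - n * Bd.card) ≤ M * T := by nlinarith
  exact le_of_mul_le_mul_left h7 (by linarith)

end S5

namespace S5
open Polynomial

lemma mv_congr {K B ι : Type*} [Field K] [CommRing B] [Algebra K B] (b : B) (x y : ι → B)
    (h : ∀ i, b ∣ x i - y i) (g : MvPolynomial ι K) : b ∣ MvPolynomial.aeval x g - MvPolynomial.aeval y g := by
  rw [← Ideal.mem_span_singleton, ← Ideal.Quotient.eq]
  have e : ∀ z : ι → B, (Ideal.Quotient.mk (Ideal.span {b})) (MvPolynomial.aeval z g) =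
      MvPolynomial.aeval (fun i => Ideal.Quotient.mkₐ K (Ideal.span {b}) (z i)) g := by
    intro z
    exact (MvPolynomial.comp_aeval_apply (φ := Ideal.Quotient.mkₐ K (Ideal.span {b})) (f := z) g)
  rw [e, e]
  congr 2
  funext i
  exact Ideal.Quotient.eq.2 (Ideal.mem_span_singleton.2 (h i))

lemma aeval_sub_dvd' {K B : Type*} [Field K] [CommRing B] [Algebra K B] (x y : B) (p : K[X]) : x - y ∣ aeval x p - aeval y p := by
  rw [← eval_map_algebraMap, ← eval_map_algebraMap]; exact sub_dvd_eval_sub _ _ _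

lemma hens_pts {K ι : Type*} [Field K] (p : K[X]) (g : ι → MvPolynomial ι K) (α : ι → K) (r : ι → K[X])
    (hp : ∀ i, p = (X - C (α i)) * r i) (hr : ∀ i, (r i).eval (α i) ≠ 0) :
    ∃ x : ι → PowerSeries K, (∀ i, PowerSeries.constantCoeff (x i) = α i) ∧
      ∀ i, aeval (x i) p + PowerSeries.X * MvPolynomial.aeval x (g i) = 0 := by
  let z : (ι → PowerSeries K) → ι → PowerSeries K := fun w i => PowerSeries.C (α i) + PowerSeries.X * w i
  let Φ : (ι → PowerSeries K) → ι → PowerSeries K := fun w i =>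
    w i - PowerSeries.C ((r i).eval (α i))⁻¹ * (w i * aeval (z w i) (r i) + MvPolynomial.aeval (z w) (g i))
  obtain ⟨w, hw, -⟩ := contr Φ (fun _ _ => Set.univ) (fun _ _ => trivial) (fun _ _ _ _ => trivial) (by
    intro x y N hxy i
    have hz : ∀ i, PowerSeries.X ^ (N+1) ∣ z x i - z y i := by
      intro i
      have : z x i - z y i = PowerSeries.X * (x i - y i) := by simp only [z]; ring
      rw [this, pow_succ']
      exact mul_dvd_mul_left _ (hxy i)
    have h1 : PowerSeries.X ^ (N+1) ∣ MvPolynomial.aeval (z x) (g i) - MvPolynomial.aeval (z y) (g i) :=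
      mv_congr _ _ _ hz _
    have h2 : PowerSeries.X ^ (N+1) ∣ aeval (z x i) (r i) - aeval (z y i) (r i) :=
      (hz i).trans (aeval_sub_dvd' _ _ _)
    have h3 : PowerSeries.X ∣ aeval (z x i) (r i) - PowerSeries.C ((r i).eval (α i)) := by
      have : PowerSeries.C ((r i).eval (α i)) = aeval (PowerSeries.C (α i)) (r i) := by
        rw [show PowerSeries.C (α i) = algebraMap K (PowerSeries K) (α i) from rfl, aeval_algebraMap_apply]
        simp
      rw [this]
      refine dvd_trans ?_ (aeval_sub_dvd' _ _ _)
      simp [z]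
    have h4 : PowerSeries.C ((r i).eval (α i))⁻¹ * PowerSeries.C ((r i).eval (α i)) = 1 := by
      rw [← map_mul, inv_mul_cancel₀ (hr i), map_one]
    have : Φ x i - Φ y i = -PowerSeries.C ((r i).eval (α i))⁻¹ * ((x i - y i) * (aeval (z x i) (r i) - PowerSeries.C ((r i).eval (α i)))
        + y i * (aeval (z x i) (r i) - aeval (z y i) (r i)) + (MvPolynomial.aeval (z x) (g i) - MvPolynomial.aeval (z y) (g i))) := by
      simp only [Φ]
      linear_combination (-(x i - y i)) * h4
    rw [this]
    refine Dvd.dvd.mul_left (dvd_add (dvd_add ?_ (h2.mul_left _)) h1) _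
    rw [pow_succ]
    exact mul_dvd_mul (hxy i) h3)
  refine ⟨z w, fun i => by simp [z], fun i => ?_⟩
  have h := congrFun hw i
  simp only [Φ] at h
  have h5 : w i * aeval (z w i) (r i) + MvPolynomial.aeval (z w) (g i) = 0 := by
    have := sub_eq_self.1 h
    refine (mul_eq_zero.1 this).resolve_left ?_
    intro h0
    exact inv_ne_zero (hr i) ((map_eq_zero_iff _ PowerSeries.C_injective).1 h0)
  rw [hp i]
  have : aeval (z w i) (X - C (α i)) = PowerSeries.X * w i := by
    simp only [map_sub, aeval_X, aeval_C, z]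
    rw [show PowerSeries.C (α i) = algebraMap K (PowerSeries K) (α i) from rfl]; ring
  rw [map_mul, this]
  linear_combination PowerSeries.X * h5
end S5

namespace S5
open Polynomial

abbrev MI (ι : Type*) (M : ℕ) := {e : ι →₀ ℕ // e.degree ≤ M}

instance finite_MI (ι : Type*) [Finite ι] (M : ℕ) : Finite (MI ι M) := Finsupp.finite_of_degree_le M

lemma tdeg_aeval_X {K ι : Type*} [Field K] (i : ι) (r : K[X]) (n : ℕ) (h : r.natDegree ≤ n) :
    (aeval (MvPolynomial.X i : MvPolynomial ι K) r).totalDegree ≤ n := by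
  rw [aeval_eq_sum_range]
  refine MvPolynomial.totalDegree_finsetSum_le fun j hj => ?_
  refine (MvPolynomial.totalDegree_smul_le _ _).trans ?_
  rw [MvPolynomial.totalDegree_X_pow]
  simp at hj; omega

lemma adj_natDegree_le {K n : Type*} [Field K] [Fintype n] [DecidableEq n] (A : Matrix n n K[X]) (c : ℕ)
    (h : ∀ i j, (A i j).natDegree ≤ c) (i j : n) : (A.adjugate i j).natDegree ≤ Fintype.card n * c := by
  rw [Matrix.adjugate_apply]
  refine (det_natDegree_le' _ (fun _ => c) ?_).trans (by simp)
  intro a b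
  rw [Matrix.updateRow_apply]
  split_ifs
  · by_cases hb : b = i
    · subst hb; simp
    · simp [hb]
  · exact h _ _

lemma aeval_sum_MI {K B ι : Type*} [Field K] [CommRing B] [Algebra K B] [Finite ι] (M : ℕ) [Fintype (MI ι M)]
    (x : ι → B) (P : MvPolynomial ι K) (hP : P.totalDegree ≤ M) :
    MvPolynomial.aeval x P = ∑ e : MI ι M, algebraMap K B (P.coeff e.1) * e.1.prod (fun i n => x i ^ n) := by
  classical
  rw [MvPolynomial.aeval_def, MvPolynomial.eval₂_eq]
  symm
  have : ∀ e : MI ι M, algebraMap K B (P.coeff e.1) * e.1.prod (fun i n => x i ^ n) =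
    (fun e : ι →₀ ℕ => algebraMap K B (P.coeff e) * ∏ i ∈ e.support, x i ^ e i) e.1 := fun e => rfl
  refine (Finset.sum_congr rfl fun e _ => this e).trans ?_
  refine (Finset.sum_map Finset.univ (Function.Embedding.subtype _)
    (fun e : ι →₀ ℕ => algebraMap K B (P.coeff e) * ∏ i ∈ e.support, x i ^ e i)).symm.trans ?_
  symm
  refine Finset.sum_subset ?_ ?_
  · intro e he
    simp only [Finset.mem_map, Finset.mem_univ, true_and, Function.Embedding.coe_subtype, Subtype.exists, exists_prop, exists_eq_right]
    exact (MvPolynomial.le_totalDegree he).trans hP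
  · intro e _ he
    rw [MvPolynomial.notMem_support_iff.1 he]; simp

lemma elim {K ι : Type*} [Field K] [Fintype ι] [DecidableEq ι] (d M : ℕ) (hd : 0 < d) (hM : Fintype.card ι * d ≤ M)
    (p : K[X]) (hp : p.Monic) (hpd : p.natDegree = d) (g : ι → MvPolynomial ι K) (hg : ∀ i, (g i).totalDegree ≤ d) :
    ∃ (ρ : K[X]) (N : ι → (ι → Fin d) → (ι → Fin d) → K[X]), ρ.eval 0 = 1 ∧ ρ.natDegree ≤ Nat.card (MI ι M) ∧
      (∀ i a b, (N i a b).natDegree ≤ Nat.card (MI ι M)) ∧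
      ∀ x : ι → PowerSeries K, (∀ i, aeval (x i) p + PowerSeries.X * MvPolynomial.aeval x (g i) = 0) →
        ∀ i b, (ρ : PowerSeries K) * (x i * ∏ j, x j ^ (b j : ℕ)) = ∑ a : ι → Fin d, (∏ j, x j ^ (a j : ℕ)) * (N i a b : PowerSeries K) := by
  classical
  have : Fintype (MI ι M) := Fintype.ofFinite _
  -- the rows
  have hrow : ∀ e : MI ι M, ∃ P0 P1 : MvPolynomial ι K, P0.totalDegree ≤ M ∧ P1.totalDegree ≤ M ∧
      (P0.coeff e.1 = 1) ∧ (∀ e' : ι →₀ ℕ, e' ≠ e.1 → e.1.degree ≤ e'.degree → P0.coeff e' = 0) ∧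
      ∀ x : ι → PowerSeries K, (∀ i, aeval (x i) p + PowerSeries.X * MvPolynomial.aeval x (g i) = 0) →
        MvPolynomial.aeval x P0 + PowerSeries.X * MvPolynomial.aeval x P1 =
          if ∀ i, e.1 i < d then e.1.prod (fun i n => x i ^ n) else 0 := by
    rintro ⟨e, he⟩
    by_cases h : ∀ i, e i < d
    · refine ⟨MvPolynomial.monomial e 1, 0, ?_, by simp, by simp, ?_, ?_⟩
      · rw [MvPolynomial.totalDegree_monomial _ one_ne_zero]; exact he
      · intro e' h1 _
        simp [MvPolynomial.coeff_monomial, h1.symm]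
      · intro x _
        rw [if_pos h]
        simp [MvPolynomial.aeval_monomial]
    · have h' := h
      push Not at h
      obtain ⟨i, hi⟩ := h
      set s : ι →₀ ℕ := e - Finsupp.single i d with hs
      have hse : s + Finsupp.single i d = e := by
        ext j
        simp only [hs, Finsupp.add_apply, Finsupp.tsub_apply, Finsupp.single_apply]
        split_ifs with hj
        · subst hj; omega
        · omega
      have hdeg : s.degree + d = e.degree := by
        rw [← hse, map_add, Finsupp.degree_single]
      have hm : (MvPolynomial.monomial s (1:K)).totalDegree = s.degree :=
        MvPolynomial.totalDegree_monomial _ one_ne_zero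
      have hP0 : MvPolynomial.monomial s (1:K) * aeval (MvPolynomial.X i) p = MvPolynomial.monomial e 1 +
          MvPolynomial.monomial s 1 * aeval (MvPolynomial.X i) p.eraseLead := by
        conv_lhs => rw [← eraseLead_add_C_mul_X_pow p]
        rw [hp.leadingCoeff, hpd, map_add, mul_add, add_comm]
        congr 1
        rw [← hse]
        simp [MvPolynomial.X_pow_eq_monomial, MvPolynomial.monomial_mul]
      have hlow : ∀ e' : ι →₀ ℕ, e.degree ≤ e'.degree → MvPolynomial.coeff e' (MvPolynomial.monomial s (1:K) * aeval (MvPolynomial.X i) p.eraseLead) = 0 := by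
        intro e' h1
        apply MvPolynomial.coeff_eq_zero_of_totalDegree_lt
        refine lt_of_le_of_lt (MvPolynomial.totalDegree_mul _ _) ?_
        have := tdeg_aeval_X i p.eraseLead (d-1) (by rw [← hpd]; exact eraseLead_natDegree_le p)
        have h2 : ∑ j ∈ e'.support, e' j = e'.degree := rfl
        omega
      refine ⟨MvPolynomial.monomial s 1 * aeval (MvPolynomial.X i) p, MvPolynomial.monomial s 1 * g i, ?_, ?_, ?_, ?_, ?_⟩
      · refine (MvPolynomial.totalDegree_mul _ _).trans ?_
        have := tdeg_aeval_X i p d hpd.le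
        omega
      · refine (MvPolynomial.totalDegree_mul _ _).trans ?_
        have := hg i
        omega
      · rw [hP0, MvPolynomial.coeff_add, hlow _ le_rfl]; simp
      · intro e' h1 h2
        rw [hP0, MvPolynomial.coeff_add, hlow _ h2]
        simp [MvPolynomial.coeff_monomial, h1.symm]
      · intro x hx
        rw [if_neg h']
        have e1 : MvPolynomial.aeval x (aeval (MvPolynomial.X i : MvPolynomial ι K) p) = aeval (x i) p := by
          rw [← aeval_algHom_apply, MvPolynomial.aeval_X]
        rw [map_mul, map_mul, e1]
        linear_combination (MvPolynomial.aeval x (MvPolynomial.monomial s (1:K))) * hx i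
  choose P0 P1 hP0 hP1 hc1 hc0 hev using hrow
  let A : Matrix (MI ι M) (MI ι M) K[X] := fun e e' => C ((P0 e).coeff e'.1) + X * C ((P1 e).coeff e'.1)
  have hAd : ∀ e e', (A e e').natDegree ≤ 1 := by
    intro e e'
    simp only [A]
    compute_degree
  let emb : (ι → Fin d) → MI ι M := fun b => ⟨Finsupp.equivFunOnFinite.symm (fun i => (b i : ℕ)), by
    rw [Finsupp.degree_eq_sum]
    refine le_trans (Finset.sum_le_card_nsmul _ _ d ?_) (by simpa using hM)
    intro i _; simp [(b i).2.le]⟩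
  have hemb1 : ∀ (i : ι) (b : ι → Fin d), ((emb b).1 + Finsupp.single i 1).degree ≤ M := by
    intro i b
    rw [Finsupp.degree_eq_sum]
    refine le_trans (Finset.sum_le_card_nsmul _ _ d ?_) (by simpa using hM)
    intro j _
    have := (b j).2
    simp only [emb, Finsupp.add_apply, Finsupp.equivFunOnFinite_symm_apply_apply, Finsupp.single_apply]
    split_ifs <;> omega
  refine ⟨A.det, fun i a b => A.adjugate ⟨(emb b).1 + Finsupp.single i 1, hemb1 i b⟩ (emb a), ?_, ?_, ?_, ?_⟩
  · have hA0 : ∀ e e', (evalRingHom (0:K)).mapMatrix A e e' = (P0 e).coeff e'.1 := by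
      intro e e'
      show (A e e').eval 0 = _
      simp [A]
    have h1 : A.det.eval 0 = ((evalRingHom (0:K)).mapMatrix A).det := by
      rw [← RingHom.map_det]; rfl
    rw [h1]
    have hbt : ((evalRingHom (0:K)).mapMatrix A).BlockTriangular (fun e => OrderDual.toDual e.1.degree) := by
      intro e e' h
      have h2 : e.1.degree < e'.1.degree := h
      rw [hA0]
      exact hc0 e e'.1 (fun h3 => by rw [h3] at h2; exact lt_irrefl _ h2) h2.le
    rw [hbt.det]
    refine Finset.prod_eq_one fun a _ => ?_
    have : ((evalRingHom (0:K)).mapMatrix A).toSquareBlock (fun e => OrderDual.toDual e.1.degree) a = 1 := by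
      ext ⟨e, he⟩ ⟨e', he'⟩
      rw [Matrix.toSquareBlock_def, Matrix.of_apply, hA0]
      by_cases h : e = e'
      · subst h; simp [hc1]
      · rw [Matrix.one_apply_ne (by simpa using h)]
        refine hc0 e e'.1 (fun h3 => h (Subtype.ext h3.symm)) ?_
        rw [← he] at he'
        exact le_of_eq (OrderDual.toDual.injective he').symm
    rw [this, Matrix.det_one]
  · refine (det_natDegree_le' _ (fun _ => 1) hAd).trans (by simp)
  · intro i a b
    refine (adj_natDegree_le A 1 hAd _ _).trans (by simp)
  · intro x hx i b
    have hmv : ∀ e, ∑ e', (A e e' : PowerSeries K) * e'.1.prod (fun i n => x i ^ n) =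
        if ∀ i, e.1 i < d then e.1.prod (fun i n => x i ^ n) else 0 := by
      intro e
      rw [← hev e x hx, aeval_sum_MI M x _ (hP0 e), aeval_sum_MI M x _ (hP1 e), Finset.mul_sum, ← Finset.sum_add_distrib]
      refine Finset.sum_congr rfl fun e' _ => ?_
      simp only [A, coe_add, coe_mul, coe_C, coe_X]
      rw [show (algebraMap K (PowerSeries K)) = PowerSeries.C from rfl]
      ring
    set e0 : MI ι M := ⟨(emb b).1 + Finsupp.single i 1, hemb1 i b⟩ with he0
    have hadj : ∀ e', ∑ e, A.adjugate e0 e * A e e' = if e0 = e' then A.det else 0 := by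
      intro e'
      have := congrFun (congrFun A.adjugate_mul e0) e'
      rw [Matrix.mul_apply] at this
      rw [this]
      simp [Matrix.smul_apply, Matrix.one_apply]
    have h1 : (A.det : PowerSeries K) * e0.1.prod (fun i n => x i ^ n) = ∑ e, (A.adjugate e0 e : PowerSeries K) *
        (if ∀ i, e.1 i < d then e.1.prod (fun i n => x i ^ n) else 0) := by
      simp only [← hmv, Finset.mul_sum]
      rw [Finset.sum_comm]
      have h2 : ∀ e', ∑ e, (A.adjugate e0 e : PowerSeries K) * ((A e e' : PowerSeries K) * e'.1.prod (fun i n => x i ^ n))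
          = if e0 = e' then (A.det : PowerSeries K) * e'.1.prod (fun i n => x i ^ n) else 0 := by
        intro e'
        have h3 := congrArg (Polynomial.coeToPowerSeries.ringHom) (hadj e')
        rw [map_sum] at h3
        simp only [map_mul, coeToPowerSeries.ringHom_apply] at h3
        simp only [← mul_assoc]
        rw [← Finset.sum_mul, h3]
        split_ifs <;> simp
      rw [Finset.sum_congr rfl fun e' _ => h2 e', Finset.sum_ite_eq, if_pos (Finset.mem_univ _)]
    have hprod : ∀ e : ι →₀ ℕ, e.prod (fun i n => x i ^ n) = ∏ j, x j ^ (e j) := by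
      intro e; exact Finsupp.prod_fintype _ _ (by simp)
    have h4 : e0.1.prod (fun i n => x i ^ n) = x i * ∏ j, x j ^ (b j : ℕ) := by
      rw [hprod]
      simp only [he0, emb, Finsupp.add_apply, Finsupp.equivFunOnFinite_symm_apply_apply, pow_add, Finset.prod_mul_distrib]
      rw [mul_comm]
      congr 1
      rw [Finset.prod_eq_single i]
      · simp
      · intro j _ hj; simp [hj.symm]
      · simp
    rw [h4] at h1
    rw [h1]
    symm
    refine Finset.sum_of_injOn emb ?_ (by simp) ?_ ?_
    · intro a _ b _ h
      have := congrArg Subtype.val h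
      simp only [emb] at this
      have h5 := Finsupp.equivFunOnFinite.symm.injective this
      funext i
      exact Fin.ext (congrFun h5 i)
    · intro e _ he
      rw [if_neg, mul_zero]
      intro h
      apply he
      refine ⟨fun i => ⟨e.1 i, h i⟩, by simp, ?_⟩
      apply Subtype.ext; ext i; simp [emb]
    · intro a _
      rw [if_pos (by intro j; simp [emb]), hprod]
      simp only [emb, Finsupp.equivFunOnFinite_symm_apply_apply]
      ring
end S5

namespace S5
open Polynomial

/-- bidegree bound -/
def BD {K : Type*} [Field K] (c m : ℕ) (P : K[X][X]) : Prop := P.natDegree ≤ m ∧ ∀ j, (P.coeff j).natDegree ≤ c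

section
variable {K : Type*} [Field K]

lemma BD.mono {c c' m m' : ℕ} {P : K[X][X]} (h : BD c m P) (hc : c ≤ c') (hm : m ≤ m') : BD c' m' P :=
  ⟨h.1.trans hm, fun j => (h.2 j).trans hc⟩

lemma BD.mul {c c' m m' : ℕ} {P Q : K[X][X]} (h : BD c m P) (h' : BD c' m' Q) : BD (c + c') (m + m') (P * Q) := by
  refine ⟨natDegree_mul_le.trans (add_le_add h.1 h'.1), fun j => ?_⟩
  rw [coeff_mul]
  refine natDegree_sum_le_of_forall_le _ _ fun p _ => ?_
  exact natDegree_mul_le.trans (add_le_add (h.2 _) (h'.2 _))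

lemma BD.sum {α : Type*} (s : Finset α) {c m : ℕ} {P : α → K[X][X]} (h : ∀ i ∈ s, BD c m (P i)) : BD c m (∑ i ∈ s, P i) := by
  refine ⟨natDegree_sum_le_of_forall_le _ _ fun i hi => (h i hi).1, fun j => ?_⟩
  rw [finsetSum_coeff]
  exact natDegree_sum_le_of_forall_le _ _ fun i hi => (h i hi).2 j

lemma BD.C {c : ℕ} {p : K[X]} (h : p.natDegree ≤ c) : BD c 0 (Polynomial.C p) := by
  refine ⟨by simp, fun j => ?_⟩
  rw [coeff_C]; split_ifs <;> simp [h]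

lemma BD.X : BD 0 1 (X : K[X][X]) := by
  refine ⟨natDegree_X_le, fun j => ?_⟩
  rw [coeff_X]; split_ifs <;> simp

lemma BD.zero {c m : ℕ} : BD c m (0 : K[X][X]) := ⟨by simp, by simp⟩
lemma BD.one : BD 0 0 (1 : K[X][X]) := by
  have := BD.C (K := K) (c := 0) (p := 1) (by simp)
  simpa using this

lemma BD.neg {c m : ℕ} {P : K[X][X]} (h : BD c m P) : BD c m (-P) := ⟨by simpa using h.1, fun j => by simpa using h.2 j⟩

lemma BD.sub {c m : ℕ} {P Q : K[X][X]} (h : BD c m P) (h' : BD c m Q) : BD c m (P - Q) := by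
  refine ⟨(natDegree_sub_le _ _).trans (max_le h.1 h'.1), fun j => ?_⟩
  rw [coeff_sub]; exact (natDegree_sub_le _ _).trans (max_le (h.2 _) (h'.2 _))

lemma BD.prod {α : Type*} (s : Finset α) {c m : ℕ} {P : α → K[X][X]} (h : ∀ i ∈ s, BD c m (P i)) :
    BD (s.card * c) (s.card * m) (∏ i ∈ s, P i) := by
  classical
  induction s using Finset.induction_on with
  | empty => simpa using BD.one
  | insert a s ha ih =>
    rw [Finset.prod_insert ha, Finset.card_insert_of_notMem ha]
    exact ((h a (by simp)).mul (ih fun i hi => h i (by simp [hi]))).mono (by ring_nf; rfl) (by ring_nf; rfl)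

lemma BD.deriv {c m : ℕ} {P : K[X][X]} (h : BD c m P) : BD c m (derivative P) := by
  refine ⟨(natDegree_derivative_le _).trans ((Nat.sub_le _ _).trans h.1), fun j => ?_⟩
  rw [coeff_derivative]
  refine natDegree_mul_le.trans ?_
  have : ((j : K[X]) + 1).natDegree = 0 := by
    have := natDegree_natCast (R := K) (j+1)
    push_cast at this; exact this
  rw [this]; simpa using h.2 _

lemma BD.det {n : Type*} [Fintype n] [DecidableEq n] {c m : ℕ} {A : Matrix n n K[X][X]} (h : ∀ i j, BD c m (A i j)) :
    BD (Fintype.card n * c) (Fintype.card n * m) A.det := by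
  rw [Matrix.det_apply]
  refine BD.sum _ fun σ _ => ?_
  have := BD.prod Finset.univ (P := fun i => A (σ i) i) (fun i _ => h _ _)
  rw [Finset.card_univ] at this
  rcases Int.units_eq_one_or (Equiv.Perm.sign σ) with h1 | h1 <;> rw [h1]
  · simpa using this
  · simpa using this.neg

lemma BD.adj {n : Type*} [Fintype n] [DecidableEq n] {c m : ℕ} {A : Matrix n n K[X][X]} (h : ∀ i j, BD c m (A i j)) (i j : n) :
    BD (Fintype.card n * c) (Fintype.card n * m) (A.adjugate i j) := by
  rw [Matrix.adjugate_apply]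
  refine BD.det fun a b => ?_
  rw [Matrix.updateRow_apply]
  split_ifs
  · by_cases hb : b = i
    · subst hb; simpa using BD.one.mono (Nat.zero_le _) (Nat.zero_le _)
    · simpa [hb] using BD.zero
  · exact h _ _

lemma swap_coeff (P : K[X][X]) (i j : ℕ) : ((Bivariate.swap P).coeff i).coeff j = (P.coeff j).coeff i := by
  induction P using Polynomial.induction_on' with
  | add p q hp hq => simp [hp, hq]
  | monomial n f =>
    rw [Bivariate.swap_monomial, coeff_mul_C, coeff_map, coeff_C_mul, coeff_X_pow, coeff_monomial]
    by_cases h : j = n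
    · simp [h]
    · simp [h, Ne.symm h]

lemma BD_dvd {c m : ℕ} {P H : K[X][X]} (hP : BD c m P) (h0 : P ≠ 0) (hH : H ∣ P) : BD c m H := by
  refine ⟨(natDegree_le_of_dvd hH h0).trans hP.1, fun j => ?_⟩
  have h1 : (Bivariate.swap P).natDegree ≤ c := by
    rw [natDegree_le_iff_coeff_eq_zero]
    intro i hi
    ext j
    rw [swap_coeff, coeff_eq_zero_of_natDegree_lt ((hP.2 j).trans_lt hi)]; simp
  have h2 : (Bivariate.swap H).natDegree ≤ c := by
    refine (natDegree_le_of_dvd (_root_.map_dvd Bivariate.swap hH) ?_).trans h1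
    exact (map_ne_zero_iff _ (Bivariate.swap (R := K)).injective).2 h0
  rw [natDegree_le_iff_coeff_eq_zero]
  intro i hi
  rw [← swap_coeff, coeff_eq_zero_of_natDegree_lt (h2.trans_lt hi)]; simp

end

lemma conj {R B n : Type*} [CommRing R] [CommRing B] [IsDomain B] [Fintype n] [DecidableEq n] (φ : R →+* B)
    (V : Matrix n n B) (hV : V.det ≠ 0) (N N' : Matrix n n R) (θ y : n → B)
    (h : V * N.map φ = Matrix.diagonal θ * V) (h' : V * N'.map φ = Matrix.diagonal y * V) :
    N.charpoly.map φ = ∏ s, (X - C (θ s)) ∧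
    (Matrix.trace (N.charmatrix.adjugate * N'.map C)).map φ = ∑ s, (∏ s' ∈ Finset.univ.erase s, (X - C (θ s'))) * C (y s) := by
  set V' : Matrix n n B[X] := V.map C with hV'
  have hdet : V'.det ≠ 0 := by
    have : V'.det = C V.det := by rw [hV', ← RingHom.mapMatrix_apply, ← RingHom.map_det]
    rw [this]; simpa using hV
  set Dg : Matrix n n B[X] := Matrix.diagonal (fun s => X - C (θ s)) with hDg
  set Ch : Matrix n n B[X] := (N.map φ).charmatrix with hCh
  have hCh' : (mapRingHom φ).mapMatrix N.charmatrix = Ch := by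
    rw [hCh]; exact Matrix.charmatrix_map N φ |>.symm
  have hD : Dg = Matrix.diagonal (fun _ => X) - Matrix.diagonal (fun s => C (θ s)) := by
    rw [hDg, Matrix.diagonal_sub]
  have hC1 : V' * Ch = Dg * V' := by
    have e1 : V' * (N.map φ).map C = Matrix.diagonal (fun s => C (θ s)) * V' := by
      have := congrArg (C : B →+* B[X]).mapMatrix h
      rw [map_mul, map_mul] at this
      simpa [RingHom.mapMatrix_apply, Matrix.diagonal_map] using this
    rw [hCh, Matrix.charmatrix, hD, mul_sub, sub_mul, RingHom.mapMatrix_apply, e1]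
    congr 1
    ext1 i j; simp [Matrix.scalar_apply, mul_comm]
  have hC2 : V' * (N'.map φ).map C = Matrix.diagonal (fun s => C (y s)) * V' := by
    have := congrArg (C : B →+* B[X]).mapMatrix h'
    rw [map_mul, map_mul] at this
    simpa [RingHom.mapMatrix_apply, Matrix.diagonal_map] using this
  constructor
  · have h1 : N.charpoly.map φ = Ch.det := by
      rw [Matrix.charpoly, ← coe_mapRingHom, RingHom.map_det, hCh']
    have h2 := congrArg Matrix.det hC1
    rw [Matrix.det_mul, Matrix.det_mul, mul_comm] at h2
    rw [h1, mul_right_cancel₀ hdet h2, hDg, Matrix.det_diagonal]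
  · have h1 : (Matrix.trace (N.charmatrix.adjugate * N'.map C)).map φ = Matrix.trace (Ch.adjugate * (N'.map φ).map C) := by
      have h0 : ∀ A : Matrix n n R[X], (Matrix.trace A).map φ = Matrix.trace ((mapRingHom φ).mapMatrix A) := by
        intro A
        simp [Matrix.trace, Polynomial.map_sum]
      rw [h0, map_mul, RingHom.map_adjugate, hCh']
      congr 2
      ext1 i j; simp
    rw [h1]
    have h3 : Ch.adjugate * V'.adjugate = V'.adjugate * Dg.adjugate := by
      rw [← Matrix.adjugate_mul_distrib, hC1, Matrix.adjugate_mul_distrib]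
    have h4 : V'.det * Matrix.trace (Ch.adjugate * (N'.map φ).map C) =
        V'.det * Matrix.trace (Dg.adjugate * Matrix.diagonal (fun s => C (y s))) := by
      calc V'.det * Matrix.trace (Ch.adjugate * (N'.map φ).map C)
          = Matrix.trace (Ch.adjugate * (V'.adjugate * V') * (N'.map φ).map C) := by
            rw [Matrix.adjugate_mul]; simp
        _ = Matrix.trace (V'.adjugate * (Dg.adjugate * Matrix.diagonal (fun s => C (y s)) * V')) := by
            rw [← mul_assoc, h3, mul_assoc, mul_assoc, hC2]; simp only [mul_assoc]
        _ = Matrix.trace (Dg.adjugate * Matrix.diagonal (fun s => C (y s)) * (V' * V'.adjugate)) := by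
            rw [Matrix.trace_mul_comm, mul_assoc]
        _ = _ := by rw [Matrix.mul_adjugate]; simp
    rw [mul_left_cancel₀ hdet h4, hDg, Matrix.adjugate_diagonal, Matrix.diagonal_mul_diagonal, Matrix.trace_diagonal]
end S5

namespace S5
open Polynomial

lemma det_grid_ne {K ι : Type*} [Field K] [Fintype ι] [DecidableEq ι] (d : ℕ) (a : Fin d → K) (ha : Function.Injective a) :
    (Matrix.of fun (s b : ι → Fin d) => ∏ i, a (s i) ^ (b i : ℕ)).det ≠ 0 := by
  have hv : IsUnit (Matrix.vandermonde a).det := (Matrix.det_vandermonde_ne_zero_iff.2 ha).isUnit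
  have h1 := Matrix.mul_nonsing_inv _ hv
  set W := (Matrix.vandermonde a)⁻¹ with hW
  have h2 : (Matrix.of fun (s b : ι → Fin d) => ∏ i, a (s i) ^ (b i : ℕ)) *
      (Matrix.of fun (b s : ι → Fin d) => ∏ i, W (b i) (s i)) = 1 := by
    ext1 s s'
    rw [Matrix.mul_apply]
    simp only [Matrix.of_apply, ← Finset.prod_mul_distrib]
    rw [← Fintype.prod_sum (f := fun i (r : Fin d) => a (s i) ^ (r : ℕ) * W r (s' i))]
    have h3 : ∀ i, ∑ r : Fin d, a (s i) ^ (r : ℕ) * W r (s' i) = if s i = s' i then 1 else 0 := by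
      intro i
      have := congrFun (congrFun h1 (s i)) (s' i)
      rw [Matrix.mul_apply, Matrix.one_apply] at this
      exact this
    simp only [h3]
    rw [Matrix.one_apply]
    split_ifs with h
    · subst h; simp
    · obtain ⟨i, hi⟩ := Function.ne_iff.1 h
      exact Finset.prod_eq_zero (Finset.mem_univ i) (if_neg hi)
  have h4 := congrArg Matrix.det h2
  rw [Matrix.det_mul, Matrix.det_one] at h4
  exact left_ne_zero_of_mul_eq_one h4

/-- the constant -/
noncomputable def cMI (ι : Type*) [Fintype ι] (d : ℕ) : ℕ := Nat.card (MI ι (Fintype.card ι * d))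

lemma geo {K ι : Type*} [Field K] [Fintype ι] [DecidableEq ι] (d : ℕ) (hd : 0 < d)
    (a : Fin d → K) (ha : Function.Injective a) (g : ι → MvPolynomial ι K) (hg : ∀ i, (g i).totalDegree ≤ d)
    (l : ι → K) (hl : ∀ s s' : ι → Fin d, ∑ i, l i * a (s i) = ∑ i, l i * a (s' i) → s = s') (n c : ℕ)
    (hn : n = d ^ Fintype.card ι) (hc : c = cMI ι d) :
    ∃ (x : (ι → Fin d) → ι → PowerSeries K) (ρ : K[X]) (χ : K[X][X]) (Q : ι → K[X][X]) (θ : (ι → Fin d) → PowerSeries K),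
      (∀ s i, PowerSeries.constantCoeff (x s i) = a (s i)) ∧
      (∀ s i, aeval (x s i) (∏ j, (X - C (a j))) + PowerSeries.X * MvPolynomial.aeval (x s) (g i) = 0) ∧
      ρ ≠ 0 ∧ ρ.natDegree ≤ c ∧ χ.Monic ∧ BD (n * c) n χ ∧ (∀ i, BD (n * c + c) n (Q i)) ∧
      (∀ s, θ s = ρ * ∑ i, PowerSeries.C (l i) * x s i) ∧
      (∀ s, ev2 PowerSeries.X (θ s) χ = 0) ∧ (∀ s, ev2 PowerSeries.X (θ s) (derivative χ) ≠ 0) ∧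
      (∀ s i, ev2 PowerSeries.X (θ s) (Q i) = ρ * x s i * ev2 PowerSeries.X (θ s) (derivative χ)) := by
  classical
  set p : K[X] := ∏ j, (X - C (a j)) with hp
  have hpm : p.Monic := monic_prod_of_monic _ _ fun j _ => monic_X_sub_C _
  have hpd : p.natDegree = d := by
    rw [hp, natDegree_prod_of_monic _ _ (fun j _ => monic_X_sub_C _)]; simp
  have hx : ∀ s : ι → Fin d, ∃ x : ι → PowerSeries K, (∀ i, PowerSeries.constantCoeff (x i) = a (s i)) ∧
      ∀ i, aeval (x i) p + PowerSeries.X * MvPolynomial.aeval x (g i) = 0 := by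
    intro s
    refine hens_pts p g (fun i => a (s i)) (fun i => ∏ j ∈ Finset.univ.erase (s i), (X - C (a j))) ?_ ?_
    · intro i
      exact (Finset.mul_prod_erase _ _ (Finset.mem_univ _)).symm
    · intro i
      rw [eval_prod, Finset.prod_ne_zero_iff]
      intro j hj
      simp only [eval_sub, eval_X, eval_C]
      exact sub_ne_zero.2 (fun h => (Finset.ne_of_mem_erase hj) (ha h).symm)
  choose x hx0 hxz using hx
  obtain ⟨ρ, N, hρ0, hρd, hNd, hN⟩ := elim d _ hd le_rfl p hpm hpd g hg
  rw [← cMI, ← hc] at hρd hNd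
  let φ : K[X] →+* PowerSeries K := (aeval (PowerSeries.X : PowerSeries K) : K[X] →ₐ[K] _)
  have hφ : ∀ r : K[X], φ r = (r : PowerSeries K) := aeval_ps_X
  have hφC : ∀ r : K, φ (C r) = PowerSeries.C r := by intro r; rw [hφ]; simp
  let θ : (ι → Fin d) → PowerSeries K := fun s => ρ * ∑ i, PowerSeries.C (l i) * x s i
  let V : Matrix (ι → Fin d) (ι → Fin d) (PowerSeries K) := Matrix.of fun s b => ∏ j, x s j ^ (b j : ℕ)
  have hV : V.det ≠ 0 := by
    intro h
    have h1 := congrArg (PowerSeries.constantCoeff) h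
    rw [RingHom.map_det, map_zero] at h1
    refine det_grid_ne (ι := ι) d a ha ?_
    rw [← h1]
    congr 1
    ext1 s b
    simp [V, hx0]
  let Nm : ι → Matrix (ι → Fin d) (ι → Fin d) K[X] := fun i => Matrix.of (N i)
  have hVN : ∀ i, V * (Nm i).map φ = Matrix.diagonal (fun s => (ρ : PowerSeries K) * x s i) * V := by
    intro i
    ext1 s b
    rw [Matrix.mul_apply, Matrix.diagonal_mul]
    simp only [Matrix.map_apply, Nm, V, Matrix.of_apply, hφ]
    rw [← hN (x s) (hxz s) i b]; ring
  let Nl : Matrix (ι → Fin d) (ι → Fin d) K[X] := ∑ i, C (l i) • Nm i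
  have hVl : V * Nl.map φ = Matrix.diagonal θ * V := by
    have e1 : Nl.map φ = ∑ i, PowerSeries.C (l i) • (Nm i).map φ := by
      ext1 s b
      simp only [Nl, Matrix.map_apply, Matrix.sum_apply, Matrix.smul_apply, map_sum, smul_eq_mul, map_mul, hφC]
    rw [e1, Finset.mul_sum]
    simp only [Matrix.mul_smul, hVN]
    ext1 s b
    simp only [Matrix.sum_apply, Matrix.smul_apply, Matrix.diagonal_mul, θ, smul_eq_mul]
    rw [Finset.mul_sum, Finset.sum_mul]
    refine Finset.sum_congr rfl fun i _ => by ring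
  have hθ : Function.Injective θ := by
    intro s s' h
    apply hl
    have h1 := congrArg PowerSeries.constantCoeff h
    simp only [θ, map_mul, map_sum, PowerSeries.constantCoeff_C, hx0] at h1
    have h2 : PowerSeries.constantCoeff (ρ : PowerSeries K) = 1 := by
      rw [← PowerSeries.coeff_zero_eq_constantCoeff_apply, Polynomial.coeff_coe, coeff_zero_eq_eval_zero, hρ0]
    simpa [h2] using h1
  have hcard : Fintype.card (ι → Fin d) = n := by simp [hn]
  have hcj := fun i => conj φ V hV Nl (Nm i) θ _ hVl (hVN i)
  have hχ : Nl.charpoly.map φ = ∏ s, (X - C (θ s)) := by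
    have := fun i => (hcj i).1
    rcases isEmpty_or_nonempty ι with h | ⟨⟨i⟩⟩
    · have hN0 : V * (0 : Matrix (ι → Fin d) (ι → Fin d) K[X]).map φ = Matrix.diagonal (fun _ => 0) * V := by simp
      exact (conj φ V hV Nl 0 θ _ hVl hN0).1
    · exact (hcj i).1
  have hder : ∀ s, ev2 PowerSeries.X (θ s) (derivative Nl.charpoly) = ∏ s' ∈ Finset.univ.erase s, (θ s - θ s') := by
    intro s
    rw [ev2_eq_eval]
    change eval (θ s) ((derivative Nl.charpoly).map φ) = _
    rw [← derivative_map, hχ, derivative_prod_finset, eval_finsetSum, Finset.sum_eq_single s]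
    · simp [eval_prod]
    · intro s' _ hs'
      rw [eval_mul, eval_prod, Finset.prod_eq_zero (i := s)]
      · simp
      · simp [hs'.symm]
      · simp
    · simp
  have hNl : ∀ s b, (Nl s b).natDegree ≤ c := by
    intro s b
    simp only [Nl, Matrix.sum_apply, Matrix.smul_apply, smul_eq_mul]
    exact natDegree_sum_le_of_forall_le _ _ fun i _ => (natDegree_C_mul_le _ _).trans (hNd i s b)
  have hchm : ∀ s b, BD c 1 (Nl.charmatrix s b) := by
    intro s b
    rw [Matrix.charmatrix_apply]
    refine BD.sub ?_ ((BD.C (hNl s b)).mono le_rfl (Nat.zero_le _))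
    rw [Matrix.diagonal_apply]
    split_ifs
    · exact BD.X.mono (Nat.zero_le _) le_rfl
    · exact BD.zero
  refine ⟨x, ρ, Nl.charpoly, fun i => Matrix.trace (Nl.charmatrix.adjugate * (Nm i).map C), θ, hx0, hxz, ?_, hρd,
    Matrix.charpoly_monic _, ?_, ?_, fun s => rfl, ?_, ?_, ?_⟩
  · rintro rfl; simp at hρ0
  · have hb := BD.det hchm
    rw [hcard] at hb; simpa [Matrix.charpoly] using hb
  · intro i
    simp only [Matrix.trace, Matrix.diag_apply, Matrix.mul_apply, Matrix.map_apply]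
    refine BD.sum _ fun s _ => BD.sum _ fun b _ => ?_
    have h1 := BD.adj hchm s b
    rw [hcard] at h1
    simpa [Nm] using h1.mul (BD.C (hNd i b s))
  · intro s
    rw [ev2_eq_eval]
    change eval (θ s) (Nl.charpoly.map φ) = _
    rw [hχ, eval_prod, Finset.prod_eq_zero (Finset.mem_univ s)]
    simp
  · intro s
    rw [hder, Finset.prod_ne_zero_iff]
    intro s' hs'
    exact sub_ne_zero.2 fun h => Finset.ne_of_mem_erase hs' (hθ h).symm
  · intro s i
    rw [hder, ev2_eq_eval]
    change eval (θ s) (Polynomial.map φ _) = _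
    rw [(hcj i).2, eval_finsetSum, Finset.sum_eq_single s]
    · simp [eval_prod]; ring
    · intro s' _ hs'
      rw [eval_mul, eval_prod, Finset.prod_eq_zero (i := s)]
      · simp
      · simp [hs'.symm]
      · simp
    · simp
end S5

namespace S5
open Polynomial

lemma exists_min {K : Type*} [Field K] (u : PowerSeries K) (χ : K[X][X]) (hm : χ.Monic) (h0 : ev2 PowerSeries.X u χ = 0) :
    ∃ H : K[X][X], H.Monic ∧ ev2 PowerSeries.X u H = 0 ∧ ∀ P : K[X][X], ev2 PowerSeries.X u P = 0 → H ∣ P := by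
  have hal : ∀ r : K[X], algebraMap K[X] (PowerSeries K) r = (r : PowerSeries K) := by
    intro r
    rw [PowerSeries.algebraMap_apply']; simp
  have he : ∀ P : K[X][X], ev2 PowerSeries.X u P = aeval u P := by
    intro P
    rw [ev2_eq_eval, ← eval_map_algebraMap]
    have : ((aeval (PowerSeries.X : PowerSeries K) : K[X] →ₐ[K] _) : K[X] →+* PowerSeries K) = algebraMap K[X] (PowerSeries K) := by
      refine RingHom.ext fun r => ?_
      rw [hal]; exact aeval_ps_X r
    rw [this]
  have : Module.IsTorsionFree K[X] (PowerSeries K) := by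
    rw [Module.isTorsionFree_iff_algebraMap_injective]
    intro r s h
    rw [hal, hal] at h
    exact Polynomial.coe_injective K h
  have hint : IsIntegral K[X] u := ⟨χ, hm, by rw [← aeval_def, ← he, h0]⟩
  refine ⟨minpoly K[X] u, minpoly.monic hint, by rw [he, minpoly.aeval], fun P hP => ?_⟩
  exact minpoly.isIntegrallyClosed_dvd hint (by rw [← he]; exact hP)

/-- homogenisation -/
noncomputable def hmg {K S ι : Type*} [Field K] [CommRing S] [Algebra K S] (d : ℕ) (E : S) (Q : ι → S) (G : MvPolynomial ι K) : S :=
  ∑ s ∈ G.support, algebraMap K S (G.coeff s) * (E ^ (d - s.degree) * s.prod fun i n => Q i ^ n)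

lemma hmg_map {K S B ι : Type*} [Field K] [CommRing S] [Algebra K S] [CommRing B] [Algebra K B] (d : ℕ) (E : S) (Q : ι → S)
    (G : MvPolynomial ι K) (hG : G.totalDegree ≤ d) (φ : S →+* B) (hφ : ∀ r, φ (algebraMap K S r) = algebraMap K B r)
    (x : ι → B) (hx : ∀ i, φ (Q i) = x i * φ E) : φ (hmg d E Q G) = φ E ^ d * MvPolynomial.aeval x G := by
  rw [hmg, map_sum, MvPolynomial.aeval_def, MvPolynomial.eval₂_eq, Finset.mul_sum]
  refine Finset.sum_congr rfl fun s hs => ?_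
  rw [map_mul, hφ, map_mul, map_pow, Finsupp.prod, map_prod]
  simp only [map_pow, hx, mul_pow, Finset.prod_mul_distrib]
  rw [Finset.prod_pow_eq_pow_sum]
  have h1 : s.degree ≤ d := (MvPolynomial.le_totalDegree hs).trans hG
  have h2 : φ E ^ d = φ E ^ (d - s.degree) * φ E ^ (∑ i ∈ s.support, s i) := by
    rw [← pow_add]; congr 1
    have : ∑ i ∈ s.support, s i = s.degree := rfl
    omega
  rw [h2]; ring

lemma ev2_K {K : Type*} [Field K] (τ y : K) (P : K[X][X]) : ev2 τ y P = eval y (P.map (evalRingHom τ)) := by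
  rw [ev2_eq_eval]
  congr 2
end S5

namespace S5
open Polynomial

lemma fiber (k d : ℕ) (hk : 0 < k) (hd : 0 < d) : ∃ n0 e0 c0 : ℕ, ∀ (K : Type) [Field K] [Fintype K] [DecidableEq K]
    (a : Fin d → K) (_ : Function.Injective a) (l : Fin (d^k) × Fin k → K)
    (_ : ∀ s s' : Fin (d^k) × Fin k → Fin d, ∑ i, l i * a (s i) = ∑ i, l i * a (s' i) → s = s')
    (g : Fin k → MvPolynomial (Fin k) K) (_ : ∀ i, (g i).totalDegree ≤ d),
    ∃ (n : ℕ) (u : PowerSeries K) (H : K[X][X]) (Bd : Finset K), 0 < n ∧ n ≤ n0 ∧ H.Monic ∧ H.natDegree = n ∧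
      (∀ j, (H.coeff j).natDegree ≤ e0) ∧ ev2 PowerSeries.X u H = 0 ∧
      (∀ P : K[X][X], P ≠ 0 → P.natDegree < n → ev2 PowerSeries.X u P ≠ 0) ∧ Bd.card ≤ c0 ∧
      (∀ τ ∉ Bd, (H.map (evalRingHom τ)).Separable) ∧
      ∀ τ ∉ Bd, (H.map (evalRingHom τ)).roots.toFinset.card ≤
        (Nat.card {x : Fin k → K // ∀ i, aeval (x i) (∏ j, (X - C (a j))) + τ * MvPolynomial.aeval x (g i) = 0}).descFactorial (d^k) := by
  classical
  set D := d ^ k with hD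
  set c := cMI (Fin D × Fin k) d with hc
  set n0 := d ^ Fintype.card (Fin D × Fin k) with hn0
  set S : Finset (Fin D × Fin D) := Finset.univ.filter (fun p => p.1 ≠ p.2) with hS
  set E0 := c + n0 * c + S.card * (n0 * c + c) with hE0
  set N0 := 0 + n0 + S.card * n0 with hN0
  refine ⟨n0, n0 * c, n0 * E0 + N0 * (n0 * c), ?_⟩
  intro K _ _ _ a ha l hl g hg
  have hgd : ∀ i : Fin D × Fin k, (MvPolynomial.rename (Prod.mk i.1) (g i.2)).totalDegree ≤ d := fun i =>
    (MvPolynomial.totalDegree_rename_le _ _).trans (hg _)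
  obtain ⟨x, ρ, χ, Q, θ, hx0, hxz, hρ, hρd, hχm, hχB, hQB, hθ, hθχ, hθd, hQ⟩ :=
    geo (ι := Fin D × Fin k) d hd a ha (fun i => MvPolynomial.rename (Prod.mk i.1) (g i.2)) hgd l hl n0 c hn0 hc
  have eqv : Fin D ≃ (Fin k → Fin d) := Fintype.equivOfCardEq (by simp [hD])
  let s0 : Fin D × Fin k → Fin d := fun i => eqv i.1 i.2
  obtain ⟨H, hHm, hH0, hHd⟩ := exists_min (θ s0) χ hχm (hθχ s0)
  have hHχ : H ∣ χ := hHd _ (hθχ s0)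
  have hHB : BD (n0 * c) n0 H := BD_dvd hχB hχm.ne_zero hHχ
  have hρu : ev2 PowerSeries.X (θ s0) (C ρ) = (ρ : PowerSeries K) := by rw [ev2_C, aeval_ps_X]
  set E : K[X][X] := C ρ * derivative χ with hE
  have hEu : ev2 PowerSeries.X (θ s0) E = ρ * ev2 PowerSeries.X (θ s0) (derivative χ) := by rw [hE, map_mul, hρu]
  have hρ' : (ρ : PowerSeries K) ≠ 0 := by
    intro h; exact hρ (Polynomial.coe_injective K (by simpa using h))
  have hEu0 : ev2 PowerSeries.X (θ s0) E ≠ 0 := by rw [hEu]; exact mul_ne_zero hρ' (hθd s0)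
  have hQE : ∀ i, ev2 PowerSeries.X (θ s0) (Q i) = x s0 i * ev2 PowerSeries.X (θ s0) E := by
    intro i; rw [hQ, hEu]; ring
  have hch : ∀ p : Fin D × Fin D, ∃ i : Fin k, p ∈ S → eqv p.1 i ≠ eqv p.2 i := by
    intro p
    by_cases h : p ∈ S
    · have h1 : eqv p.1 ≠ eqv p.2 := fun h2 => (Finset.mem_filter.1 h).2 (eqv.injective h2)
      obtain ⟨i, hi⟩ := Function.ne_iff.1 h1
      exact ⟨i, fun _ => hi⟩
    · exact ⟨⟨0, hk⟩, fun h' => absurd h' h⟩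
  choose ch hch using hch
  set W : K[X][X] := E * ∏ p ∈ S, (Q (p.1, ch p) - Q (p.2, ch p)) with hW
  have hWB : BD E0 N0 W := by
    refine BD.mul (BD.mul (BD.C hρd) hχB.deriv) (BD.prod _ fun p _ => (hQB _).sub (hQB _))
  have hWu : ev2 PowerSeries.X (θ s0) W ≠ 0 := by
    rw [hW, map_mul, map_prod]
    refine mul_ne_zero hEu0 (Finset.prod_ne_zero_iff.2 fun p hp => ?_)
    rw [map_sub, hQE, hQE, ← sub_mul]
    refine mul_ne_zero (fun h => ?_) hEu0
    have := congrArg PowerSeries.constantCoeff h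
    rw [map_sub, hx0, hx0, map_zero, sub_eq_zero] at this
    exact hch p hp (ha this)
  have hn : 0 < H.natDegree := by
    rw [Nat.pos_iff_ne_zero]
    intro h
    rw [hHm.natDegree_eq_zero.1 h] at hH0
    simp at hH0
  have hmin : ∀ P : K[X][X], P ≠ 0 → P.natDegree < H.natDegree → ev2 PowerSeries.X (θ s0) P ≠ 0 := by
    intro P hP hlt h0
    exact absurd (natDegree_le_of_dvd (hHd P h0) hP) (by omega)
  have hr0 := res_ne_zero _ (θ s0) H W _ N0 hHm rfl hH0 hmin hWB.1 hWu
  have hrd := res_natDegree_le H W H.natDegree N0 _ _ hHB.2 hWB.2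
  obtain ⟨A, B, -, -, hAB⟩ := exists_mul_add_mul_eq_C_resultant H W le_rfl hWB.1 (Or.inl hn.ne')
  set r := resultant H W H.natDegree N0 with hr
  have hroot : ∀ τ ∉ r.roots.toFinset, r.eval τ ≠ 0 := by
    intro τ hτ h
    exact hτ (Multiset.mem_toFinset.2 ((mem_roots hr0).2 h))
  have hWτ : ∀ τ ∉ r.roots.toFinset, ∀ y, ev2 τ y H = 0 → ev2 τ y W ≠ 0 := by
    intro τ hτ y hy hw
    have := congrArg (ev2 τ y) hAB
    rw [map_add, map_mul, map_mul, hy, hw, ev2_C] at this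
    apply hroot τ hτ
    rw [← coe_aeval_eq_eval, ← this]; ring
  refine ⟨H.natDegree, θ s0, H, r.roots.toFinset, hn, hHB.1, hHm, rfl, hHB.2, hH0, hmin, ?_, ?_, ?_⟩
  · refine (Multiset.toFinset_card_le _).trans ((card_roots' r).trans (hrd.trans ?_))
    have := hHB.1
    gcongr
  · intro τ hτ
    obtain ⟨H2, hH2⟩ := hHχ
    have h1 := congrArg (Polynomial.map (evalRingHom τ)) hAB
    have h2 : W = (C ρ * ∏ p ∈ S, (Q (p.1, ch p) - Q (p.2, ch p))) * (derivative H * H2 + H * derivative H2) := by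
      rw [hW, hE, hH2, derivative_mul]; ring
    rw [h2] at h1
    simp only [Polynomial.map_add, Polynomial.map_mul, map_C, coe_evalRingHom] at h1
    rw [Polynomial.separable_def]
    have h3 : C (r.eval τ)⁻¹ * C (r.eval τ) = 1 := by rw [← C_mul, inv_mul_cancel₀ (hroot τ hτ), C_1]
    rw [derivative_map]
    set G := Polynomial.map (evalRingHom τ) (∏ p ∈ S, (Q (p.1, ch p) - Q (p.2, ch p))) with hG
    refine ⟨C (r.eval τ)⁻¹ * (Polynomial.map (evalRingHom τ) A + Polynomial.map (evalRingHom τ) B * (C (ρ.eval τ) * G) * Polynomial.map (evalRingHom τ) (derivative H2)),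
      C (r.eval τ)⁻¹ * (Polynomial.map (evalRingHom τ) B * (C (ρ.eval τ) * G) * Polynomial.map (evalRingHom τ) H2), ?_⟩
    rw [← h3]
    linear_combination C (r.eval τ)⁻¹ * h1
  · intro τ hτ
    set Zs := {x : Fin k → K // ∀ i, aeval (x i) (∏ j, (X - C (a j))) + τ * MvPolynomial.aeval x (g i) = 0} with hZs
    have hspec : ∀ P : K[X][X], ev2 PowerSeries.X (θ s0) P = 0 → ∀ y, ev2 τ y H = 0 → ev2 τ y P = 0 := by
      intro P hP y hy
      obtain ⟨P', rfl⟩ := hHd P hP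
      rw [map_mul, hy, zero_mul]
    have hy0 : ∀ y : {y // y ∈ (H.map (evalRingHom τ)).roots.toFinset}, ev2 τ y.1 H = 0 := by
      intro y
      have := y.2
      rw [Multiset.mem_toFinset, mem_roots (hHm.map _).ne_zero] at this
      rw [ev2_K]; exact this
    have hEy : ∀ y, ev2 τ y H = 0 → ev2 τ y E ≠ 0 := by
      intro y hy h
      apply hWτ τ hτ y hy
      rw [hW, map_mul, h, zero_mul]
    let xx : K → Fin D × Fin k → K := fun y i => ev2 τ y (Q i) / ev2 τ y E
    have hxx : ∀ y, ev2 τ y H = 0 → ∀ i, ev2 τ y (Q i) = xx y i * ev2 τ y E := by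
      intro y hy i
      exact (div_mul_cancel₀ _ (hEy y hy)).symm
    have halg : ∀ {B : Type} [CommRing B] [Algebra K B] (t y : B) (r : K), ev2 t y (algebraMap K K[X][X] r) = algebraMap K B r := by
      intro B _ _ t y r
      exact ev2_CC t y r
    have hzero : ∀ y, ev2 τ y H = 0 → ∀ (j : Fin D) (i : Fin k), aeval (xx y (j, i)) (∏ j, (X - C (a j))) + τ * MvPolynomial.aeval (fun i => xx y (j, i)) (g i) = 0 := by
      intro y hy j i
      let G0 : MvPolynomial (Fin D × Fin k) K := aeval (MvPolynomial.X (j, i)) (∏ j, (X - C (a j)))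
      let G1 : MvPolynomial (Fin D × Fin k) K := MvPolynomial.rename (Prod.mk j) (g i)
      have hG0 : G0.totalDegree ≤ d := tdeg_aeval_X _ _ _ (by
        rw [natDegree_prod_of_monic _ _ (fun j _ => monic_X_sub_C _)]; simp)
      have hG1 : G1.totalDegree ≤ d := hgd (j, i)
      have hG0e : ∀ {B : Type} [CommRing B] [Algebra K B] (z : Fin D × Fin k → B),
          MvPolynomial.aeval z G0 = aeval (z (j, i)) (∏ j, (X - C (a j))) := by
        intro B _ _ z
        rw [← aeval_algHom_apply, MvPolynomial.aeval_X]
      have hG1e : ∀ {B : Type} [CommRing B] [Algebra K B] (z : Fin D × Fin k → B),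
          MvPolynomial.aeval z G1 = MvPolynomial.aeval (fun i => z (j, i)) (g i) := by
        intro B _ _ z
        rw [MvPolynomial.aeval_rename]; rfl
      have h1 : ev2 PowerSeries.X (θ s0) (hmg d E Q G0 + C X * hmg d E Q G1) = 0 := by
        rw [map_add, map_mul, hmg_map d E Q G0 hG0 _ (halg _ _) _ hQE, hmg_map d E Q G1 hG1 _ (halg _ _) _ hQE, ev2_C, aeval_X, hG0e]
        linear_combination (ev2 PowerSeries.X (θ s0) E ^ d) * hxz s0 (j, i)
      have h2 := hspec _ h1 y hy
      rw [map_add, map_mul, hmg_map d E Q G0 hG0 _ (halg _ _) _ (hxx y hy), hmg_map d E Q G1 hG1 _ (halg _ _) _ (hxx y hy), ev2_C, aeval_X, hG0e, hG1e] at h2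
      have h3 : ev2 τ y E ^ d ≠ 0 := pow_ne_zero _ (hEy y hy)
      refine (mul_eq_zero.1 (?_ : ev2 τ y E ^ d * _ = 0)).resolve_left h3
      linear_combination h2
    have hdist : ∀ y, ev2 τ y H = 0 → Function.Injective (fun j : Fin D => fun i => xx y (j, i)) := by
      intro y hy j j' hjj
      by_contra hne
      apply hWτ τ hτ y hy
      have hp : (j, j') ∈ S := by simp [hS, hne]
      rw [hW, map_mul, map_prod, Finset.prod_eq_zero hp, mul_zero]
      rw [map_sub, hxx y hy, hxx y hy]
      have := congrFun hjj (ch (j, j'))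
      simp only at this
      rw [this, sub_self]
    have hinj : ∀ y, ev2 τ y H = 0 → y = ρ.eval τ * ∑ i, l i * xx y i := by
      intro y hy
      have h1 : ev2 PowerSeries.X (θ s0) (∑ i, C (C (l i)) * Q i - X * derivative χ) = 0 := by
        rw [map_sub, map_sum, map_mul, ev2_X, sub_eq_zero]
        simp only [map_mul, hQ, ev2_CC]
        generalize ev2 PowerSeries.X (θ s0) (derivative χ) = w
        rw [hθ s0]
        rw [Finset.mul_sum, Finset.sum_mul]
        refine Finset.sum_congr rfl fun i _ => ?_
        rw [show (algebraMap K (PowerSeries K)) = PowerSeries.C from rfl]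
        ring
      have h2 := hspec _ h1 y hy
      rw [map_sub, map_sum, map_mul, ev2_X, sub_eq_zero] at h2
      have hEv : ev2 τ y E = ρ.eval τ * ev2 τ y (derivative χ) := by rw [hE, map_mul, ev2_C, coe_aeval_eq_eval]
      simp only [map_mul, hxx y hy, ev2_CC, hEv, Algebra.algebraMap_self, RingHom.id_apply] at h2
      have h3 : ev2 τ y (derivative χ) ≠ 0 := by
        intro h; apply hEy y hy; rw [hEv, h, mul_zero]
      apply mul_right_cancel₀ h3
      rw [← h2, Finset.mul_sum, Finset.sum_mul]
      exact Finset.sum_congr rfl fun i _ => by ring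
    let f : {y // y ∈ (H.map (evalRingHom τ)).roots.toFinset} → (Fin D ↪ Zs) := fun y =>
      ⟨fun j => ⟨fun i => xx y.1 (j, i), fun i => hzero y.1 (hy0 y) j i⟩, fun j j' h =>
        hdist y.1 (hy0 y) (congrArg Subtype.val h)⟩
    have hf : Function.Injective f := by
      intro y y' h
      apply Subtype.ext
      rw [hinj y.1 (hy0 y), hinj y'.1 (hy0 y')]
      have : xx y.1 = xx y'.1 := by
        funext ⟨j, i⟩
        have := congrArg (fun e : Fin D ↪ Zs => (e j).1 i) h
        exact this
      rw [this]
    have h1 := Fintype.card_le_of_injective f hf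
    rw [Fintype.card_coe, Fintype.card_embedding_eq, Fintype.card_fin] at h1
    rwa [Nat.card_eq_fintype_card]
end S5

namespace S5

abbrev TT (k d : ℕ) (K : Type) [Field K] := Fin k → MvPolynomial.restrictTotalDegree (Fin k) K d

noncomputable def ZZ {k d : ℕ} {K : Type} [Field K] (f : TT k d K) : ℕ :=
  Nat.card {x : Fin k → K // ∀ i, MvPolynomial.eval x (f i).1 = 0}

lemma exists_sep' {K ι : Type*} [Field K] [Fintype K] [Fintype ι] (d : ℕ) (a : Fin d → K) (ha : Function.Injective a)
    (h : d ^ Fintype.card ι * d ^ Fintype.card ι * Fintype.card ι < Fintype.card K) :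
    ∃ l : ι → K, ∀ s s' : ι → Fin d, ∑ i, l i * a (s i) = ∑ i, l i * a (s' i) → s = s' := by
  classical
  let e := Fintype.equivFin ι
  let V : Finset (Fin (Fintype.card ι) → K) := Finset.univ.image (fun s : ι → Fin d => fun j => a (s (e.symm j)))
  have hV : V.card ≤ d ^ Fintype.card ι := Finset.card_image_le.trans (by simp)
  obtain ⟨l, hl⟩ := exists_separating _ V Finset.univ (by
    rw [Finset.card_univ]; refine lt_of_le_of_lt ?_ h; gcongr)
  refine ⟨fun i => l (e i), fun s s' hs => ?_⟩
  have := hl (fun j => a (s (e.symm j))) (Finset.mem_image_of_mem _ (Finset.mem_univ s))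
    (fun j => a (s' (e.symm j))) (Finset.mem_image_of_mem _ (Finset.mem_univ s')) (by
      rw [← e.sum_comp, ← e.sum_comp]; simpa using hs)
  funext i
  have h2 := congrFun this (e i)
  simpa using ha h2

lemma avg {K T : Type*} [Field K] [Fintype K] [DecidableEq K] [AddCommGroup T] [Module K T] [Fintype T] (f0 : T) (P : T → Prop) [DecidablePred P] :
    ∑ g : T, (Finset.univ.filter (fun τ : K => P (f0 + τ • g))).card ≤
      Fintype.card T + Fintype.card K * (Finset.univ.filter P).card := by
  classical
  have h1 : ∑ g : T, (Finset.univ.filter (fun τ : K => P (f0 + τ • g))).card =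
      ∑ τ : K, (Finset.univ.filter (fun g : T => P (f0 + τ • g))).card := by
    simp only [Finset.card_filter]
    exact Finset.sum_comm
  rw [h1, ← Finset.add_sum_erase _ _ (Finset.mem_univ (0:K))]
  refine add_le_add (Finset.card_le_univ _) ?_
  refine (Finset.sum_le_card_nsmul _ _ (Finset.univ.filter P).card ?_).trans ?_
  · intro τ hτ
    refine Finset.card_le_card_of_injOn (fun g => f0 + τ • g) ?_ ?_
    · intro g hg; simpa using hg
    · intro g _ g' _ h
      have := add_left_cancel h
      exact smul_right_injective T (Finset.ne_of_mem_erase hτ) this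
  · rw [smul_eq_mul]
    exact Nat.mul_le_mul_right _ (Finset.card_le_univ _)

open Polynomial in
lemma line (k d : ℕ) (hk : 0 < k) (hd : 0 < d) : ∃ n0 C1 : ℕ, ∀ ε : ℝ, 0 < ε → ∃ Q : ℕ, ∀ (K : Type) [Field K] [Fintype K] [DecidableEq K],
    Q ≤ Fintype.card K → ∃ f0 : TT k d K, ∀ g : TT k d K,
      (1 - ε) * (Fintype.card K : ℝ) - C1 ≤ (Nat.factorial (d^k) : ℝ) * (Finset.univ.filter (fun τ : K => ZZ (f0 + τ • g) = d^k)).card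
        + n0 * (Finset.univ.filter (fun τ : K => d^k < ZZ (f0 + τ • g))).card := by
  classical
  obtain ⟨n0, e0, c0, hfib⟩ := fiber k d hk hd
  refine ⟨n0, n0 * c0, fun ε hε => ?_⟩
  have hst : ∀ n : ℕ, ∃ Q : ℕ, 0 < n → ∀ (K : Type) [Field K] [Fintype K] [DecidableEq K],
    Q ≤ Fintype.card K → ∀ (u : PowerSeries K) (H : K[X][X]), H.Monic → H.natDegree = n →
    (∀ j, (H.coeff j).natDegree ≤ e0) → ev2 PowerSeries.X u H = 0 →
    (∀ P : K[X][X], P ≠ 0 → P.natDegree < n → ev2 PowerSeries.X u P ≠ 0) →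
    ∀ (Bd : Finset K), (∀ τ ∉ Bd, (H.map (evalRingHom τ)).Separable) →
    (1 - ε) * (Fintype.card K : ℝ) - n * (Bd.card : ℝ) ≤
      ((∑ τ ∈ Finset.univ \ Bd, (H.map (evalRingHom τ)).roots.toFinset.card : ℕ) : ℝ) := by
    intro n
    by_cases hn : 0 < n
    · obtain ⟨Q, hQ⟩ := stepanov n e0 hn ε hε
      exact ⟨Q, fun _ => hQ⟩
    · exact ⟨0, fun h => absurd h hn⟩
  choose Qn hQn using hst
  set m := Fintype.card (Fin (d^k) × Fin k) with hm
  refine ⟨(∑ n ∈ Finset.range (n0 + 1), Qn n) + d + (d ^ m * d ^ m * m + 1), fun K _ _ _ hq => ?_⟩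
  obtain ⟨a⟩ : Nonempty (Fin d ↪ K) := Function.Embedding.nonempty_of_card_le (by rw [Fintype.card_fin]; omega)
  obtain ⟨l, hl⟩ := exists_sep' (ι := Fin (d^k) × Fin k) d a a.injective (by rw [← hm]; omega)
  have hpd : (∏ j, (X - C (a j))).natDegree ≤ d := by
    rw [natDegree_prod_of_monic _ _ (fun j _ => monic_X_sub_C _)]; simp
  let f0 : TT k d K := fun i => ⟨aeval (MvPolynomial.X i) (∏ j, (X - C (a j))),
    (MvPolynomial.mem_restrictTotalDegree _ _ _).2 (tdeg_aeval_X i _ d hpd)⟩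
  refine ⟨f0, fun g => ?_⟩
  obtain ⟨n, u, H, Bd, hn, hn0, hHm, hHn, hHe, hHu, hmin, hBd, hsep, hroots⟩ :=
    hfib K a a.injective l hl (fun i => (g i).1) (fun i => (MvPolynomial.mem_restrictTotalDegree _ _ _).1 (g i).2)
  have hQle : Qn n ≤ ∑ n ∈ Finset.range (n0 + 1), Qn n :=
    Finset.single_le_sum (f := Qn) (fun _ _ => Nat.zero_le _) (Finset.mem_range.2 (by omega))
  have h1 := hQn n hn K (by omega) u H hHm hHn hHe hHu hmin Bd hsep
  have hZ : ∀ τ : K, Nat.card {x : Fin k → K // ∀ i, aeval (x i) (∏ j, (X - C (a j))) + τ * MvPolynomial.aeval x (g i).1 = 0} = ZZ (f0 + τ • g) := by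
    intro τ
    unfold ZZ
    refine Nat.card_congr (Equiv.subtypeEquivRight fun x => forall_congr' fun i => ?_)
    have : MvPolynomial.eval x ((f0 + τ • g) i).1 = aeval (x i) (∏ j, (X - C (a j))) + τ * MvPolynomial.aeval x (g i).1 := by
      have e1 : MvPolynomial.aeval x (aeval (MvPolynomial.X i : MvPolynomial (Fin k) K) (∏ j, (X - C (a j)))) = aeval (x i) (∏ j, (X - C (a j))) := by
        rw [← aeval_algHom_apply, MvPolynomial.aeval_X]
      have e2 : ((f0 + τ • g) i).1 = aeval (MvPolynomial.X i) (∏ j, (X - C (a j))) + τ • (g i).1 := rfl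
      rw [e2, ← e1, ← MvPolynomial.coe_aeval_eq_eval]
      simp only [RingHom.coe_coe, map_add, map_smul, smul_eq_mul]
    rw [this]
  have h2 : ∑ τ ∈ Finset.univ \ Bd, (H.map (evalRingHom τ)).roots.toFinset.card ≤
      Nat.factorial (d^k) * (Finset.univ.filter (fun τ : K => ZZ (f0 + τ • g) = d^k)).card
        + n0 * (Finset.univ.filter (fun τ : K => d^k < ZZ (f0 + τ • g))).card := by
    rw [Finset.card_filter, Finset.card_filter, Finset.mul_sum, Finset.mul_sum, ← Finset.sum_add_distrib]
    refine (Finset.sum_le_sum (g := fun τ => Nat.factorial (d^k) * (if ZZ (f0 + τ • g) = d^k then 1 else 0) + n0 * (if d^k < ZZ (f0 + τ • g) then 1 else 0)) ?_).trans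
      (Finset.sum_le_sum_of_subset (Finset.subset_univ _))
    intro τ hτ
    have hr := hroots τ (by simpa using hτ)
    rw [hZ] at hr
    rcases lt_trichotomy (ZZ (f0 + τ • g)) (d^k) with h | h | h
    · rw [Nat.descFactorial_eq_zero_iff_lt.2 h] at hr; omega
    · rw [h, Nat.descFactorial_self] at hr
      simp only [h, if_true]; omega
    · have h3 : (H.map (evalRingHom τ)).roots.toFinset.card ≤ n0 := by
        refine (Multiset.toFinset_card_le _).trans ((card_roots' _).trans (natDegree_map_le.trans ?_))
        omega
      simp only [h, if_true]; omega
  have h3 : ((∑ τ ∈ Finset.univ \ Bd, (H.map (evalRingHom τ)).roots.toFinset.card : ℕ) : ℝ) ≤ _ := Nat.cast_le.2 h2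
  have h4 : (n : ℝ) * Bd.card ≤ n0 * c0 := by
    have : n * Bd.card ≤ n0 * c0 := Nat.mul_le_mul hn0 hBd
    exact_mod_cast this
  push_cast at h3 h1 ⊢
  linarith

lemma parta (k d : ℕ) (hk : 0 < k) (hd : 0 < d) (ε : ℝ) (hε : 0 < ε) : ∃ Q : ℕ, ∀ (K : Type) [Field K] [Fintype K],
    Q ≤ Fintype.card K → (1 - ε) / (Nat.factorial (d ^ k) : ℝ) * (Nat.card (TT k d K) : ℝ) ≤
      (Nat.card {f : TT k d K // ZZ f = d ^ k} : ℝ) := by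
  classical
  obtain ⟨n0, C1, hline⟩ := line k d hk hd
  obtain ⟨Cm, hb⟩ := partb k d hd
  obtain ⟨Q, hQ⟩ := hline (ε/2) (by linarith)
  set C2 : ℕ := C1 + Nat.factorial (d^k) + n0 + n0 * Cm with hC2
  obtain ⟨Q2, hQ2⟩ := exists_nat_ge ((C2 : ℝ) / (ε/2))
  refine ⟨Q + Q2, fun K _ _ hq => ?_⟩
  have : Fintype (TT k d K) := Fintype.ofFinite _
  obtain ⟨f0, hf0⟩ := hQ K (by omega)
  have hbK := hb K
  set q := Fintype.card K with hqdef
  set tot := Fintype.card (TT k d K) with htot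
  set A := (Finset.univ.filter (fun f : TT k d K => ZZ f = d^k)).card with hA
  set B := (Finset.univ.filter (fun f : TT k d K => d^k < ZZ f)).card with hB
  have e1 : Nat.card {f : TT k d K // ZZ f = d ^ k} = A := by
    rw [Nat.card_eq_fintype_card, Fintype.card_subtype]
  have e2 : Nat.card {f : TT k d K // d ^ k < ZZ f} = B := by
    rw [Nat.card_eq_fintype_card, Fintype.card_subtype]
  have e3 : Nat.card (TT k d K) = tot := Nat.card_eq_fintype_card
  have e4 : Nat.card (MvPolynomial.restrictTotalDegree (Fin k) K d) ^ k = tot := by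
    rw [← e3, Nat.card_fun]; simp
  rw [e4] at hbK
  have hqpos : 0 < q := Fintype.card_pos
  have hqB : q * B ≤ Cm * tot := by
    refine le_trans ?_ hbK
    have e2' : Nat.card {f : Fin k → MvPolynomial.restrictTotalDegree (Fin k) K d //
      d ^ k < Nat.card {x : Fin k → K // ∀ i, MvPolynomial.eval x (f i).1 = 0}} = B := e2
    rw [e2', mul_comm]
    exact Nat.mul_le_mul_left _ (Nat.le_self_pow (by omega) q)
  have s1 := avg (K := K) f0 (fun f : TT k d K => ZZ f = d^k)
  have s2 := avg (K := K) f0 (fun f : TT k d K => d^k < ZZ f)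
  rw [← hA, ← hqdef, ← htot] at s1
  rw [← hB, ← hqdef, ← htot] at s2
  have hsum := Finset.sum_le_sum (s := Finset.univ) (fun g (_ : g ∈ Finset.univ) => hf0 g)
  rw [Finset.sum_const, Finset.sum_add_distrib, ← Finset.mul_sum, ← Finset.mul_sum, Finset.card_univ, ← htot, nsmul_eq_mul] at hsum
  have s1' : (∑ g : TT k d K, ((Finset.univ.filter (fun τ : K => ZZ (f0 + τ • g) = d^k)).card : ℝ)) ≤ tot + q * A := by exact_mod_cast s1
  have s2' : (∑ g : TT k d K, ((Finset.univ.filter (fun τ : K => d^k < ZZ (f0 + τ • g))).card : ℝ)) ≤ tot + q * B := by exact_mod_cast s2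
  have hqB' : (q:ℝ) * B ≤ Cm * tot := by exact_mod_cast hqB
  have hF : (0:ℝ) < Nat.factorial (d^k) := by exact_mod_cast Nat.factorial_pos _
  have m1 := mul_le_mul_of_nonneg_left s1' hF.le
  have m2 := mul_le_mul_of_nonneg_left s2' (Nat.cast_nonneg (α := ℝ) n0)
  have m3 := mul_le_mul_of_nonneg_left hqB' (Nat.cast_nonneg (α := ℝ) n0)
  have hq2 : (C2 : ℝ) ≤ ε/2 * q := by
    have h5 : (C2 : ℝ) / (ε/2) ≤ q := hQ2.trans (by exact_mod_cast (by omega : Q2 ≤ q))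
    rw [div_le_iff₀ (by linarith)] at h5
    linarith
  have hC2' : (C2 : ℝ) = C1 + Nat.factorial (d^k) + n0 + n0 * Cm := by rw [hC2]; push_cast; ring
  have m4 := mul_le_mul_of_nonneg_left hq2 (Nat.cast_nonneg (α := ℝ) tot)
  rw [hC2'] at m4
  have hq' : (0:ℝ) < q := by exact_mod_cast hqpos
  have hfin : (q:ℝ) * ((1 - ε) * tot) ≤ q * (Nat.factorial (d^k) * A) := by
    linarith
  have := le_of_mul_le_mul_left hfin hq'
  rw [e1, e3, div_mul_eq_mul_div, div_le_iff₀ hF]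
  linarith
end S5
theorem statement_5 (k d : ℕ) (hk : 0 < k) (hd : 0 < d) :
    (∀ ε : ℝ, 0 < ε → ∃ Q : ℕ, ∀ (F : Type) [Field F] [Fintype F],
        Q ≤ Fintype.card F →
        (1 - ε) / (Nat.factorial (d ^ k) : ℝ) *
            (Nat.card {f : Fin k → MvPolynomial (Fin k) F //
              ∀ i, (f i).totalDegree ≤ d} : ℝ) ≤
          (Nat.card {f : Fin k → MvPolynomial (Fin k) F //
            (∀ i, (f i).totalDegree ≤ d) ∧
            Nat.card {x : Fin k → F // ∀ i, MvPolynomial.eval x (f i) = 0} =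
              d ^ k} : ℝ)) ∧
    (∃ C : ℝ, 0 < C ∧ ∀ (F : Type) [Field F] [Fintype F],
        (Nat.card {f : Fin k → MvPolynomial (Fin k) F //
            (∀ i, (f i).totalDegree ≤ d) ∧
            d ^ k <
              Nat.card {x : Fin k → F // ∀ i, MvPolynomial.eval x (f i) = 0}} : ℝ) ≤
          C * (Fintype.card F : ℝ) ^ (-(d : ℤ)) *
            Nat.card {f : Fin k → MvPolynomial (Fin k) F //
              ∀ i, (f i).totalDegree ≤ d}) := by
  have hT : ∀ (F : Type) [Field F], Nat.card {f : Fin k → MvPolynomial (Fin k) F // ∀ i, (f i).totalDegree ≤ d} =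
      Nat.card (S5.TT k d F) := by
    intro F _
    refine Nat.card_congr ⟨fun f i => ⟨f.1 i, (MvPolynomial.mem_restrictTotalDegree _ _ _).2 (f.2 i)⟩,
      fun f => ⟨fun i => (f i).1, fun i => (MvPolynomial.mem_restrictTotalDegree _ _ _).1 (f i).2⟩, fun _ => rfl, fun _ => rfl⟩
  have hP : ∀ (F : Type) [Field F] (P : ℕ → Prop), Nat.card {f : Fin k → MvPolynomial (Fin k) F // (∀ i, (f i).totalDegree ≤ d) ∧
        P (Nat.card {x : Fin k → F // ∀ i, MvPolynomial.eval x (f i) = 0})} =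
      Nat.card {f : S5.TT k d F // P (S5.ZZ f)} := by
    intro F _ P
    refine Nat.card_congr ⟨fun f => ⟨fun i => ⟨f.1 i, (MvPolynomial.mem_restrictTotalDegree _ _ _).2 (f.2.1 i)⟩, f.2.2⟩,
      fun f => ⟨fun i => (f.1 i).1, fun i => (MvPolynomial.mem_restrictTotalDegree _ _ _).1 (f.1 i).2, f.2⟩, fun _ => rfl, fun _ => rfl⟩
  constructor
  · intro ε hε
    obtain ⟨Q, hQ⟩ := S5.parta k d hk hd ε hε
    refine ⟨Q, fun F _ _ hq => ?_⟩
    rw [hT, hP F (fun z => z = d ^ k)]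
    exact hQ F hq
  · obtain ⟨Cm, hb⟩ := S5.partb k d hd
    refine ⟨(Cm : ℝ) + 1, by positivity, fun F _ _ => ?_⟩
    rw [hT, hP F (fun z => d ^ k < z)]
    have h := hb F
    have e4 : Nat.card (MvPolynomial.restrictTotalDegree (Fin k) F d) ^ k = Nat.card (S5.TT k d F) := by
      rw [Nat.card_fun]; simp
    rw [e4] at h
    have h1 : Nat.card {f : S5.TT k d F // d ^ k < S5.ZZ f} * Fintype.card F ^ d ≤ Cm * Nat.card (S5.TT k d F) := by
      refine le_trans (Nat.mul_le_mul_left _ ?_) h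
      exact Nat.pow_le_pow_right Fintype.card_pos (Nat.le_succ d)
    have hq : (0:ℝ) < (Fintype.card F : ℝ) ^ d := by
      have : 0 < Fintype.card F := Fintype.card_pos
      positivity
    have h2 : (Nat.card {f : S5.TT k d F // d ^ k < S5.ZZ f} : ℝ) * (Fintype.card F : ℝ) ^ d ≤ Cm * Nat.card (S5.TT k d F) := by
      exact_mod_cast h1
    rw [zpow_neg, zpow_natCast, mul_assoc, mul_comm (_⁻¹), ← mul_assoc, ← div_eq_mul_inv, le_div_iff₀ hq]
    refine h2.trans ?_
    have : (0:ℝ) ≤ Nat.card (S5.TT k d F) := Nat.cast_nonneg _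
    linarith
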